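/- (Generalized Hodge type inequality, Theorem 7.3.) Let 1 ≤ p ≤ n and let K₁, …, K_p, L₁, …, L_{n−p} be nonempty compact convex sets in ℝⁿ. Then MV(K₁, …, K_p, L₁, …, L_{n−p})^p ≥ Π_{i=1}^{p} MV(K_i^{(p)}, L₁, …, L_{n−p}). -/

import Mathlib

open scoped Pointwise
open MeasureTheory Finset

/-- Lebesgue volume of a subset of ℝⁿ, as a real number. -/
noncomputable def vol {n : ℕ} (A : Set (Fin n → ℝ)) : ℝ := (volume A).toReal

/-- The mixed volume of `n` convex bodies in ℝⁿ, defined by the inclusion–exclusion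
formula. -/
noncomputable def MV (n : ℕ) (K : Fin n → Set (Fin n → ℝ)) : ℝ :=
  ∑ j ∈ Finset.Icc 1 n, (-1 : ℝ) ^ (n - j) *
    ∑ S ∈ Finset.univ.powersetCard j, vol (∑ i ∈ S, K i)

/-- The family `(K₁, …, K_p, L₁, …, L_{n−p})` of `n` sets. -/
def combine {n p : ℕ} (hpn : p ≤ n) {α : Type*} (K : Fin p → α) (L : Fin (n - p) → α) :
    Fin n → α :=
  fun i => if h : (i : ℕ) < p then K ⟨i, h⟩
    else L ⟨(i : ℕ) - p, by have := i.isLt; omega⟩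

namespace AF
open MvPolynomial

section Alg
variable {ι : Type*} [Fintype ι]

noncomputable def D (v : ι → ℝ) : MvPolynomial ι ℝ →ₗ[ℝ] MvPolynomial ι ℝ :=
  ∑ i, v i • (pderiv i).toLinearMap

lemma D_apply (v : ι → ℝ) (g : MvPolynomial ι ℝ) : D v g = ∑ i, v i • pderiv i g := by
  simp [D]

lemma pderiv_comm (i j : ι) (g : MvPolynomial ι ℝ) :
    pderiv i (pderiv j g) = pderiv j (pderiv i g) := by
  classical
  have h : ⁅(pderiv i : Derivation ℝ (MvPolynomial ι ℝ) (MvPolynomial ι ℝ)), (pderiv j : Derivation ℝ (MvPolynomial ι ℝ) (MvPolynomial ι ℝ))⁆ = 0 := by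
    apply derivation_ext
    intro k
    rw [Derivation.commutator_apply, pderiv_X, pderiv_X]
    by_cases h1 : k = j <;> by_cases h2 : k = i <;> simp [Pi.single_apply, h1, h2] <;>
      (split_ifs <;> simp)
  have := congrArg (fun d => d g) h
  simp only [Derivation.commutator_apply] at this
  exact sub_eq_zero.mp this

lemma D_comm (v w : ι → ℝ) (g : MvPolynomial ι ℝ) : D v (D w g) = D w (D v g) := by
  simp only [D_apply, map_sum, Derivation.map_smul, smul_sum]
  rw [sum_comm]
  refine sum_congr rfl fun i _ => sum_congr rfl fun j _ => ?_
  rw [pderiv_comm, smul_comm]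

lemma D_add (v w : ι → ℝ) (g : MvPolynomial ι ℝ) : D (v + w) g = D v g + D w g := by
  simp [D_apply, add_smul, sum_add_distrib]

lemma D_smul (a : ℝ) (w : ι → ℝ) (g : MvPolynomial ι ℝ) : D (a • w) g = a • D w g := by
  simp [D_apply, smul_sum, mul_smul]

lemma D_sub (v w : ι → ℝ) (g : MvPolynomial ι ℝ) : D (v - w) g = D v g - D w g := by
  simp [D_apply, sub_smul, sum_sub_distrib]

lemma D_zero (g : MvPolynomial ι ℝ) : D 0 g = 0 := by simp [D_apply]

lemma D_single [DecidableEq ι] (i : ι) (g : MvPolynomial ι ℝ) :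
    D (Pi.single i 1) g = pderiv i g := by
  rw [D_apply, sum_eq_single i]
  · simp
  · intro j _ hj; simp [hj]
  · simp

instance : LeftCommutative (fun (v : ι → ℝ) (g : MvPolynomial ι ℝ) => D v g) :=
  ⟨fun v w g => D_comm v w g⟩

noncomputable def DS (s : Multiset (ι → ℝ)) (g : MvPolynomial ι ℝ) : MvPolynomial ι ℝ :=
  s.foldr (fun v g => D v g) g

@[simp] lemma DS_zero (g : MvPolynomial ι ℝ) : DS 0 g = g := by simp [DS]
@[simp] lemma DS_cons (v) (s : Multiset (ι → ℝ)) (g : MvPolynomial ι ℝ) :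
    DS (v ::ₘ s) g = D v (DS s g) := by simp [DS]

lemma D_DS (v) (s : Multiset (ι → ℝ)) (g : MvPolynomial ι ℝ) :
    D v (DS s g) = DS s (D v g) := by
  induction s using Multiset.induction with
  | empty => simp
  | cons w s ih => simp [D_comm v w, ih]

lemma DS_cons' (v) (s : Multiset (ι → ℝ)) (g : MvPolynomial ι ℝ) :
    DS (v ::ₘ s) g = DS s (D v g) := by rw [DS_cons, D_DS]

lemma DS_add_multiset (s t : Multiset (ι → ℝ)) (g : MvPolynomial ι ℝ) :
    DS (s + t) g = DS s (DS t g) := by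
  simp [DS, Multiset.foldr_add]

noncomputable def DSl (s : Multiset (ι → ℝ)) : MvPolynomial ι ℝ →ₗ[ℝ] MvPolynomial ι ℝ where
  toFun := DS s
  map_add' x y := by
    induction s using Multiset.induction with
    | empty => simp
    | cons w s ih => simp [ih]
  map_smul' a x := by
    induction s using Multiset.induction with
    | empty => simp
    | cons w s ih => simp at ih; simp [ih]

/-- the mixed value -/
noncomputable def cc (s : Multiset (ι → ℝ)) (g : MvPolynomial ι ℝ) : ℝ := constantCoeff (DS s g)

noncomputable def ccl (s : Multiset (ι → ℝ)) : MvPolynomial ι ℝ →ₗ[ℝ] ℝ where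
  toFun g := cc s g
  map_add' x y := by
    have := (DSl s).map_add x y
    simp only [DSl, LinearMap.coe_mk, AddHom.coe_mk] at this
    simp [cc, this]
  map_smul' a x := by
    have := (DSl s).map_smul a x
    simp only [DSl, LinearMap.coe_mk, AddHom.coe_mk] at this
    simp [cc, this, constantCoeff_smul]

lemma ccl_apply (s) (g : MvPolynomial ι ℝ) : ccl s g = cc s g := rfl

lemma cc_cons (v) (s : Multiset (ι → ℝ)) (g : MvPolynomial ι ℝ) :
    cc (v ::ₘ s) g = cc s (D v g) := by simp only [cc, DS_cons']

lemma cc_cons_sum (v) (s : Multiset (ι → ℝ)) (g : MvPolynomial ι ℝ) :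
    cc (v ::ₘ s) g = ∑ i, v i * cc s (pderiv i g) := by
  rw [cc_cons, D_apply, ← ccl_apply, map_sum]
  simp [ccl_apply]

lemma cc_zero_right (s : Multiset (ι → ℝ)) : cc s (0 : MvPolynomial ι ℝ) = 0 := by
  rw [← ccl_apply, map_zero]

lemma cc_cons_add (v w) (s : Multiset (ι → ℝ)) (g : MvPolynomial ι ℝ) :
    cc ((v + w) ::ₘ s) g = cc (v ::ₘ s) g + cc (w ::ₘ s) g := by
  rw [cc_cons, cc_cons, cc_cons, D_add, ← ccl_apply, map_add]; rfl

lemma cc_cons_smul (a : ℝ) (w) (s : Multiset (ι → ℝ)) (g : MvPolynomial ι ℝ) :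
    cc ((a • w) ::ₘ s) g = a * cc (w ::ₘ s) g := by
  rw [cc_cons, cc_cons, D_smul, ← ccl_apply, map_smul]; rfl

lemma cc_cons_sub (v w) (s : Multiset (ι → ℝ)) (g : MvPolynomial ι ℝ) :
    cc ((v - w) ::ₘ s) g = cc (v ::ₘ s) g - cc (w ::ₘ s) g := by
  rw [cc_cons, cc_cons, cc_cons, D_sub, ← ccl_apply, map_sub]; rfl

lemma D_homog {v : ι → ℝ} {g : MvPolynomial ι ℝ} {m : ℕ} (h : g.IsHomogeneous m) :
    (D v g).IsHomogeneous (m - 1) := by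
  rw [D_apply]
  apply IsHomogeneous.sum
  intro i _
  exact (homogeneousSubmodule ι ℝ (m - 1)).smul_mem _ h.pderiv

lemma hasDerivAt_eval (g : MvPolynomial ι ℝ) (h x : ι → ℝ) (t : ℝ) :
    HasDerivAt (fun t : ℝ => eval (h + t • x) g) (eval (h + t • x) (D x g)) t := by
  classical
  induction g using MvPolynomial.induction_on with
  | C a => simpa [D_apply] using hasDerivAt_const t a
  | add p q hp hq =>
    simp only [map_add]; exact hp.add hq
  | mul_X p i hp =>
    have h1 : HasDerivAt (fun t : ℝ => h i + t * x i) (x i) t := by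
      simpa using ((hasDerivAt_id t).mul_const (x i)).const_add (h i)
    have := hp.mul h1
    simp only [map_mul, eval_X, Pi.add_apply, Pi.smul_apply, smul_eq_mul]
    refine this.congr_deriv ?_
    have e : D x (p * X i) = D x p * X i + x i • p := by
      simp only [D_apply, pderiv_mul, pderiv_X, smul_add, sum_add_distrib, sum_mul]
      congr 1
      · refine sum_congr rfl fun j _ => by rw [smul_mul_assoc]
      · rw [sum_eq_single i]
        · simp
        · intro j _ hj; simp [hj.symm]
        · simp
    rw [e]; simp [smul_eval]; ring

lemma euler_eval {g : MvPolynomial ι ℝ} {m : ℕ} (hg : g.IsHomogeneous m) (h : ι → ℝ) :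
    eval h (D h g) = m * eval h g := by
  have := congrArg (eval h) hg.sum_X_mul_pderiv
  simp only [map_sum, map_mul, eval_X, map_nsmul, nsmul_eq_mul, map_natCast] at this
  rw [← this, D_apply]
  simp [smul_eval]

lemma eval_eq_cc {g : MvPolynomial ι ℝ} {m : ℕ} (hg : g.IsHomogeneous m) (h : ι → ℝ) :
    cc (Multiset.replicate m h) g = m.factorial * eval h g := by
  induction m generalizing g with
  | zero =>
    have : g.totalDegree = 0 := Nat.le_zero.mp hg.totalDegree_le
    rw [totalDegree_eq_zero_iff_eq_C] at this
    rw [this]; simp [cc]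
  | succ m ih =>
    rw [Multiset.replicate_succ, cc_cons, ih (D_homog hg), euler_eval hg, Nat.factorial_succ]
    push_cast; ring

end Alg
end AF

namespace AF

lemma ground_state {κ : Type*} [Fintype κ] (M : κ → κ → ℝ) (hs : ∀ k l, M k l = M l k)
    (w m : κ → ℝ) (hw : ∀ k, 0 < w k) (hm : ∀ k, ∑ l, M k l * w l = m k) (x : κ → ℝ) :
    ∑ k, ∑ l, M k l * w k * w l * (x k / w k - x l / w l) ^ 2
      = 2 * (∑ k, m k / w k * x k ^ 2 - ∑ k, ∑ l, M k l * x k * x l) := by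
  have h1 : ∀ k l, M k l * w k * w l * (x k / w k - x l / w l) ^ 2
      = M k l * w l * (x k ^ 2 / w k) + M l k * w k * (x l ^ 2 / w l) - 2 * (M k l * x k * x l) := by
    intro k l
    have := (hw k).ne'; have := (hw l).ne'
    rw [hs l k]; field_simp; ring
  simp only [h1, sum_sub_distrib, sum_add_distrib]
  rw [sum_comm (f := fun k l => M l k * w k * (x l ^ 2 / w l))]
  have h2 : ∑ k, ∑ l, M k l * w l * (x k ^ 2 / w k) = ∑ k, m k / w k * x k ^ 2 := by
    refine sum_congr rfl fun k _ => ?_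
    rw [← sum_mul, hm]; ring
  rw [h2]; simp only [← mul_sum]; ring

lemma matrix_lemma {κ : Type*} [Fintype κ] (M : κ → κ → ℝ) (hs : ∀ k l, M k l = M l k)
    (hoff : ∀ k l, k ≠ l → 0 ≤ M k l)
    (w m : κ → ℝ) (hw : ∀ k, 0 < w k) (hmp : ∀ k, 0 < m k) (hm : ∀ k, ∑ l, M k l * w l = m k)
    (hconn : ∀ T : Set κ, T.Nonempty → Tᶜ.Nonempty → ∃ k ∈ T, ∃ l ∉ T, 0 < M k l)
    (hB : ∀ x : κ → ℝ, ∑ k, ∑ l, M k l * x k * x l ≤ ∑ k, w k / m k * (∑ l, M k l * x l) ^ 2)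
    (x : κ → ℝ) (hx : ∑ k, m k * x k = 0) : ∑ k, ∑ l, M k l * x k * x l ≤ 0 := by
  classical
  set r : κ → ℝ := fun k => Real.sqrt (m k / w k) with hr
  have hrp : ∀ k, 0 < r k := fun k => Real.sqrt_pos.mpr (div_pos (hmp k) (hw k))
  have hr2 : ∀ k, r k * r k = m k / w k := fun k =>
    Real.mul_self_sqrt (div_pos (hmp k) (hw k)).le
  let N : Matrix κ κ ℝ := Matrix.of fun k l => M k l / (r k * r l)
  have hN : N.IsHermitian := by
    ext k l; simp [N, Matrix.conjTranspose_apply, hs l k, mul_comm (r l)]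
  let b := hN.eigenvectorBasis
  let lam := hN.eigenvalues
  have hev : ∀ i k, ∑ l, N k l * b i l = lam i * b i k := by
    intro i k
    have := congrFun (hN.mulVec_eigenvectorBasis i) k
    simpa [Matrix.mulVec, dotProduct, b, lam] using this
  -- key
  have key : ∀ i, lam i ≤ 0 ∨ ∑ k, b i k * (r k * x k) = 0 := by
    intro i
    by_contra! hcon
    obtain ⟨hl, hne⟩ := hcon
    let z : κ → ℝ := fun k => b i k / r k
    have hz : ∀ k, b i k = r k * z k := fun k => by
      have := (hrp k).ne'; simp only [z]; field_simp
    have hMz : ∀ k, ∑ l, M k l * z l = lam i * (m k / w k) * z k := by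
      intro k
      have h1 := hev i k
      have h2 : ∑ l, M k l * z l = r k * ∑ l, N k l * b i l := by
        rw [mul_sum]; refine sum_congr rfl fun l _ => ?_
        have := (hrp k).ne'; have := (hrp l).ne'
        simp only [N, Matrix.of_apply, z]; field_simp
      rw [h2, h1, hz k, ← hr2 k]; ring
    have hquad : ∑ k, ∑ l, M k l * z k * z l = lam i * ∑ k, m k / w k * z k ^ 2 := by
      rw [mul_sum]; refine sum_congr rfl fun k _ => ?_
      have : ∑ l, M k l * z k * z l = z k * ∑ l, M k l * z l := by
        rw [mul_sum]; refine sum_congr rfl fun l _ => by ring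
      rw [this, hMz]; ring
    have hpos : 0 < ∑ k, m k / w k * z k ^ 2 := by
      have h0 : ∀ k ∈ univ, 0 ≤ m k / w k * z k ^ 2 := fun k _ =>
        mul_nonneg (div_pos (hmp k) (hw k)).le (sq_nonneg _)
      rcases (sum_nonneg h0).lt_or_eq with h | h
      · exact h
      · exfalso
        apply hne
        have h3 := (sum_eq_zero_iff_of_nonneg h0).mp h.symm
        refine sum_eq_zero fun k hk => ?_
        have h4 := h3 k hk
        have : z k = 0 := by
          rcases mul_eq_zero.mp h4 with h5 | h5
          · exact absurd h5 (div_pos (hmp k) (hw k)).ne'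
          · exact pow_eq_zero_iff (two_ne_zero) |>.mp h5
        rw [hz, this]; ring
    have hB1 := hB z
    have h5 : ∑ k, w k / m k * (∑ l, M k l * z l) ^ 2 = lam i ^ 2 * ∑ k, m k / w k * z k ^ 2 := by
      rw [mul_sum]; refine sum_congr rfl fun k _ => ?_
      rw [hMz]; have := (hw k).ne'; have := (hmp k).ne'; field_simp
    rw [hquad, h5] at hB1
    have h1 : 1 ≤ lam i := by
      have := le_of_mul_le_mul_right hB1 hpos
      by_contra! h; nlinarith
    have hg := ground_state M hs w m hw hm z
    rw [hquad] at hg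
    have hterm : ∀ k l, 0 ≤ M k l * w k * w l * (z k / w k - z l / w l) ^ 2 := by
      intro k l
      by_cases h : k = l
      · subst h; simp
      · exact mul_nonneg (mul_nonneg (mul_nonneg (hoff k l h) (hw k).le) (hw l).le) (sq_nonneg _)
    have hle : ∑ k, ∑ l, M k l * w k * w l * (z k / w k - z l / w l) ^ 2 ≤ 0 := by
      rw [hg]; nlinarith
    have hzero : ∀ k l, 0 < M k l → z k / w k = z l / w l := by
      intro k l hkl
      have a := (sum_eq_zero_iff_of_nonneg (fun k _ => sum_nonneg fun l _ => hterm k l)).mp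
        (le_antisymm hle (sum_nonneg fun k _ => sum_nonneg fun l _ => hterm k l)) k (mem_univ _)
      have a2 := (sum_eq_zero_iff_of_nonneg (fun l _ => hterm k l)).mp a l (mem_univ _)
      have : 0 < M k l * w k * w l := mul_pos (mul_pos hkl (hw k)) (hw l)
      rcases mul_eq_zero.mp a2 with h | h
      · exact absurd h this.ne'
      · exact sub_eq_zero.mp (pow_eq_zero_iff two_ne_zero |>.mp h)
    apply hne
    rcases isEmpty_or_nonempty κ with he | ⟨⟨k0⟩⟩
    · simp
    have hconst : ∀ k, z k / w k = z k0 / w k0 := by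
      by_contra! hcon
      obtain ⟨k1, hk1⟩ := hcon
      obtain ⟨k, hk, l, hl, h⟩ := hconn {k | z k / w k = z k0 / w k0} ⟨k0, rfl⟩ ⟨k1, hk1⟩
      exact hl ((hzero k l h).symm.trans hk)
    calc ∑ k, b i k * (r k * x k) = ∑ k, z k0 / w k0 * (m k * x k) := by
          refine sum_congr rfl fun k _ => ?_
          rw [← hconst k, hz k]
          have h6 : r k * z k * (r k * x k) = (r k * r k) * (z k * x k) := by ring
          rw [h6, hr2]; ring
      _ = 0 := by rw [← mul_sum, hx, mul_zero]
  -- conclude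
  let y : EuclideanSpace ℝ κ := WithLp.toLp 2 (fun k => r k * x k)
  let Ny : EuclideanSpace ℝ κ := WithLp.toLp 2 (fun k => ∑ l, N k l * (r l * x l))
  have h7 : ∑ k, ∑ l, M k l * x k * x l = inner ℝ y Ny := by
    simp only [y, Ny, PiLp.inner_apply, RCLike.inner_apply, conj_trivial]
    refine sum_congr rfl fun k _ => ?_
    rw [sum_mul]
    refine sum_congr rfl fun l _ => ?_
    have := (hrp k).ne'; have := (hrp l).ne'
    simp only [N, Matrix.of_apply]; field_simp
  rw [h7, ← b.sum_inner_mul_inner]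
  refine sum_nonpos fun i _ => ?_
  have h8 : inner ℝ (b i) Ny = lam i * inner ℝ y (b i) := by
    simp only [y, Ny, PiLp.inner_apply, RCLike.inner_apply, conj_trivial]
    simp only [sum_mul]
    rw [sum_comm, mul_sum]
    refine sum_congr rfl fun l _ => ?_
    have h9 := hev i l
    have : ∑ k, N k l * (r l * x l) * b i k = (r l * x l) * ∑ k, N l k * b i k := by
      rw [mul_sum]; refine sum_congr rfl fun k _ => ?_
      have : N k l = N l k := by simp [N, hs k l, mul_comm (r k)]
      rw [this]; ring
    rw [this, h9]; ring
  rw [h8]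
  rcases key i with h | h
  · nlinarith [mul_self_nonneg (inner ℝ y (b i))]
  · have : inner ℝ y (b i) = 0 := by
      simp only [y, PiLp.inner_apply, RCLike.inner_apply, conj_trivial]
      exact h
    rw [this]; simp

/-- Lorentz lemma -/
lemma lorentz {V : Type*} [AddCommGroup V] [Module ℝ V] (q : V → V → ℝ)
    (hs : ∀ x y, q x y = q y x) (ha : ∀ x y z, q (x + y) z = q x z + q y z)
    (hc : ∀ (a : ℝ) x z, q (a • x) z = a * q x z) (w : V) (hw : 0 < q w w)
    (h : ∀ x, q x w = 0 → q x x ≤ 0) (x v : V) (hv : 0 < q v v) :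
    q x x * q v v ≤ q x v ^ 2 := by
  have ha' : ∀ x y z, q z (x + y) = q z x + q z y := fun x y z => by rw [hs, ha, hs x, hs y]
  have hc' : ∀ (a : ℝ) x z, q z (a • x) = a * q z x := fun a x z => by rw [hs, hc, hs x]
  have hvw : q v w ≠ 0 := fun h0 => absurd (h v h0) (not_le.mpr hv)
  -- z = x - (q x w / q v w) v
  set c := - (q x w / q v w) with hcdef
  have h1 := h (x + c • v) (by rw [ha, hc, hcdef]; field_simp; ring)
  rw [ha, ha', ha', hc, hc, hc', hc', hs v x] at h1
  -- q x x + 2c q x v + c^2 q v v ≤ 0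
  nlinarith [sq_nonneg (q x v + c * q v v)]
end AF

namespace AF
open MvPolynomial

section AbsAF
variable {ι : Type*} [Fintype ι] [DecidableEq ι]

noncomputable def F (f : MvPolynomial ι ℝ) (I : Finset ι) : MvPolynomial ι ℝ :=
  DS (I.val.map (fun i => (Pi.single i 1 : ι → ℝ))) f

structure Good (f : MvPolynomial ι ℝ) (n : ℕ) (Δ : Set (Finset ι)) (C : Set (ι → ℝ)) : Prop where
  hom : f.IsHomogeneous n
  a1 : ∀ I ∉ Δ, F f I = 0
  a2 : ∀ σ ∈ Δ, σ.card = n → 0 < constantCoeff (F f σ)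
  a3 : ∀ I ∈ Δ, ∀ v ∈ C, ∃ l : ι → ℝ, D l f = 0 ∧ (∀ i ∈ I, l i = v i) ∧ ∀ k ∉ I, l k < v k
  a4 : ∀ I ∈ Δ, I.card < n → ∃ k ∉ I, insert k I ∈ Δ
  a5 : ∀ I ∈ Δ, ∀ h x, h ∈ C → h + x ∈ C → h - x ∈ C →
    eval (h + x) (F f I) * eval (h - x) (F f I) ≤ eval h (F f I) ^ 2
  op : IsOpen C
  ne : C.Nonempty

lemma F_insert (f : MvPolynomial ι ℝ) {I : Finset ι} {k : ι} (h : k ∉ I) :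
    F f (insert k I) = pderiv k (F f I) := by
  rw [F, insert_val_of_notMem h, Multiset.map_cons, DS_cons, D_single, F]

lemma F_homog {f : MvPolynomial ι ℝ} {n : ℕ} (hf : f.IsHomogeneous n) (I : Finset ι) :
    (F f I).IsHomogeneous (n - I.card) := by
  induction I using Finset.induction_on with
  | empty => simpa [F] using hf
  | insert k I hk ih =>
    rw [F_insert f hk, card_insert_of_notMem hk, ← Nat.sub_sub]
    exact ih.pderiv

lemma D_F {f : MvPolynomial ι ℝ} {l : ι → ℝ} (h : D l f = 0) (I : Finset ι) : D l (F f I) = 0 := by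
  rw [F, D_DS, h]; exact (DSl _).map_zero

noncomputable def Q (s : Multiset (ι → ℝ)) (g : MvPolynomial ι ℝ) (x y : ι → ℝ) : ℝ :=
  cc (x ::ₘ y ::ₘ s) g

end AbsAF
section AbsAF2
variable {ι : Type*} [Fintype ι]
lemma Q_symm (s : Multiset (ι → ℝ)) (g : MvPolynomial ι ℝ) (x y) : Q s g x y = Q s g y x := by
  rw [Q, Multiset.cons_swap, Q]
lemma Q_add (s : Multiset (ι → ℝ)) (g : MvPolynomial ι ℝ) (x y z) :
    Q s g (x + y) z = Q s g x z + Q s g y z := cc_cons_add _ _ _ _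
lemma Q_smul (s : Multiset (ι → ℝ)) (g : MvPolynomial ι ℝ) (a : ℝ) (x z) :
    Q s g (a • x) z = a * Q s g x z := cc_cons_smul _ _ _ _

lemma lc2 {C : Set (ι → ℝ)} (hC : IsOpen C) (g : MvPolynomial ι ℝ) {h : ι → ℝ} (hh : h ∈ C)
    (hlc : ∀ x, h + x ∈ C → h - x ∈ C → eval (h + x) g * eval (h - x) g ≤ eval h g ^ 2)
    (hp : 0 < eval h g) (x : ι → ℝ) (hx : eval h (D x g) = 0) : eval h (D x (D x g)) ≤ 0 := by
  by_contra! hcon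
  let G : ℝ → ℝ := fun t => eval (h + t • x) g
  let G1 : ℝ → ℝ := fun t => eval (h + t • x) (D x g)
  let G2 : ℝ → ℝ := fun t => eval (h + t • x) (D x (D x g))
  have d1 : ∀ t, HasDerivAt G (G1 t) t := fun t => hasDerivAt_eval _ _ _ _
  have d2 : ∀ t, HasDerivAt G1 (G2 t) t := fun t => hasDerivAt_eval _ _ _ _
  have d1' : ∀ t, HasDerivAt (fun t => G (-t)) (-G1 (-t)) t := fun t => by
    exact ((d1 (-t)).comp t (hasDerivAt_neg t)).congr_deriv (by ring)
  have d2' : ∀ t, HasDerivAt (fun t => G1 (-t)) (-G2 (-t)) t := fun t => by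
    exact ((d2 (-t)).comp t (hasDerivAt_neg t)).congr_deriv (by ring)
  let φ : ℝ → ℝ := fun t => G t * G (-t)
  have e1 : deriv φ = fun t => G1 t * G (-t) - G t * G1 (-t) := by
    ext t
    have h3 : deriv φ t = _ := ((d1 t).mul (d1' t)).deriv
    rw [h3]; ring
  have e2 : deriv (deriv φ) 0 = 2 * G 0 * G2 0 - 2 * G1 0 ^ 2 := by
    rw [e1]
    have := ((d2 0).mul (d1' 0)).sub ((d1 0).mul (d2' 0))
    have h2 := this.deriv
    have h3 : deriv (fun t => G1 t * G (-t) - G t * G1 (-t)) 0 = _ := h2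
    rw [h3]; simp; ring
  have g0 : G 0 = eval h g := by simp [G]
  have g1 : G1 0 = 0 := by simp [G1, hx]
  have g2 : G2 0 = eval h (D x (D x g)) := by simp [G2]
  have hpos : 0 < deriv (deriv φ) 0 := by rw [e2, g0, g1, g2]; nlinarith [mul_pos hp hcon]
  have hmin := isLocalMin_of_deriv_deriv_pos hpos (by rw [e1]; simp; ring)
    ((d1 0).mul (d1' 0)).continuousAt
  have hev : ∀ᶠ t : ℝ in nhds 0, h + t • x ∈ C ∧ h - t • x ∈ C := by
    have c1 : Continuous fun t : ℝ => h + t • x := by fun_prop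
    have c2 : Continuous fun t : ℝ => h - t • x := by fun_prop
    exact (c1.continuousAt.eventually (hC.mem_nhds (by simpa using hh))).and
      (c2.continuousAt.eventually (hC.mem_nhds (by simpa using hh)))
  have hconst : φ =ᶠ[nhds 0] fun _ => φ 0 := by
    filter_upwards [hev, hmin] with t ht ht2
    refine le_antisymm ?_ ht2
    have := hlc (t • x) ht.1 ht.2
    simp only [φ, G, neg_smul, ← sub_eq_add_neg]
    simpa [sq] using this
  have := hconst.deriv.deriv_eq
  rw [this] at hpos; simp at hpos

lemma rlor {C : Set (ι → ℝ)} (hC : IsOpen C) {d : ℕ} {g : MvPolynomial ι ℝ}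
    (hg : g.IsHomogeneous (d + 2)) {h : ι → ℝ} (hh : h ∈ C)
    (hlc : ∀ x, h + x ∈ C → h - x ∈ C → eval (h + x) g * eval (h - x) g ≤ eval h g ^ 2)
    (hp : 0 < Q (Multiset.replicate d h) g h h) (x : ι → ℝ)
    (hx : Q (Multiset.replicate d h) g x h = 0) : Q (Multiset.replicate d h) g x x ≤ 0 := by
  have f0 : ∀ m : ℕ, (0 : ℝ) < m.factorial := fun m => by exact_mod_cast m.factorial_pos
  have h1 : Q (Multiset.replicate d h) g h h = (d+2).factorial * eval h g := by
    rw [← eval_eq_cc hg]; simp [Q, Multiset.replicate_succ]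
  have h2 : Q (Multiset.replicate d h) g x h = (d+1).factorial * eval h (D x g) := by
    have hh1 : (D x g).IsHomogeneous (d+1) := D_homog hg
    rw [← eval_eq_cc hh1, ← cc_cons]
    simp [Q, Multiset.replicate_succ]
  have h3 : Q (Multiset.replicate d h) g x x = d.factorial * eval h (D x (D x g)) := by
    have hh1 : (D x (D x g)).IsHomogeneous d := D_homog (D_homog hg)
    rw [← eval_eq_cc hh1, ← cc_cons, ← cc_cons,
      Q]
  rw [h1] at hp; rw [h2] at hx
  have a : 0 < eval h g := (pos_iff_pos_of_mul_pos hp).mp (f0 _)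
  have b : eval h (D x g) = 0 := (mul_eq_zero.mp hx).resolve_left (f0 _).ne'
  rw [h3]
  exact mul_nonpos_of_nonneg_of_nonpos (f0 _).le (lc2 hC g hh hlc a x b)


end AbsAF2
end AF

namespace AF
open MvPolynomial

section AbsAF3
variable {ι : Type*} [Fintype ι] [DecidableEq ι]
variable {f : MvPolynomial ι ℝ} {n : ℕ} {Δ : Set (Finset ι)} {C : Set (ι → ℝ)}

open Classical in
noncomputable def lk (Δ : Set (Finset ι)) (I : Finset ι) : Finset ι :=
  univ.filter fun k => k ∉ I ∧ insert k I ∈ Δ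

lemma mem_lk {I : Finset ι} {k : ι} : k ∈ lk Δ I ↔ k ∉ I ∧ insert k I ∈ Δ := by simp [lk]

lemma Good.expand (H : Good f n Δ C) {I : Finset ι} {v l : ι → ℝ} (hl : D l f = 0)
    (hv : ∀ i ∈ I, l i = v i) (s : Multiset (ι → ℝ)) :
    cc (v ::ₘ s) (F f I) = ∑ k ∈ lk Δ I, (v k - l k) * cc s (F f (insert k I)) := by
  have h1 : cc (v ::ₘ s) (F f I) = cc ((v - l) ::ₘ s) (F f I) := by
    rw [cc_cons_sub, cc_cons l, D_F hl, cc_zero_right, sub_zero]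
  rw [h1, cc_cons_sum]
  symm
  apply sum_subset_zero_on_sdiff (subset_univ _)
  · intro k hk
    simp only [mem_sdiff, mem_univ, true_and, mem_lk, not_and] at hk
    by_cases hkI : k ∈ I
    · simp [hv k hkI]
    · rw [← F_insert f hkI, H.a1 _ (hk hkI), cc_zero_right, mul_zero]
  · intro k hk
    rw [F_insert f (mem_lk.mp hk).1]; rfl

lemma Good.pos (H : Good f n Δ C) (vs : Multiset (ι → ℝ)) (hvs : ∀ v ∈ vs, v ∈ C) :
    ∀ I ∈ Δ, I.card + vs.card = n → 0 < cc vs (F f I) := by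
  induction vs using Multiset.induction with
  | empty => intro I hI hc; simpa [cc] using H.a2 I hI (by simpa using hc)
  | cons v vs ih =>
    intro I hI hc
    simp only [Multiset.card_cons] at hc
    obtain ⟨l, h1, h2, h3⟩ := H.a3 I hI v (hvs v (by simp))
    rw [H.expand h1 h2]
    refine sum_pos (fun k hk => ?_) ?_
    · rw [mem_lk] at hk
      refine mul_pos (sub_pos.mpr (h3 k hk.1)) (ih (fun v hv => hvs v (by simp [hv])) _ hk.2 ?_)
      rw [card_insert_of_notMem hk.1]; omega
    · obtain ⟨k, hk⟩ := H.a4 I hI (by omega)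
      exact ⟨k, mem_lk.mpr hk⟩

lemma Good.lin (H : Good f n Δ C) {I : Finset ι} (hI : I ∈ Δ) (x : ι → ℝ) :
    ∃ l : ι → ℝ, D l f = 0 ∧ ∀ i ∈ I, l i = x i := by
  obtain ⟨v, hv⟩ := H.ne
  have c1 : Continuous fun t : ℝ => v + t • x := by fun_prop
  have : ∀ᶠ t : ℝ in nhds 0, v + t • x ∈ C :=
    c1.continuousAt.eventually (H.op.mem_nhds (by simpa using hv))
  obtain ⟨t, ht, ht0⟩ := ((this.filter_mono nhdsWithin_le_nhds).and
    (self_mem_nhdsWithin : ∀ᶠ t in nhdsWithin (0:ℝ) (Set.Ioi 0), t ∈ Set.Ioi (0:ℝ))).exists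
  obtain ⟨l1, a1, a2, -⟩ := H.a3 I hI _ ht
  obtain ⟨l2, b1, b2, -⟩ := H.a3 I hI _ hv
  have ht0' : t ≠ 0 := ne_of_gt ht0
  refine ⟨t⁻¹ • (l1 - l2), by rw [D_smul, D_sub, a1, b1]; simp, fun i hi => ?_⟩
  simp [a2 i hi, b2 i hi, ht0']

lemma Good.rl (H : Good f n Δ C) {I : Finset ι} (hI : I ∈ Δ) {d : ℕ} (hd : I.card + 2 + d = n)
    {w : ι → ℝ} (hw : w ∈ C) (x : ι → ℝ)
    (hx : Q (Multiset.replicate d w) (F f I) x w = 0) :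
    Q (Multiset.replicate d w) (F f I) x x ≤ 0 := by
  have hg := F_homog H.hom I
  rw [show n - I.card = d + 2 by omega] at hg
  refine rlor H.op hg hw (fun x h1 h2 => H.a5 I hI w x hw h1 h2) ?_ x hx
  refine H.pos _ ?_ I hI ?_
  · intro v hv
    simp only [Multiset.mem_cons] at hv
    rcases hv with rfl | rfl | hv
    · exact hw
    · exact hw
    · rwa [Multiset.eq_of_mem_replicate hv]
  · simp; omega

lemma Q_sum (s : Multiset (ι → ℝ)) (g : MvPolynomial ι ℝ) (x y) :
    Q s g x y = ∑ i, x i * Q s g (Pi.single i 1) y := by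
  rw [Q, cc_cons_sum]
  refine sum_congr rfl fun i _ => ?_
  rw [Q, cc_cons (Pi.single i 1), D_single]

lemma Q_single (s : Multiset (ι → ℝ)) {I : Finset ι} {k : ι} (hk : k ∉ I) (y) :
    Q s (F f I) (Pi.single k 1) y = cc (y ::ₘ s) (F f (insert k I)) := by
  rw [Q, cc_cons, D_single, F_insert f hk]

lemma Good.conn (H : Good f n Δ C) {I : Finset ι} (hI : I ∈ Δ) (hd : I.card + 2 ≤ n)
    {w : ι → ℝ} (hw : w ∈ C) (T : Finset ι) (hT : T ⊆ lk Δ I) (h1 : T.Nonempty)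
    (h2 : (lk Δ I \ T).Nonempty) :
    ∃ k ∈ T, ∃ l ∈ lk Δ I \ T, insert k (insert l I) ∈ Δ := by
  by_contra! hcon
  obtain ⟨d, hd⟩ := Nat.exists_eq_add_of_le hd
  obtain ⟨L, l1, l2, l3⟩ := H.a3 I hI w hw
  set s := Multiset.replicate d w with hs
  let r := Q s (F f I)
  let a : ι → ℝ := fun k => if k ∈ T then w k - L k else 0
  let b : ι → ℝ := fun k => if k ∈ lk Δ I \ T then w k - L k else 0
  have hsC : ∀ v ∈ w ::ₘ s, v ∈ C := by
    intro v hv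
    rcases Multiset.mem_cons.mp hv with rfl | hv
    · exact hw
    · rwa [Multiset.eq_of_mem_replicate hv]
  have hrw : ∀ y, r w y = r a y + r b y := by
    intro y
    change cc _ _ = _
    rw [H.expand l1 l2, ← sum_sdiff hT, add_comm]
    simp only [r]
    rw [Q_sum _ _ a, Q_sum _ _ b]
    simp only [a, b, ite_mul, zero_mul, sum_ite_mem, univ_inter]
    congr 1
    · refine sum_congr rfl fun k hk => ?_
      rw [Q_single _ (mem_lk.mp (hT hk)).1]
    · refine sum_congr rfl fun k hk => ?_
      rw [Q_single _ (mem_lk.mp (mem_sdiff.mp hk).1).1]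
  have hab : r a b = 0 := by
    simp only [r]
    rw [Q_sum]
    refine sum_eq_zero fun k _ => ?_
    by_cases hk : k ∈ T
    · rw [Q_symm, Q_sum, sum_eq_zero, mul_zero]
      intro l _
      by_cases hl : l ∈ lk Δ I \ T
      · rw [Q_single _ (mem_lk.mp (mem_sdiff.mp hl).1).1, cc_cons, D_single, ← F_insert,
          H.a1 _ (hcon k hk l hl), cc_zero_right, mul_zero]
        rw [mem_insert, not_or]
        refine ⟨?_, (mem_lk.mp (hT hk)).1⟩
        rintro rfl
        exact (mem_sdiff.mp hl).2 hk
      · rw [show b l = 0 from if_neg hl, zero_mul]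
    · rw [show a k = 0 from if_neg hk, zero_mul]
  have hp : ∀ k ∈ lk Δ I, 0 < (w k - L k) * Q s (F f I) (Pi.single k 1) w := by
    intro k hk
    rw [mem_lk] at hk
    rw [Q_single _ hk.1]
    refine mul_pos (sub_pos.mpr (l3 k hk.1)) (H.pos _ hsC _ hk.2 ?_)
    rw [card_insert_of_notMem hk.1]; simp [hs]; omega
  have haw : 0 < r a w := by
    simp only [r]; rw [Q_sum]
    simp only [a, ite_mul, zero_mul, sum_ite_mem, univ_inter]
    exact sum_pos (fun k hk => hp k (hT hk)) h1
  have hbw : 0 < r b w := by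
    simp only [r]; rw [Q_sum]
    simp only [b, ite_mul, zero_mul, sum_ite_mem, univ_inter]
    exact sum_pos (fun k hk => hp k (mem_sdiff.mp hk).1) h2
  have hba : r b a = 0 := by rw [← hab]; exact Q_symm _ _ _ _
  have haa : r a a = r a w := by
    have := hrw a; rw [hba, add_zero] at this; rw [← this]; exact Q_symm _ _ _ _
  have hbb : r b b = r b w := by
    have := hrw b; rw [hab, zero_add] at this; rw [← this]; exact Q_symm _ _ _ _
  have e1 : ∀ y, r (r b w • a + (-r a w) • b) y = r b w * r a y + (-r a w) * r b y := by
    intro y; simp only [r]; rw [Q_add, Q_smul, Q_smul]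
  have := H.rl hI hd.symm hw (r b w • a + (-r a w) • b) (by
    rw [← hs]; change r _ w = 0
    rw [e1]; ring)
  rw [← hs] at this; change r _ _ ≤ 0 at this
  have e2 : ∀ y, r y (r b w • a + (-r a w) • b) = r b w * r y a + (-r a w) * r y b := by
    intro y
    have := e1 y
    simp only [r] at this ⊢
    rw [Q_symm s _ y, Q_symm s _ y, Q_symm s _ y]; exact this
  rw [e2, e1, e1, haa, hbb, hab, hba] at this
  nlinarith [mul_pos haw hbw, mul_pos (mul_pos hbw hbw) haw, mul_pos (mul_pos haw haw) hbw]

lemma Good.lor (H : Good f n Δ C) (vs : Multiset (ι → ℝ)) (hvs : ∀ v ∈ vs, v ∈ C) :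
    ∀ I ∈ Δ, I.card + 2 + vs.card = n → ∀ x, ∀ v ∈ C,
      Q vs (F f I) x x * Q vs (F f I) v v ≤ Q vs (F f I) x v ^ 2 := by
  induction vs using Multiset.induction with
  | empty =>
    intro I hI hc x v hv
    have hpos : 0 < Q 0 (F f I) v v := H.pos _ (by simp [hv]) I hI (by simp at hc ⊢; omega)
    refine lorentz (Q 0 (F f I)) (Q_symm _ _) (Q_add _ _) (Q_smul _ _) v hpos ?_ x v hpos
    intro x hx
    exact H.rl hI (d := 0) (by simpa using hc) hv x hx
  | cons w vs ih =>
    intro I hI hc x v hv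
    have hvs' : ∀ v ∈ vs, v ∈ C := fun v hv => hvs v (by simp [hv])
    have hw : w ∈ C := hvs w (by simp)
    simp only [Multiset.card_cons] at hc
    have hposI : ∀ v ∈ C, 0 < Q (w ::ₘ vs) (F f I) v v := fun v hv =>
      H.pos _ (by simp only [Multiset.mem_cons]; rintro _ (rfl | rfl | rfl | h); exacts [hv, hv, hw, hvs' _ h]) I hI
        (by simp; omega)
    refine lorentz (Q (w ::ₘ vs) (F f I)) (Q_symm _ _) (Q_add _ _) (Q_smul _ _) w (hposI w hw) ?_ x v
      (hposI v hv)
    intro x hx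
    set q := Q (w ::ₘ vs) (F f I) with hq
    obtain ⟨L, l1, l2, l3⟩ := H.a3 I hI w hw
    obtain ⟨X, x1, x2⟩ := H.lin hI x
    let S := lk Δ I
    let e : ι → ι → ℝ := fun k => Pi.single k 1
    have hS : ∀ k : S, (k : ι) ∉ I ∧ insert (k : ι) I ∈ Δ := fun k => mem_lk.mp k.2
    -- expansions
    have hqx : ∀ (x X : ι → ℝ), D X f = 0 → (∀ i ∈ I, X i = x i) → ∀ y,
        q x y = ∑ k : S, (x k - X k) * q (e k) y := by
      intro x X x1 x2 y
      rw [hq]; change cc _ _ = _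
      rw [H.expand x1 x2, ← sum_coe_sort]
      refine sum_congr rfl fun k _ => ?_
      rw [Q_single _ (hS k).1]
    have hqk : ∀ (k : S) y, q (e k) y = cc (y ::ₘ w ::ₘ vs) (F f (insert (k : ι) I)) := fun k y =>
      Q_single _ (hS k).1 y
    have hcard : ∀ k : S, (insert (k : ι) I).card = I.card + 1 := fun k =>
      card_insert_of_notMem (hS k).1
    have hm : ∀ k : S, 0 < q (e k) w := by
      intro k
      rw [hqk]
      refine H.pos _ ?_ _ (hS k).2 ?_
      · simp only [Multiset.mem_cons]; rintro _ (rfl | rfl | h); exacts [hw, hw, hvs' _ h]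
      · rw [hcard]; simp; omega
    have hpair : ∀ k l : S, k ≠ l → q (e k) (e l) = cc (w ::ₘ vs) (F f (insert (l : ι) (insert (k : ι) I))) := by
      intro k l hkl
      rw [hqk, cc_cons, D_single, ← F_insert]
      rw [mem_insert, not_or]
      exact ⟨fun h => hkl (Subtype.ext h.symm), (hS l).1⟩
    have hpp : ∀ k l : S, k ≠ l → insert (l : ι) (insert (k : ι) I) ∈ Δ → 0 < q (e k) (e l) := by
      intro k l hkl h
      rw [hpair k l hkl]
      refine H.pos _ ?_ _ h ?_
      · simp only [Multiset.mem_cons]; rintro _ (rfl | h); exacts [hw, hvs' _ h]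
      · rw [card_insert_of_notMem, hcard]
        · simp; omega
        · rw [mem_insert, not_or]
          exact ⟨fun h => hkl (Subtype.ext h.symm), (hS l).1⟩
    have hmat := matrix_lemma (κ := S) (fun k l => q (e k) (e l)) (fun k l => Q_symm _ _ _ _)
      (by
        intro k l hkl
        by_cases h : insert (l : ι) (insert (k : ι) I) ∈ Δ
        · exact (hpp k l hkl h).le
        · rw [hpair k l hkl, H.a1 _ h, cc_zero_right])
      (fun k => w k - L k) (fun k => q (e k) w) (fun k => sub_pos.mpr (l3 k (hS k).1)) hm
      (by
        intro k
        have := hqx w L l1 l2 (e k)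
        rw [show q w (e k) = q (e k) w from Q_symm _ _ _ _] at this
        rw [this]
        refine sum_congr rfl fun l _ => ?_
        rw [show q (e k) (e l) = q (e l) (e k) from Q_symm _ _ _ _]; ring)
      (by
        classical
        intro T hT1 hT2
        obtain ⟨k0, hk0⟩ := hT1
        obtain ⟨k1, hk1⟩ := hT2
        let T' : Finset ι := (univ.filter (· ∈ T)).map (Function.Embedding.subtype _)
        have hmem : ∀ k : S, (k : ι) ∈ T' ↔ k ∈ T := by
          intro k; simp [T']
        obtain ⟨k, hk, l, hl, hkl⟩ := H.conn hI (by omega) hw T'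
          (by intro k hk; simp only [T', mem_map] at hk; obtain ⟨a, _, rfl⟩ := hk; exact a.2)
          ⟨k0, (hmem k0).mpr hk0⟩ ⟨k1, mem_sdiff.mpr ⟨k1.2, fun h => hk1 ((hmem k1).mp h)⟩⟩
        have hkS : k ∈ S := by simp only [T', mem_map] at hk; obtain ⟨a, _, rfl⟩ := hk; exact a.2
        obtain ⟨hl1, hl2⟩ := mem_sdiff.mp hl
        refine ⟨⟨k, hkS⟩, (hmem ⟨k, hkS⟩).mp hk, ⟨l, hl1⟩, fun h => hl2 ((hmem ⟨l, hl1⟩).mpr h), ?_⟩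
        refine hpp _ _ ?_ ?_
        · intro h
          rw [Subtype.mk.injEq] at h
          subst h; exact hl2 hk
        · simpa [insert_comm] using hkl)
      (by
        intro z
        let Z : ι → ℝ := fun i => if h : i ∈ S then z ⟨i, h⟩ else 0
        have hZ : ∀ k : S, Z k = z k := fun k => by simp [Z]
        have hqZ : ∀ y, q Z y = ∑ k : S, z k * q (e k) y := by
          intro y
          rw [hq, Q_sum, ← hq, ← sum_subset (subset_univ S), ← sum_coe_sort]
          · refine sum_congr rfl fun k _ => ?_
            rw [hZ]
          · intro i _ hi; simp [Z, hi]
        have e1 : q Z Z = ∑ k : S, ∑ l : S, q (e k) (e l) * z k * z l := by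
          rw [hqZ]
          refine sum_congr rfl fun k _ => ?_
          rw [show q (e k) Z = q Z (e k) from Q_symm _ _ _ _, hqZ, mul_sum]
          refine sum_congr rfl fun l _ => ?_
          rw [show q (e k) (e l) = q (e l) (e k) from Q_symm _ _ _ _]; ring
        rw [← e1]
        have e2 : q Z Z = ∑ k : S, (w k - L k) * Q vs (F f (insert (k : ι) I)) Z Z := by
          have : q Z Z = cc (w ::ₘ Z ::ₘ Z ::ₘ vs) (F f I) := by
            rw [hq, Q]; congr 1
            rw [Multiset.cons_swap w Z, Multiset.cons_swap w Z]
          rw [this, H.expand l1 l2, ← sum_coe_sort]; rfl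
        rw [e2]
        refine sum_le_sum fun k _ => ?_
        have hk := ih hvs' _ (hS k).2 (by rw [hcard]; omega) Z w hw
        have e3 : Q vs (F f (insert (k : ι) I)) w w = q (e k) w := (hqk k w).symm
        have e4 : Q vs (F f (insert (k : ι) I)) Z w = ∑ l : S, q (e k) (e l) * z l := by
          rw [Q, ← hqk, show q (e k) Z = q Z (e k) from Q_symm _ _ _ _, hqZ]
          refine sum_congr rfl fun l _ => ?_
          rw [show q (e k) (e l) = q (e l) (e k) from Q_symm _ _ _ _]; ring
        rw [e3, e4] at hk
        rw [div_mul_eq_mul_div, mul_div_assoc]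
        exact mul_le_mul_of_nonneg_left ((le_div_iff₀ (hm k)).mpr hk)
          (sub_pos.mpr (l3 k (hS k).1)).le)
      (fun k => x k - X k)
      (by
        rw [hqx x X x1 x2] at hx
        rw [← hx]; exact sum_congr rfl fun k _ => mul_comm _ _)
    have e5 : q x x = ∑ k : S, ∑ l : S, q (e k) (e l) * (x k - X k) * (x l - X l) := by
      rw [hqx x X x1 x2]
      refine sum_congr rfl fun k _ => ?_
      rw [show q (e k) x = q x (e k) from Q_symm _ _ _ _, hqx x X x1 x2, mul_sum]
      refine sum_congr rfl fun l _ => ?_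
      rw [show q (e k) (e l) = q (e l) (e k) from Q_symm _ _ _ _]; ring
    rw [e5]; exact hmat

/-- abstract Alexandrov–Fenchel -/
theorem Good.af (H : Good f n Δ C) (h0 : ∅ ∈ Δ) (vs : Multiset (ι → ℝ)) (hvs : ∀ v ∈ vs, v ∈ C)
    (hc : 2 + vs.card = n) (x v : ι → ℝ) (hv : v ∈ C) :
    cc (x ::ₘ x ::ₘ vs) f * cc (v ::ₘ v ::ₘ vs) f ≤ cc (x ::ₘ v ::ₘ vs) f ^ 2 := by
  have := H.lor vs hvs ∅ h0 (by simpa using hc) x v hv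
  simpa [F, Q] using this

theorem Good.pos0 (H : Good f n Δ C) (h0 : ∅ ∈ Δ) (vs : Multiset (ι → ℝ)) (hvs : ∀ v ∈ vs, v ∈ C)
    (hc : vs.card = n) : 0 < cc vs f := by
  have := H.pos vs hvs ∅ h0 (by simpa using hc)
  simpa [F] using this

end AbsAF3
end AF

namespace AF

lemma p_ineq {p : ℕ} {α : Type*} (G : (Fin p → α) → ℝ) (hG : ∀ y, 0 < G y)
    (hAF : ∀ y i j, i ≠ j →
      G (Function.update y i (y j)) * G (Function.update y j (y i)) ≤ G y ^ 2)
    (y : Fin p → α) : ∏ i, G (fun _ => y i) ≤ G y ^ p := by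
  classical
  rcases Nat.eq_zero_or_pos p with rfl | hp
  · simp
  haveI : Nonempty (Fin p) := ⟨⟨0, hp⟩⟩
  have hp' : (0:ℝ) < p := by exact_mod_cast hp
  let c : Fin p → ℝ := fun i => Real.log (G fun _ => y i)
  let g : (Fin p → Fin p) → ℝ := fun z => p * Real.log (G (y ∘ z)) - ∑ i, c (z i)
  have hupd : ∀ (φ : Fin p → ℝ) (z : Fin p → Fin p) i j,
      ∑ k, φ (Function.update z i (z j) k) = ∑ k, φ (z k) + (φ (z j) - φ (z i)) := by
    intro φ z i j
    rw [← add_sum_erase univ _ (mem_univ i), ← add_sum_erase univ (fun k => φ (z k)) (mem_univ i)]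
    simp only [Function.update_self]
    rw [sum_congr rfl (g := fun k => φ (z k)) (fun k hk => by
      rw [Function.update_of_ne (ne_of_mem_erase hk)])]
    ring
  have hg : ∀ z i j, i ≠ j → g (Function.update z i (z j)) + g (Function.update z j (z i)) ≤ 2 * g z := by
    intro z i j hij
    have h1 := hAF (y ∘ z) i j hij
    have h2 : y ∘ Function.update z i (z j) = Function.update (y ∘ z) i ((y ∘ z) j) := by
      rw [Function.comp_update]; rfl
    have h3 : y ∘ Function.update z j (z i) = Function.update (y ∘ z) j ((y ∘ z) i) := by
      rw [Function.comp_update]; rfl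
    rw [← h2, ← h3] at h1
    have h4 := Real.log_le_log (mul_pos (hG _) (hG _)) h1
    rw [Real.log_mul (hG _).ne' (hG _).ne', Real.log_pow] at h4
    simp only [g, hupd c]
    push_cast at h4
    nlinarith
  obtain ⟨z0, -, hz0⟩ := exists_min_image univ g univ_nonempty
  obtain ⟨z, hz, hzmax⟩ := exists_max_image (univ.filter fun z => g z = g z0)
    (fun z => ∑ i, ((z i : ℕ) : ℝ)) ⟨z0, by simp⟩
  simp only [mem_filter, mem_univ, true_and] at hz hzmax
  have hconst : ∀ i j, z i = z j := by
    by_contra! hcon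
    obtain ⟨i, j, hij⟩ := hcon
    have hne : i ≠ j := fun h => hij (by rw [h])
    have h1 := hg z i j hne
    have h2 := hz0 (Function.update z i (z j)) (mem_univ _)
    have h3 := hz0 (Function.update z j (z i)) (mem_univ _)
    have h4 := hzmax (Function.update z i (z j)) (by linarith)
    have h5 := hzmax (Function.update z j (z i)) (by linarith)
    rw [hupd (fun a => ((a : ℕ) : ℝ))] at h4 h5
    apply hij
    have : ((z i : ℕ) : ℝ) = ((z j : ℕ) : ℝ) := by linarith
    exact Fin.ext (by exact_mod_cast this)
  have hgz : g z = 0 := by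
    let i0 : Fin p := ⟨0, hp⟩
    have : z = fun _ => z i0 := funext fun i => hconst i i0
    rw [this]
    have : (y ∘ fun _ : Fin p => z i0) = fun _ => y (z i0) := rfl
    simp only [g, this, sum_const, card_univ, Fintype.card_fin, nsmul_eq_mul, c]
    ring
  have hfin := hz0 id (mem_univ _)
  rw [← hz, hgz] at hfin
  simp only [g, Function.comp_id, id] at hfin
  rw [← Real.log_le_log_iff (prod_pos fun i _ => hG _) (pow_pos (hG _) _),
    Real.log_prod (fun i _ => (hG _).ne'), Real.log_pow]
  linarith

open MvPolynomial in
theorem Good.hodge {ι : Type*} [Fintype ι] [DecidableEq ι]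
    {f : MvPolynomial ι ℝ} {n : ℕ} {Δ : Set (Finset ι)} {C : Set (ι → ℝ)} (H : Good f n Δ C)
    (h0 : ∅ ∈ Δ) {p : ℕ} (ls : Multiset (ι → ℝ)) (hls : ∀ v ∈ ls, v ∈ C)
    (hc : p + ls.card = n) (y : Fin p → ι → ℝ) (hy : ∀ i, y i ∈ C) :
    ∏ i, cc (univ.val.map (fun _ : Fin p => y i) + ls) f ≤ cc (univ.val.map y + ls) f ^ p := by
  have key := p_ineq (α := C) (fun x : Fin p → C => cc (univ.val.map (fun i => (x i : ι → ℝ)) + ls) f)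
    (by
      intro x
      refine H.pos0 h0 _ ?_ (by simpa using hc)
      intro v hv
      rcases Multiset.mem_add.mp hv with h | h
      · obtain ⟨i, -, rfl⟩ := Multiset.mem_map.mp h; exact (x i).2
      · exact hls v h)
    (by
      intro x i j hij
      let rest : Multiset (Fin p) := ((univ.erase i).erase j).val
      have hu : (univ : Finset (Fin p)).val = i ::ₘ j ::ₘ rest := by
        have h1 : insert j ((univ.erase i).erase j) = univ.erase i :=
          insert_erase (mem_erase.mpr ⟨hij.symm, mem_univ _⟩)
        rw [← insert_erase (mem_univ i), insert_val_of_notMem (notMem_erase _ _), ← h1,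
          insert_val_of_notMem (notMem_erase _ _)]
      have hr : ∀ k ∈ rest, k ≠ i ∧ k ≠ j := by
        intro k hk
        have : k ∈ (univ.erase i).erase j := hk
        simp only [mem_erase] at this; tauto
      let vs := rest.map (fun i => (x i : ι → ℝ)) + ls
      have e : ∀ (z : Fin p → C), (∀ k, k ≠ i → k ≠ j → z k = x k) →
          univ.val.map (fun i => (z i : ι → ℝ)) + ls = (z i : ι → ℝ) ::ₘ (z j : ι → ℝ) ::ₘ vs := by
        intro z hz
        rw [hu, Multiset.map_cons, Multiset.map_cons, Multiset.cons_add, Multiset.cons_add]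
        congr 2
        simp only [vs]
        congr 1
        exact Multiset.map_congr rfl fun k hk => by rw [hz k (hr k hk).1 (hr k hk).2]
      rw [e _ (fun k h1 h2 => by rw [Function.update_of_ne h1]),
        e _ (fun k h1 h2 => by rw [Function.update_of_ne h2]), e x (fun _ _ _ => rfl)]
      simp only [Function.update_self, Function.update_of_ne hij, Function.update_of_ne hij.symm]
      have := H.af h0 vs ?_ ?_ (x i) (x j) (x j).2
      · rw [mul_comm]; exact this
      · intro v hv
        rcases Multiset.mem_add.mp hv with h | h
        · obtain ⟨i, -, rfl⟩ := Multiset.mem_map.mp h; exact (x i).2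
        · exact hls v h
      · have h1 := congrArg Multiset.card hu
        simp at h1
        simp [vs]; omega)
    (fun i => ⟨y i, hy i⟩)
  exact key
end AF

namespace AF
open MvPolynomial

section Diff
variable {ι κ : Type*} [DecidableEq κ]

noncomputable def dF (s : Finset κ) (v : κ → ι → ℝ) (Φ : (ι → ℝ) → ℝ) (h : ι → ℝ) : ℝ :=
  ∑ A ∈ s.powerset, (-1) ^ (#s - #A) * Φ (h + ∑ i ∈ A, v i)

omit [DecidableEq κ] in
lemma dF_empty (v : κ → ι → ℝ) (Φ : (ι → ℝ) → ℝ) (h : ι → ℝ) : dF ∅ v Φ h = Φ h := by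
  simp [dF]

lemma dF_insert {s : Finset κ} {a : κ} (ha : a ∉ s) (v : κ → ι → ℝ) (Φ : (ι → ℝ) → ℝ) (h : ι → ℝ) :
    dF (insert a s) v Φ h = dF s v Φ (h + v a) - dF s v Φ h := by
  rw [dF, sum_powerset_insert ha, dF, dF, ← neg_add_eq_sub, ← sum_neg_distrib]
  congr 1
  · refine sum_congr rfl fun A hA => ?_
    have h1 := card_le_card (mem_powerset.mp hA)
    rw [card_insert_of_notMem ha, Nat.sub_add_comm h1, pow_succ]; ring
  · refine sum_congr rfl fun A hA => ?_
    have h2 : a ∉ A := fun h => ha (mem_powerset.mp hA h)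
    rw [card_insert_of_notMem ha, card_insert_of_notMem h2, Nat.add_sub_add_right, sum_insert h2,
      add_assoc]

variable [Fintype ι]

lemma dF_mvt (s : Finset κ) (v : κ → ι → ℝ) (g : MvPolynomial ι ℝ) (h : ι → ℝ) :
    ∃ θ : κ → ℝ, (∀ i, θ i ∈ Set.Icc (0:ℝ) 1) ∧
      dF s v (fun x => eval x g) h = eval (h + ∑ i ∈ s, θ i • v i) (DS (s.val.map v) g) := by
  induction s using Finset.induction_on generalizing g h with
  | empty => exact ⟨fun _ => 0, by simp, by simp [dF_empty]⟩
  | insert a s ha ih =>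
    have hd : ∀ t : ℝ, HasDerivAt (fun t : ℝ => dF s v (fun x => eval x g) (h + t • v a))
        (dF s v (fun x => eval x (D (v a) g)) (h + t • v a)) t := by
      intro t
      simp only [dF]
      refine HasDerivAt.fun_sum fun A _ => HasDerivAt.const_mul _ ?_
      have := hasDerivAt_eval g (h + ∑ i ∈ A, v i) (v a) t
      simpa only [add_right_comm h] using this
    obtain ⟨t, ht, hte⟩ := exists_hasDerivAt_eq_slope _ _ (zero_lt_one (α := ℝ))
      (fun t _ => (hd t).continuousAt.continuousWithinAt) (fun t _ => hd t)
    obtain ⟨θ, hθ, he⟩ := ih (D (v a) g) (h + t • v a)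
    refine ⟨Function.update θ a t, ?_, ?_⟩
    · intro i
      by_cases hi : i = a
      · subst hi; simp [ht.1.le, ht.2.le]
      · simp [Function.update_of_ne hi]; exact hθ i
    · rw [dF_insert ha, insert_val_of_notMem ha, Multiset.map_cons, DS_cons', sum_insert ha,
        Function.update_self, sum_congr rfl (g := fun i => θ i • v i), ← add_assoc, ← he, hte]
      · simp
      · intro i hi
        rw [Function.update_of_ne]; rintro rfl; exact ha hi

omit [DecidableEq κ] in
lemma DS_homog (s : Multiset (ι → ℝ)) {g : MvPolynomial ι ℝ} {m : ℕ} (hg : g.IsHomogeneous m) :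
    (DS s g).IsHomogeneous (m - s.card) := by
  induction s using Multiset.induction with
  | empty => simpa using hg
  | cons v s ih => rw [DS_cons, Multiset.card_cons, ← Nat.sub_sub]; exact D_homog ih

lemma polarization (s : Finset κ) (v : κ → ι → ℝ) {f : MvPolynomial ι ℝ}
    (hf : f.IsHomogeneous #s) :
    dF s v (fun x => eval x f) 0 = cc (s.val.map v) f := by
  obtain ⟨θ, -, h⟩ := dF_mvt s v f 0
  rw [h, cc]
  have h1 := DS_homog (s.val.map v) hf
  have h2 : (DS (s.val.map v) f).totalDegree = 0 := by
    have := h1.totalDegree_le; simpa using this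
  rw [totalDegree_eq_zero_iff_eq_C] at h2
  rw [h2]; simp

variable [DecidableEq ι]

/-- scaled differences -/
noncomputable def dE (J : Finset ι) (t : ℝ) (Φ : (ι → ℝ) → ℝ) (h : ι → ℝ) : ℝ :=
  dF J (fun i => t • (Pi.single i 1 : ι → ℝ)) Φ h

lemma DS_scaled (J : Finset ι) (t : ℝ) (f : MvPolynomial ι ℝ) :
    DS (J.val.map fun i => t • (Pi.single i 1 : ι → ℝ)) f = t ^ #J • F f J := by
  induction J using Finset.induction_on with
  | empty => simp [F]
  | insert a s ha ih =>
    rw [insert_val_of_notMem ha, Multiset.map_cons, DS_cons, ih, F_insert f ha, D_smul, D_single,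
      card_insert_of_notMem ha, pow_succ', mul_smul, Derivation.map_smul]

lemma dE_mvt (J : Finset ι) (t : ℝ) (f : MvPolynomial ι ℝ) (h : ι → ℝ) :
    ∃ θ : ι → ℝ, (∀ i, θ i ∈ Set.Icc (0:ℝ) 1) ∧
      dE J t (fun x => eval x f) h = t ^ #J *
        eval (h + t • ∑ i ∈ J, θ i • (Pi.single i 1 : ι → ℝ)) (F f J) := by
  obtain ⟨θ, h1, h2⟩ := dF_mvt J (fun i => t • (Pi.single i 1 : ι → ℝ)) f h
  refine ⟨θ, h1, ?_⟩
  rw [dE, h2, DS_scaled, smul_eval]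
  simp only [smul_sum, smul_comm t]

lemma dE_tendsto (J : Finset ι) (f : MvPolynomial ι ℝ) (h : ι → ℝ) :
    Filter.Tendsto (fun t : ℝ => dE J t (fun x => eval x f) h / t ^ #J) (nhdsWithin 0 (Set.Ioi 0))
      (nhds (eval h (F f J))) := by
  choose θ h1 h2 using fun t => dE_mvt J t f h
  have hξ : Filter.Tendsto (fun t : ℝ => h + t • ∑ i ∈ J, θ t i • (Pi.single i 1 : ι → ℝ))
      (nhdsWithin 0 (Set.Ioi 0)) (nhds h) := by
    rw [tendsto_pi_nhds]
    intro k
    have hb : ∀ t : ℝ, |(∑ i ∈ J, θ t i • (Pi.single i 1 : ι → ℝ)) k| ≤ 1 := by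
      intro t
      have : (∑ i ∈ J, θ t i • (Pi.single i 1 : ι → ℝ)) k = if k ∈ J then θ t k else 0 := by
        simp [Finset.sum_apply, Pi.single_apply]
      rw [this]
      split_ifs
      · rw [abs_of_nonneg (h1 t k).1]; exact (h1 t k).2
      · simp
    have : Filter.Tendsto (fun t : ℝ => t * (∑ i ∈ J, θ t i • (Pi.single i 1 : ι → ℝ)) k)
        (nhdsWithin 0 (Set.Ioi 0)) (nhds 0) := by
      refine squeeze_zero_norm (a := fun t => |t|) (fun t => ?_) ?_
      · rw [Real.norm_eq_abs, abs_mul]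
        exact mul_le_of_le_one_right (abs_nonneg _) (hb t)
      · have : Filter.Tendsto (fun t : ℝ => |t|) (nhds 0) (nhds |0|) := continuous_abs.tendsto 0
        rw [abs_zero] at this
        exact this.mono_left nhdsWithin_le_nhds
    simpa using this.const_add (h k)
  have hc : Continuous fun x : ι → ℝ => eval x (F f J) := MvPolynomial.continuous_eval _
  refine ((hc.tendsto h).comp hξ).congr' ?_
  filter_upwards [self_mem_nhdsWithin] with t ht
  have : t ^ #J ≠ 0 := pow_ne_zero _ (ne_of_gt ht)
  rw [h2]; simp [this]

lemma poly_zero_of_open {C : Set (ι → ℝ)} (hC : IsOpen C) (hne : C.Nonempty) {g : MvPolynomial ι ℝ}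
    (hg : ∀ x ∈ C, eval x g = 0) : g = 0 := by
  obtain ⟨c, hc⟩ := hne
  obtain ⟨ε, hε, hb⟩ := Metric.isOpen_iff.mp hC c hc
  refine MvPolynomial.funext_set (fun i => Metric.ball (c i) ε) (fun i => ?_) fun x hx => ?_
  · rw [Real.ball_eq_Ioo]; exact Set.Ioo_infinite (by linarith)
  · rw [hg x (hb ?_), map_zero]
    rw [ball_pi _ hε]; exact hx

/-- From difference data to `Good` facts. -/
lemma a1_of {C : Set (ι → ℝ)} (hC : IsOpen C) (hne : C.Nonempty) {f : MvPolynomial ι ℝ}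
    (J : Finset ι) (h : ∀ h ∈ C, ∀ᶠ t in nhdsWithin (0:ℝ) (Set.Ioi 0),
      dE J t (fun x => eval x f) h = 0) : F f J = 0 := by
  refine poly_zero_of_open hC hne fun x hx => ?_
  refine tendsto_nhds_unique (dE_tendsto J f x) ?_
  refine tendsto_const_nhds.congr' ?_
  filter_upwards [h x hx] with t ht
  rw [ht, zero_div]

lemma a2_of {n : ℕ} {f : MvPolynomial ι ℝ} (hf : f.IsHomogeneous n) (J : Finset ι) (hJ : #J = n)
    (h : ι → ℝ) (t : ℝ) (ht : 0 < t) (hd : 0 < dE J t (fun x => eval x f) h) :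
    0 < constantCoeff (F f J) := by
  obtain ⟨θ, -, h2⟩ := dE_mvt J t f h
  have h1 := F_homog hf J
  rw [hJ, Nat.sub_self] at h1
  have h3 := totalDegree_eq_zero_iff_eq_C.mp (Nat.le_zero.mp h1.totalDegree_le)
  rw [h3] at h2
  simp only [eval_C] at h2
  rw [h2] at hd
  exact (pos_iff_pos_of_mul_pos hd).mp (pow_pos ht _)

lemma a5_of {f : MvPolynomial ι ℝ} (J : Finset ι) (h x : ι → ℝ)
    (hd : ∀ᶠ t in nhdsWithin (0:ℝ) (Set.Ioi 0),
      dE J t (fun x => eval x f) (h + x) * dE J t (fun x => eval x f) (h - x)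
        ≤ dE J t (fun x => eval x f) h ^ 2) :
    eval (h + x) (F f J) * eval (h - x) (F f J) ≤ eval h (F f J) ^ 2 := by
  refine le_of_tendsto_of_tendsto ((dE_tendsto J f (h + x)).mul (dE_tendsto J f (h - x)))
    ((dE_tendsto J f h).pow 2) ?_
  filter_upwards [hd, self_mem_nhdsWithin] with t ht ht0
  have : 0 < t ^ #J := pow_pos ht0 _
  rw [div_mul_div_comm, div_pow, ← sq]
  exact div_le_div_of_nonneg_right ht (by positivity)

end Diff
end AF

namespace AF
open scoped ENNReal

lemma bm1 {A B S : Set ℝ} (hA : MeasurableSet A) (hB : MeasurableSet B) (hAn : A.Nonempty)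
    (hBn : B.Nonempty) (h : ∀ x ∈ A, ∀ y ∈ B, (x + y) / 2 ∈ S) :
    volume A + volume B ≤ 2 * volume S := by
  have key : ∀ K L : Set ℝ, K ⊆ A → L ⊆ B → IsCompact K → IsCompact L → K.Nonempty → L.Nonempty →
      volume K + volume L ≤ 2 * volume S := by
    intro K L hKA hLB hK hL hKn hLn
    obtain ⟨M, hM, hMm⟩ := hK.exists_isGreatest hKn
    obtain ⟨m, hm, hmm⟩ := hL.exists_isLeast hLn
    let X : Set ℝ := (fun x => (x + m)) '' K
    let Y : Set ℝ := (fun y => (y + M)) '' L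
    have hX : volume X = volume K := by simp only [X]; exact measure_preimage_add_right volume (-m) K ▸ by simp
    have hY : volume Y = volume L := by simp only [Y]; exact measure_preimage_add_right volume (-M) L ▸ by simp
    have hYm : MeasurableSet Y := (hL.image (by fun_prop)).measurableSet
    have hXY : volume (X ∩ Y) = 0 := by
      refine measure_mono_null (t := {M + m}) ?_ (by simp)
      rintro z ⟨⟨x, hx, rfl⟩, ⟨y, hy, hxy⟩⟩
      have h1 := hMm hx; have h2 := hmm hy
      simp only [Set.mem_singleton_iff] at *
      linarith
    have hsub : X ∪ Y ⊆ (2:ℝ) • S := by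
      rintro z (⟨x, hx, rfl⟩ | ⟨y, hy, rfl⟩)
      · exact ⟨_, h x (hKA hx) m (hLB hm), by simp; ring⟩
      · exact ⟨_, h M (hKA hM) y (hLB hy), by simp; ring⟩
    have := measure_mono (μ := volume) hsub
    rw [Measure.addHaar_smul] at this
    have h3 := measure_union_add_inter (μ := volume) X hYm
    rw [hXY, add_zero, hX, hY] at h3
    rw [← h3]; refine this.trans (le_of_eq ?_); simp
  obtain ⟨a, ha⟩ := hAn
  obtain ⟨b, hb⟩ := hBn
  rw [hA.measure_eq_iSup_isCompact, hB.measure_eq_iSup_isCompact]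
  simp only [iSup_and']
  haveI : Nonempty {K : Set ℝ // K ⊆ A ∧ IsCompact K} := ⟨⟨∅, by simp⟩⟩
  haveI : Nonempty {K : Set ℝ // K ⊆ B ∧ IsCompact K} := ⟨⟨∅, by simp⟩⟩
  rw [iSup_subtype', iSup_subtype']
  refine ENNReal.iSup_add_iSup_le ?_
  rintro ⟨K, hKA, hK⟩ ⟨L, hLB, hL⟩
  refine le_trans (add_le_add (measure_mono (Set.subset_insert a K)) (measure_mono (Set.subset_insert b L))) ?_
  exact key _ _ (Set.insert_subset ha hKA) (Set.insert_subset hb hLB) (hK.insert a) (hL.insert b)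
    (Set.insert_nonempty _ _) (Set.insert_nonempty _ _)

lemma layer {f : ℝ → ℝ≥0∞} (hf : Measurable f) (h1 : ∀ x, f x ≤ 1) :
    ∫⁻ x, f x = ∫⁻ t in Set.Ioo (0:ℝ) 1, volume {x | ENNReal.ofReal t < f x} := by
  have hfin : ∀ x, f x ≠ ∞ := fun x => ne_top_of_le_ne_top ENNReal.one_ne_top (h1 x)
  have e1 := lintegral_eq_lintegral_meas_lt volume (f := fun x => (f x).toReal)
    (ae_of_all _ fun x => ENNReal.toReal_nonneg) hf.ennreal_toReal.aemeasurable
  simp only [ENNReal.ofReal_toReal (hfin _)] at e1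
  rw [e1]
  have e2 : ∀ t ∈ Set.Ioi (0:ℝ), volume {a | t < (f a).toReal} =
      Set.indicator (Set.Ioo (0:ℝ) 1) (fun t => volume {x | ENNReal.ofReal t < f x}) t := by
    intro t ht
    by_cases h : t < 1
    · rw [Set.indicator_of_mem (show t ∈ Set.Ioo (0:ℝ) 1 from ⟨ht, h⟩)]
      congr 1; ext x
      simp only [Set.mem_setOf_eq]
      rw [ENNReal.ofReal_lt_iff_lt_toReal (le_of_lt ht) (hfin x)]
    · rw [Set.indicator_of_notMem (fun h' => h h'.2)]
      convert measure_empty (μ := (volume : Measure ℝ))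
      ext x
      simp only [Set.mem_setOf_eq, Set.mem_empty_iff_false, iff_false, not_lt]
      have : (f x).toReal ≤ 1 := by
        have := ENNReal.toReal_mono ENNReal.one_ne_top (h1 x); simpa using this
      linarith
  rw [setLIntegral_congr_fun measurableSet_Ioi e2, setLIntegral_indicator measurableSet_Ioo]
  congr 2
  ext t; simp only [Set.mem_inter_iff, Set.mem_Ioo, Set.mem_Ioi]; tauto

lemma pl1_norm {f g h : ℝ → ℝ≥0∞} (hf : Measurable f) (hg : Measurable g) (hh : Measurable h)
    (sf : ⨆ x, f x = 1) (sg : ⨆ x, g x = 1)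
    (H : ∀ x y, f x * g y ≤ h ((x + y) / 2) ^ 2) : (∫⁻ x, f x) + (∫⁻ x, g x) ≤ 2 * ∫⁻ x, h x := by
  have f1 : ∀ x, f x ≤ 1 := fun x => sf ▸ le_iSup f x
  have g1 : ∀ x, g x ≤ 1 := fun x => sg ▸ le_iSup g x
  refine le_trans ?_ (mul_le_mul_right (lintegral_mono (f := fun x => min (h x) 1) fun x => min_le_left _ _) 2)
  rw [layer hf f1, layer hg g1, layer (hh.min measurable_const) (fun x => min_le_right _ _)]
  have hmeas : ∀ f : ℝ → ℝ≥0∞, Measurable fun t : ℝ => volume {x | ENNReal.ofReal t < f x} := by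
    intro f
    apply Antitone.measurable
    intro s t hst
    exact measure_mono fun x hx => lt_of_le_of_lt (ENNReal.ofReal_le_ofReal hst) hx
  rw [← lintegral_add_left (hmeas f), ← lintegral_const_mul _ (hmeas _)]
  refine setLIntegral_mono ((hmeas _).const_mul _) fun t ht => ?_
  have ht1 : ENNReal.ofReal t < 1 := by
    rw [← ENNReal.ofReal_one]; exact (ENNReal.ofReal_lt_ofReal_iff one_pos).mpr ht.2
  refine bm1 (measurableSet_lt measurable_const hf) (measurableSet_lt measurable_const hg) ?_ ?_ ?_
  · exact lt_iSup_iff.mp (sf ▸ ht1)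
  · exact lt_iSup_iff.mp (sg ▸ ht1)
  · intro x hx y hy
    refine lt_min ?_ ht1
    have := (ENNReal.mul_lt_mul hx hy).trans_le (H x y)
    rw [← sq] at this
    by_contra! hcon
    exact absurd this (not_lt.mpr (pow_le_pow_left' hcon 2))

lemma amgm {u v w : ℝ≥0∞} (h : u + v ≤ 2 * w) : u * v ≤ w ^ 2 := by
  by_cases hw : w = ∞
  · rw [hw]; simp
  have hne : 2 * w ≠ ∞ := ENNReal.mul_ne_top (by simp) hw
  have hu : u ≠ ∞ := ne_top_of_le_ne_top hne (le_self_add.trans h)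
  have hv : v ≠ ∞ := ne_top_of_le_ne_top hne (le_add_self.trans h)
  lift u to NNReal using hu
  lift v to NNReal using hv
  lift w to NNReal using hw
  norm_cast at *
  have h' : (u:ℝ) + v ≤ 2 * w := by exact_mod_cast h
  have : (u:ℝ) * v ≤ w ^ 2 := by nlinarith [sq_nonneg ((u:ℝ) - v), u.2, v.2, w.2, sq_nonneg ((u:ℝ)+v)]
  exact_mod_cast this

lemma pl1_bdd {f g h : ℝ → ℝ≥0∞} (hf : Measurable f) (hg : Measurable g) (hh : Measurable h)
    (sf : ⨆ x, f x ≠ ∞) (sg : ⨆ x, g x ≠ ∞)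
    (H : ∀ x y, f x * g y ≤ h ((x + y) / 2) ^ 2) :
    (∫⁻ x, f x) * ∫⁻ x, g x ≤ (∫⁻ x, h x) ^ 2 := by
  set a := ⨆ x, f x with ha
  set b := ⨆ x, g x with hb
  by_cases a0 : a = 0
  · have : ∀ x, f x = 0 := by rw [ha] at a0; simpa using a0
    simp [this]
  by_cases b0 : b = 0
  · have : ∀ x, g x = 0 := by rw [hb] at b0; simpa using b0
    simp [this]
  set c := (a * b) ^ (2⁻¹ : ℝ) with hc
  have hab : a * b ≠ ∞ := ENNReal.mul_ne_top sf sg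
  have hab0 : a * b ≠ 0 := mul_ne_zero a0 b0
  have hc2 : c ^ 2 = a * b := by
    rw [hc, ← ENNReal.rpow_natCast, ← ENNReal.rpow_mul]; simp
  have hc0 : c ≠ 0 := by intro h0; rw [h0] at hc2; exact hab0 (by rw [← hc2]; simp)
  have hct : c ≠ ∞ := by intro h0; rw [h0] at hc2; exact hab (by rw [← hc2]; simp)
  have := pl1_norm (f := fun x => a⁻¹ * f x) (g := fun x => b⁻¹ * g x) (h := fun x => c⁻¹ * h x)
    (hf.const_mul _) (hg.const_mul _) (hh.const_mul _)
    (by rw [← ENNReal.mul_iSup, ← ha, ENNReal.inv_mul_cancel a0 sf])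
    (by rw [← ENNReal.mul_iSup, ← hb, ENNReal.inv_mul_cancel b0 sg])
    (by
      intro x y
      rw [mul_pow, ← ENNReal.inv_pow, hc2, ENNReal.mul_inv (Or.inl a0) (Or.inl sf),
        mul_mul_mul_comm]
      exact mul_le_mul_right (H x y) _)
  rw [lintegral_const_mul _ hf, lintegral_const_mul _ hg, lintegral_const_mul _ hh] at this
  have h2 := amgm this
  rw [mul_pow, ← ENNReal.inv_pow, hc2, mul_mul_mul_comm,
    ← ENNReal.mul_inv (Or.inl a0) (Or.inl sf)] at h2
  have h3 := mul_le_mul_right h2 (a * b)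
  rwa [← mul_assoc, ENNReal.mul_inv_cancel hab0 hab, one_mul, ← mul_assoc,
    ENNReal.mul_inv_cancel hab0 hab, one_mul] at h3

lemma pl1 {f g h : ℝ → ℝ≥0∞} (hf : Measurable f) (hg : Measurable g) (hh : Measurable h)
    (H : ∀ x y, f x * g y ≤ h ((x + y) / 2) ^ 2) :
    (∫⁻ x, f x) * ∫⁻ x, g x ≤ (∫⁻ x, h x) ^ 2 := by
  have hmono : ∀ f : ℝ → ℝ≥0∞, Measurable f → ∫⁻ x, f x = ⨆ k : ℕ, ∫⁻ x, min (f x) k := by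
    intro f hf
    rw [← lintegral_iSup (fun k => hf.min measurable_const)
      (fun i j hij x => min_le_min_left _ (by exact_mod_cast hij))]
    congr 1; ext x
    refine le_antisymm ?_ (iSup_le fun k => min_le_left _ _)
    by_cases hx : f x = ∞
    · rw [hx]
      simp only [le_top, inf_of_le_right, ENNReal.iSup_natCast]
    · obtain ⟨k, hk⟩ := ENNReal.exists_nat_gt hx
      exact le_trans (by rw [min_eq_left hk.le]) (le_iSup (fun k : ℕ => min (f x) k) k)
  rw [hmono f hf, hmono g hg]
  rw [ENNReal.iSup_mul]
  refine iSup_le fun i => ?_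
  rw [ENNReal.mul_iSup]
  refine iSup_le fun j => ?_
  refine pl1_bdd (hf.min measurable_const) (hg.min measurable_const) hh ?_ ?_ ?_
  · exact ne_top_of_le_ne_top (ENNReal.natCast_ne_top i) (iSup_le fun x => min_le_right _ _)
  · exact ne_top_of_le_ne_top (ENNReal.natCast_ne_top j) (iSup_le fun x => min_le_right _ _)
  · intro x y
    exact (mul_le_mul' (min_le_left _ _) (min_le_left _ _)).trans (H x y)

/-- Prékopa–Leindler at the midpoint. -/
theorem pl (n : ℕ) : ∀ {f g h : (Fin n → ℝ) → ℝ≥0∞}, Measurable f → Measurable g → Measurable h →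
    (∀ x y, f x * g y ≤ h ((2⁻¹ : ℝ) • (x + y)) ^ 2) →
    (∫⁻ x, f x) * ∫⁻ x, g x ≤ (∫⁻ x, h x) ^ 2 := by
  induction n with
  | zero =>
    intro f g h hf hg hh H
    have : ∀ f : (Fin 0 → ℝ) → ℝ≥0∞, ∫⁻ x, f x = f 0 := by
      intro f
      rw [volume_pi, Measure.pi_of_empty (x := 0), lintegral_dirac]
    rw [this, this, this]
    simpa using H 0 0
  | succ n ih =>
    intro f g h hf hg hh H
    let e := MeasurableEquiv.piFinSuccAbove (fun _ : Fin (n+1) => ℝ) 0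
    have he := (volume_preserving_piFinSuccAbove (fun _ : Fin (n+1) => ℝ) 0).symm
    have hint : ∀ f : (Fin (n+1) → ℝ) → ℝ≥0∞, Measurable f →
        ∫⁻ x, f x = ∫⁻ s, ∫⁻ y, f (e.symm (s, y)) := by
      intro f hf
      rw [← he.lintegral_comp hf, Measure.volume_eq_prod, lintegral_prod]
      exact (hf.comp e.symm.measurable).aemeasurable
    have hm : ∀ f : (Fin (n+1) → ℝ) → ℝ≥0∞, Measurable f →
        Measurable fun s => ∫⁻ y, f (e.symm (s, y)) := by
      intro f hf
      exact Measurable.lintegral_prod_right' (hf.comp e.symm.measurable)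
    rw [hint f hf, hint g hg, hint h hh]
    refine pl1 (hm f hf) (hm g hg) (hm h hh) fun s t => ?_
    have hm1 : ∀ (f : (Fin (n+1) → ℝ) → ℝ≥0∞) (s : ℝ), Measurable f →
        Measurable fun y => f (e.symm (s, y)) := fun f s hf =>
      hf.comp (e.symm.measurable.comp measurable_prodMk_left)
    refine ih (hm1 f s hf) (hm1 g t hg) (hm1 h _ hh) fun x y => ?_
    refine (H _ _).trans (le_of_eq ?_)
    congr 2
    ext i
    refine Fin.cases ?_ (fun j => ?_) i
    · simp [e, MeasurableEquiv.piFinSuccAbove, Fin.insertNthEquiv]; ring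
    · simp [e, MeasurableEquiv.piFinSuccAbove, Fin.insertNthEquiv, Fin.insertNth_zero']; ring

theorem bm_mul {n : ℕ} {A B S : Set (Fin n → ℝ)} (hA : MeasurableSet A) (hB : MeasurableSet B)
    (hS : MeasurableSet S) (h : ∀ x ∈ A, ∀ y ∈ B, (2⁻¹ : ℝ) • (x + y) ∈ S) :
    volume A * volume B ≤ volume S ^ 2 := by
  have := pl n (f := A.indicator 1) (g := B.indicator 1) (h := S.indicator 1)
    (measurable_one.indicator hA) (measurable_one.indicator hB) (measurable_one.indicator hS) (by
      intro x y
      by_cases hx : x ∈ A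
      · by_cases hy : y ∈ B
        · rw [Set.indicator_of_mem hx, Set.indicator_of_mem hy, Set.indicator_of_mem (h x hx y hy)]; simp
        · simp [hy]
      · simp [hx])
  simpa [lintegral_indicator_one, hA, hB, hS] using this
end AF

namespace AF
variable {n : ℕ}

noncomputable def ZZ (V : Finset (Fin n → ℝ)) (y : Fin n → ℝ) : ℝ := ∑ v ∈ V, Real.exp (v ⬝ᵥ y)
noncomputable def gg (V : Finset (Fin n → ℝ)) (y : Fin n → ℝ) : Fin n → ℝ :=
  fun i => (∑ v ∈ V, Real.exp (v ⬝ᵥ y) * v i) / ZZ V y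
noncomputable def HH (V : Finset (Fin n → ℝ)) (y : Fin n → ℝ) : Matrix (Fin n) (Fin n) ℝ :=
  fun i k => (∑ v ∈ V, Real.exp (v ⬝ᵥ y) * v i * v k) / ZZ V y - gg V y i * gg V y k

lemma ZZ_pos {V : Finset (Fin n → ℝ)} (hV : V.Nonempty) (y) : 0 < ZZ V y :=
  Finset.sum_pos (fun v _ => Real.exp_pos _) hV

noncomputable def dotL (v : Fin n → ℝ) : (Fin n → ℝ) →L[ℝ] ℝ :=
  ∑ i, v i • ContinuousLinearMap.proj (R := ℝ) (φ := fun _ : Fin n => ℝ) i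

lemma dotL_apply (v z : Fin n → ℝ) : dotL v z = v ⬝ᵥ z := by
  simp [dotL, dotProduct]

lemma dotL_hasFDerivAt (v y : Fin n → ℝ) : HasFDerivAt (fun y => v ⬝ᵥ y) (dotL v) y := by
  have := (dotL v).hasFDerivAt (x := y)
  refine this.congr_of_eventuallyEq (Filter.Eventually.of_forall fun z => (dotL_apply v z).symm)

lemma hasFDerivAt_sumexp (V : Finset (Fin n → ℝ)) (c : (Fin n → ℝ) → ℝ) (y) :
    HasFDerivAt (fun y => ∑ v ∈ V, Real.exp (v ⬝ᵥ y) * c v)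
      (∑ v ∈ V, c v • (Real.exp (v ⬝ᵥ y) • dotL v)) y := by
  apply HasFDerivAt.fun_sum
  intro v _
  exact (dotL_hasFDerivAt v y).exp.mul_const (c v)

lemma hasFDerivAt_ZZ (V : Finset (Fin n → ℝ)) (y) :
    HasFDerivAt (ZZ V) (∑ v ∈ V, (Real.exp (v ⬝ᵥ y) • dotL v)) y := by
  have := hasFDerivAt_sumexp V (fun _ => 1) y
  refine (this.congr_fderiv (by simp)).congr_of_eventuallyEq
    (Filter.Eventually.of_forall fun z => by simp [ZZ])

lemma hasFDerivAt_gg {V : Finset (Fin n → ℝ)} (hV : V.Nonempty) (y) :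
    HasFDerivAt (gg V) (Matrix.mulVecLin (HH V y)).toContinuousLinearMap y := by
  rw [hasFDerivAt_pi']
  intro i
  have h := (hasFDerivAt_sumexp V (fun v => v i) y).mul
    ((hasDerivAt_inv (ZZ_pos hV y).ne').comp_hasFDerivAt y (hasFDerivAt_ZZ V y))
  have hz := (ZZ_pos hV y).ne'
  refine (h.congr_fderiv ?_).congr_of_eventuallyEq
    (Filter.Eventually.of_forall fun z => by simp [gg, div_eq_mul_inv])
  ext z
  have e1 : (gg V y ⬝ᵥ z) = (∑ v ∈ V, Real.exp (v ⬝ᵥ y) * (v ⬝ᵥ z)) / ZZ V y := by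
    simp only [gg, dotProduct, Finset.sum_div, Finset.sum_mul, Finset.mul_sum]
    rw [Finset.sum_comm]
    refine Finset.sum_congr rfl fun v _ => Finset.sum_congr rfl fun i _ => by ring
  have e2 : (HH V y).mulVec z i =
      (∑ v ∈ V, Real.exp (v ⬝ᵥ y) * v i * (v ⬝ᵥ z)) / ZZ V y - gg V y i * (gg V y ⬝ᵥ z) := by
    simp only [Matrix.mulVec, HH]
    simp only [dotProduct, sub_mul, Finset.sum_sub_distrib, Finset.mul_sum]
    congr 1
    · simp only [Finset.sum_div, Finset.sum_mul]
      rw [Finset.sum_comm]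
      refine Finset.sum_congr rfl fun v _ => Finset.sum_congr rfl fun i _ => by ring
    · refine Finset.sum_congr rfl fun v _ => by ring
  simp only [ContinuousLinearMap.comp_apply, ContinuousLinearMap.proj_apply,
    LinearMap.coe_toContinuousLinearMap', Matrix.mulVecLin_apply, e2, e1]
  simp [dotL_apply]
  have e3 : ∑ v ∈ V, v i * (Real.exp (v ⬝ᵥ y) * (v ⬝ᵥ z)) =
     ∑ v ∈ V, Real.exp (v ⬝ᵥ y) * v i * (v ⬝ᵥ z) :=
    Finset.sum_congr rfl fun v _ => by ring
  rw [e3]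
  simp only [gg]
  field_simp
  ring

lemma hasFDerivAt_logZZ {V : Finset (Fin n → ℝ)} (hV : V.Nonempty) (y) :
    HasFDerivAt (fun y => Real.log (ZZ V y)) (dotL (gg V y)) y := by
  refine ((hasFDerivAt_ZZ V y).log (ZZ_pos hV y).ne').congr_fderiv ?_
  ext z
  simp [dotL_apply]
  have e1 : (gg V y ⬝ᵥ z) = (∑ v ∈ V, Real.exp (v ⬝ᵥ y) * (v ⬝ᵥ z)) / ZZ V y := by
    simp only [gg, dotProduct, Finset.sum_div, Finset.sum_mul, Finset.mul_sum]
    rw [Finset.sum_comm]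
    refine Finset.sum_congr rfl fun v _ => Finset.sum_congr rfl fun i _ => by ring
  rw [e1]; field_simp

lemma HH_symm (V : Finset (Fin n → ℝ)) (y) (i k) : HH V y i k = HH V y k i := by
  simp only [HH]
  congr 1
  · congr 1; refine Finset.sum_congr rfl fun v _ => by ring
  · ring

lemma HH_quad {V : Finset (Fin n → ℝ)} (hV : V.Nonempty) (y z : Fin n → ℝ) :
    z ⬝ᵥ (HH V y).mulVec z =
      (∑ v ∈ V, Real.exp (v ⬝ᵥ y) * (v ⬝ᵥ z - gg V y ⬝ᵥ z) ^ 2) / ZZ V y := by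
  have hz := (ZZ_pos hV y).ne'
  have e1 : (gg V y ⬝ᵥ z) = (∑ v ∈ V, Real.exp (v ⬝ᵥ y) * (v ⬝ᵥ z)) / ZZ V y := by
    simp only [gg, dotProduct, Finset.sum_div, Finset.sum_mul, Finset.mul_sum]
    rw [Finset.sum_comm]
    refine Finset.sum_congr rfl fun v _ => Finset.sum_congr rfl fun i _ => by ring
  have e2 : ∀ i, (HH V y).mulVec z i =
      (∑ v ∈ V, Real.exp (v ⬝ᵥ y) * v i * (v ⬝ᵥ z)) / ZZ V y - gg V y i * (gg V y ⬝ᵥ z) := by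
    intro i
    simp only [Matrix.mulVec, HH]
    simp only [dotProduct, sub_mul, Finset.sum_sub_distrib, Finset.mul_sum]
    congr 1
    · simp only [Finset.sum_div, Finset.sum_mul]
      rw [Finset.sum_comm]
      refine Finset.sum_congr rfl fun v _ => Finset.sum_congr rfl fun i _ => by ring
    · refine Finset.sum_congr rfl fun v _ => by ring
  have key : ∀ (q : ℝ) (v : Fin n → ℝ), (v ⬝ᵥ z) * q = ∑ i, v i * z i * q := by
    intro q v; rw [dotProduct, Finset.sum_mul]
  have e3 : z ⬝ᵥ (HH V y).mulVec z = (∑ v ∈ V, Real.exp (v ⬝ᵥ y) * (v ⬝ᵥ z)^2) / ZZ V y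
      - (gg V y ⬝ᵥ z)^2 := by
    conv_lhs => rw [dotProduct]
    simp only [e2, mul_sub, Finset.sum_sub_distrib]
    congr 1
    · simp only [Finset.sum_div, Finset.mul_sum]
      rw [Finset.sum_comm]
      refine Finset.sum_congr rfl fun v _ => ?_
      have := key (v ⬝ᵥ z) v
      rw [sq, this, Finset.mul_sum, Finset.sum_div]
      refine Finset.sum_congr rfl fun i _ => by ring
    · rw [sq, key]
      refine Finset.sum_congr rfl fun i _ => by ring
  rw [e3]
  set G := gg V y ⬝ᵥ z
  have e4 : ∑ v ∈ V, Real.exp (v ⬝ᵥ y) * (v ⬝ᵥ z - G)^2 = ∑ v ∈ V, Real.exp (v ⬝ᵥ y) * (v ⬝ᵥ z)^2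
     - 2 * G * (∑ v ∈ V, Real.exp (v ⬝ᵥ y) * (v ⬝ᵥ z)) + G^2 * ZZ V y := by
    simp only [ZZ, Finset.mul_sum]
    rw [← Finset.sum_sub_distrib, ← Finset.sum_add_distrib]
    refine Finset.sum_congr rfl fun v _ => by ring
  have e5 : ∑ v ∈ V, Real.exp (v ⬝ᵥ y) * (v ⬝ᵥ z) = G * ZZ V y := by rw [e1]; field_simp
  rw [e4, e5]; field_simp; ring

lemma HH_quad_pos {V : Finset (Fin n → ℝ)} (hV : V.Nonempty) (y z : Fin n → ℝ)
    (h : ¬ ∃ c, ∀ v ∈ V, v ⬝ᵥ z = c) : 0 < z ⬝ᵥ (HH V y).mulVec z := by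
  rw [HH_quad hV]
  apply div_pos _ (ZZ_pos hV y)
  push Not at h
  obtain ⟨v, hv, hne⟩ := h (gg V y ⬝ᵥ z)
  apply Finset.sum_pos' (fun v _ => by positivity)
  refine ⟨v, hv, mul_pos (Real.exp_pos _) (by have := sub_ne_zero.2 hne; positivity)⟩

lemma gg_mem {V : Finset (Fin n → ℝ)} (hV : V.Nonempty) (y) :
    gg V y ∈ convexHull ℝ (V : Set (Fin n → ℝ)) := by
  have : gg V y = ∑ v ∈ V, (Real.exp (v ⬝ᵥ y) / ZZ V y) • v := by
    ext i
    simp only [gg, Finset.sum_apply, Pi.smul_apply, smul_eq_mul, Finset.sum_div]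
    refine Finset.sum_congr rfl fun v _ => by ring
  rw [this]
  apply (convex_convexHull ℝ _).sum_mem
  · intro v _; exact div_nonneg (Real.exp_pos _).le (ZZ_pos hV y).le
  · rw [← Finset.sum_div]; exact div_self (ZZ_pos hV y).ne'
  · intro v hv; exact subset_convexHull ℝ _ hv

lemma le_logZZ {V : Finset (Fin n → ℝ)} (y p : Fin n → ℝ)
    (hp : p ∈ convexHull ℝ (V : Set (Fin n → ℝ))) : p ⬝ᵥ y ≤ Real.log (ZZ V y) := by
  have hV : V.Nonempty := by
    have := convexHull_nonempty_iff.1 ⟨p, hp⟩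
    simpa using this
  have hc : Convex ℝ {q : Fin n → ℝ | q ⬝ᵥ y ≤ Real.log (ZZ V y)} := by
    apply convex_halfSpace_le
    exact ⟨fun a b => add_dotProduct _ _ _, fun c a => by simp⟩
  refine convexHull_min ?_ hc hp
  intro v hv
  show v ⬝ᵥ y ≤ _
  rw [← Real.log_exp (v ⬝ᵥ y)]
  apply Real.log_le_log (Real.exp_pos _)
  exact Finset.single_le_sum (f := fun v => Real.exp (v ⬝ᵥ y)) (fun v _ => (Real.exp_pos _).le) hv

end AF

namespace AF
variable {n : ℕ} {J : Type*} [Fintype J]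

lemma isCompact_sum' {κ : Type*} (s : Finset κ) (A : κ → Set (Fin n → ℝ))
    (h : ∀ i ∈ s, IsCompact (A i)) : IsCompact (∑ i ∈ s, A i) := by
  classical
  induction s using Finset.induction_on with
  | empty => simp only [Finset.sum_empty]; exact isCompact_singleton
  | insert a s ha ih =>
    rw [Finset.sum_insert ha]
    exact (h a (by simp)).add (ih fun i hi => h i (by simp [hi]))

noncomputable def MM (V : J → Finset (Fin n → ℝ)) (t : J → ℝ) (y : Fin n → ℝ) :
    Matrix (Fin n) (Fin n) ℝ := ∑ j, t j • HH (V j) y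

noncomputable def KK (V : J → Finset (Fin n → ℝ)) (t : J → ℝ) : Set (Fin n → ℝ) :=
    ∑ j, t j • convexHull ℝ (V j : Set (Fin n → ℝ))

lemma KK_convex (V : J → Finset (Fin n → ℝ)) (t : J → ℝ) : Convex ℝ (KK V t) :=
  convex_sum _ fun _ _ => (convex_convexHull ℝ _).smul _

lemma KK_compact (V : J → Finset (Fin n → ℝ)) (t : J → ℝ) : IsCompact (KK V t) :=
  isCompact_sum' _ _ fun j _ => ((V j).finite_toSet.isCompact_convexHull ℝ).smul (t j)

lemma MM_quad_pos [Nonempty J] {V : J → Finset (Fin n → ℝ)} (hV : ∀ j, (V j).Nonempty)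
    (hc : ∀ j, ∀ z, z ≠ 0 → ¬ ∃ c, ∀ v ∈ V j, v ⬝ᵥ z = c) {t : J → ℝ} (ht : ∀ j, 0 < t j)
    (y z : Fin n → ℝ) (hz : z ≠ 0) : 0 < z ⬝ᵥ (MM V t y).mulVec z := by
  have : z ⬝ᵥ (MM V t y).mulVec z = ∑ j, t j * (z ⬝ᵥ (HH (V j) y).mulVec z) := by
    simp [MM, Matrix.sum_mulVec, dotProduct_sum, Matrix.smul_mulVec]
  rw [this]
  exact Finset.sum_pos (fun j _ => mul_pos (ht j) (HH_quad_pos (hV j) y z (hc j z hz)))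
    Finset.univ_nonempty

lemma MM_det_pos [Nonempty J] {V : J → Finset (Fin n → ℝ)} (hV : ∀ j, (V j).Nonempty)
    (hc : ∀ j, ∀ z, z ≠ 0 → ¬ ∃ c, ∀ v ∈ V j, v ⬝ᵥ z = c) {t : J → ℝ} (ht : ∀ j, 0 < t j)
    (y : Fin n → ℝ) : 0 < (MM V t y).det := by
  apply Matrix.PosDef.det_pos
  apply Matrix.PosDef.of_dotProduct_mulVec_pos
  · ext i k
    simp [MM, Matrix.sum_apply, Matrix.conjTranspose_apply, HH_symm]
  · intro z hz
    simpa using MM_quad_pos hV hc ht y z hz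

noncomputable def GG (V : J → Finset (Fin n → ℝ)) (t : J → ℝ) (y : Fin n → ℝ) : Fin n → ℝ :=
  ∑ j, t j • gg (V j) y

lemma hasFDerivAt_GG {V : J → Finset (Fin n → ℝ)} (hV : ∀ j, (V j).Nonempty) (t : J → ℝ)
    (y : Fin n → ℝ) :
    HasFDerivAt (GG V t) (Matrix.mulVecLin (MM V t y)).toContinuousLinearMap y := by
  have : HasFDerivAt (fun y => ∑ j, t j • gg (V j) y)
      (∑ j, t j • (Matrix.mulVecLin (HH (V j) y)).toContinuousLinearMap) y :=
    HasFDerivAt.fun_sum fun j _ => (hasFDerivAt_gg (hV j) y).const_smul (t j)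
  refine this.congr_fderiv ?_
  ext z i
  simp [MM, Matrix.sum_mulVec, Matrix.smul_mulVec, Finset.sum_apply]

lemma GG_inj [Nonempty J] {V : J → Finset (Fin n → ℝ)} (hV : ∀ j, (V j).Nonempty)
    (hc : ∀ j, ∀ z, z ≠ 0 → ¬ ∃ c, ∀ v ∈ V j, v ⬝ᵥ z = c) {t : J → ℝ} (ht : ∀ j, 0 < t j) :
    Function.Injective (GG V t) := by
  intro a b hab
  by_contra hne
  have hz : b - a ≠ 0 := sub_ne_zero.2 (Ne.symm hne)
  set z := b - a
  have hd : ∀ s : ℝ, HasDerivAt (fun s : ℝ => z ⬝ᵥ GG V t (a + s • z))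
      (z ⬝ᵥ (MM V t (a + s • z)).mulVec z) s := by
    intro s
    have h1 : HasDerivAt (fun s : ℝ => a + s • z) z s := by
      simpa using ((hasDerivAt_id s).smul_const z).const_add a
    have h2 := (hasFDerivAt_GG hV t (a + s • z)).comp_hasDerivAt s h1
    have h3 := (dotL_hasFDerivAt z (GG V t (a + s • z))).comp_hasDerivAt s h2
    rw [dotL_apply] at h3
    exact h3
  have hm : StrictMono (fun s : ℝ => z ⬝ᵥ GG V t (a + s • z)) := by
    apply strictMono_of_deriv_pos
    intro s
    rw [(hd s).deriv]
    exact MM_quad_pos hV hc ht _ z hz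
  have := hm (zero_lt_one)
  simp [z, hab] at this

lemma GG_mem {V : J → Finset (Fin n → ℝ)} (hV : ∀ j, (V j).Nonempty) (t : J → ℝ) (y) :
    GG V t y ∈ KK V t :=
  Set.finsetSum_mem_finsetSum _ _ _ fun j _ => Set.smul_mem_smul_set (gg_mem (hV j) y)

lemma GG_surj {V : J → Finset (Fin n → ℝ)} (hV : ∀ j, (V j).Nonempty) {t : J → ℝ}
    (ht : ∀ j, 0 < t j) (x : Fin n → ℝ) (hx : x ∈ interior (KK V t)) : ∃ y, GG V t y = x := by
  obtain ⟨r, hr, hball⟩ := Metric.isOpen_iff.1 isOpen_interior x hx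
  set ψ : (Fin n → ℝ) → ℝ := fun y => (∑ j, t j * Real.log (ZZ (V j) y)) - x ⬝ᵥ y with hψ
  have hsup : ∀ p ∈ KK V t, ∀ y, p ⬝ᵥ y ≤ ∑ j, t j * Real.log (ZZ (V j) y) := by
    intro p hp y
    obtain ⟨g, hg, rfl⟩ := (Set.mem_finsetSum _ _ _).1 hp
    rw [sum_dotProduct]
    refine Finset.sum_le_sum fun j _ => ?_
    obtain ⟨q, hq, hq2⟩ := Set.mem_smul_set.1 (hg (mem_univ j))
    rw [← hq2, smul_dotProduct, smul_eq_mul]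
    exact mul_le_mul_of_nonneg_left (le_logZZ y q hq) (ht j).le
  have hcoer : ∀ y, r / 2 * ‖y‖ ≤ ψ y := by
    intro y
    set p : Fin n → ℝ := fun i => x i + r / 2 * SignType.sign (y i) with hp
    have hpm : p ∈ KK V t := by
      apply interior_subset
      apply hball
      rw [Metric.mem_ball, dist_pi_lt_iff hr]
      intro i
      simp only [hp, Real.dist_eq, add_sub_cancel_left, abs_mul]
      have : |((SignType.sign (y i) : SignType) : ℝ)| ≤ 1 := by
        rcases SignType.sign (y i) with _ | _ | _ <;> simp
      rw [abs_of_pos (half_pos hr)]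
      nlinarith
    have h1 := hsup p hpm y
    have h2 : p ⬝ᵥ y = x ⬝ᵥ y + r / 2 * ∑ i, |y i| := by
      simp only [dotProduct, hp, add_mul, Finset.sum_add_distrib, Finset.mul_sum]
      congr 1
      refine Finset.sum_congr rfl fun i _ => ?_
      rw [mul_assoc, sign_mul_self]
    have h3 : ‖y‖ ≤ ∑ i, |y i| := by
      rw [pi_norm_le_iff_of_nonneg (Finset.sum_nonneg fun i _ => abs_nonneg _)]
      intro i
      rw [Real.norm_eq_abs]
      exact Finset.single_le_sum (f := fun i => |y i|) (fun i _ => abs_nonneg _) (mem_univ i)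
    simp only [hψ]
    nlinarith
  have hder : ∀ y, HasFDerivAt ψ (dotL (GG V t y) - dotL x) y := by
    intro y
    have h1 : HasFDerivAt (fun y => ∑ j, t j * Real.log (ZZ (V j) y))
        (∑ j, t j • dotL (gg (V j) y)) y :=
      HasFDerivAt.fun_sum fun j _ => (hasFDerivAt_logZZ (hV j) y).const_mul (t j)
    refine (h1.sub (dotL_hasFDerivAt x y)).congr_fderiv ?_
    congr 1
    ext z
    simp [dotL_apply, GG, sum_dotProduct]
  have hcont : Continuous ψ :=
    continuous_iff_continuousAt.2 fun y => (hder y).continuousAt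
  have htend : Filter.Tendsto ψ (Filter.cocompact _) Filter.atTop := by
    refine Filter.tendsto_atTop_mono hcoer ?_
    exact (tendsto_norm_cocompact_atTop).const_mul_atTop (half_pos hr)
  obtain ⟨y, hy⟩ := hcont.exists_forall_le htend
  refine ⟨y, ?_⟩
  have h0 := IsLocalMin.hasFDerivAt_eq_zero (Filter.Eventually.of_forall hy) (hder y)
  ext i
  have := congrArg (fun φ => φ (Pi.single i 1)) h0
  simp [dotL_apply] at this
  linarith

lemma vol_KK [Nonempty J] {V : J → Finset (Fin n → ℝ)} (hV : ∀ j, (V j).Nonempty)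
    (hc : ∀ j, ∀ z, z ≠ 0 → ¬ ∃ c, ∀ v ∈ V j, v ⬝ᵥ z = c) {t : J → ℝ} (ht : ∀ j, 0 < t j) :
    Integrable (fun y => (MM V t y).det) ∧ ∫ y, (MM V t y).det = (volume (KK V t)).toReal := by
  have h1 := lintegral_abs_det_fderiv_eq_addHaar_image (volume : Measure (Fin n → ℝ))
    (s := Set.univ) (f := GG V t) MeasurableSet.univ
    (fun y _ => (hasFDerivAt_GG hV t y).hasFDerivWithinAt) (GG_inj hV hc ht).injOn
  have hvol : volume (GG V t '' Set.univ) = volume (KK V t) := by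
    apply le_antisymm
    · apply measure_mono
      rintro _ ⟨y, -, rfl⟩
      exact GG_mem hV t y
    · calc volume (KK V t) ≤ volume (GG V t '' Set.univ ∪ frontier (KK V t)) := by
            apply measure_mono
            intro x hx
            by_cases hi : x ∈ interior (KK V t)
            · left
              obtain ⟨y, hy⟩ := GG_surj hV ht x hi
              exact ⟨y, trivial, hy⟩
            · right; exact ⟨subset_closure hx, hi⟩
        _ ≤ volume (GG V t '' Set.univ) + volume (frontier (KK V t)) := measure_union_le _ _
        _ = _ := by rw [(KK_convex V t).addHaar_frontier volume, add_zero]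
  have hdet : ∀ y, ENNReal.ofReal
      |((Matrix.mulVecLin (MM V t y)).toContinuousLinearMap : (Fin n → ℝ) →L[ℝ] _).det| =
      ENNReal.ofReal (MM V t y).det := by
    intro y
    rw [LinearMap.det_toContinuousLinearMap]
    have : LinearMap.det (Matrix.mulVecLin (MM V t y)) = (MM V t y).det :=
      LinearMap.det_toLin' _
    rw [this, abs_of_pos (MM_det_pos hV hc ht y)]
  rw [Measure.restrict_univ] at h1
  simp only [hdet] at h1
  rw [hvol] at h1
  have hcont : Continuous (fun y => (MM V t y).det) := by
    apply Continuous.matrix_det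
    apply continuous_matrix
    intro i k
    simp only [MM, Matrix.sum_apply, Matrix.smul_apply, HH, gg, smul_eq_mul]
    have hz : ∀ j, Continuous (ZZ (V j)) := fun j =>
      continuous_iff_continuousAt.2 fun y => (hasFDerivAt_ZZ (V j) y).continuousAt
    have hs : ∀ j (c : (Fin n → ℝ) → ℝ),
        Continuous (fun y => ∑ v ∈ V j, Real.exp (v ⬝ᵥ y) * c v) := fun j c =>
      continuous_iff_continuousAt.2 fun y => (hasFDerivAt_sumexp (V j) c y).continuousAt
    refine continuous_finsetSum _ fun j _ => continuous_const.mul ?_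
    have hz0 : ∀ y, ZZ (V j) y ≠ 0 := fun y => (ZZ_pos (hV j) y).ne'
    refine Continuous.sub ?_ (((hs j fun v => v i).div (hz j) hz0).mul
      ((hs j fun v => v k).div (hz j) hz0))
    refine Continuous.div ?_ (hz j) hz0
    have := hs j fun v => v i * v k
    simpa only [mul_assoc] using this
  have hfin : volume (KK V t) ≠ ⊤ := (KK_compact V t).measure_lt_top.ne
  have hpos : 0 ≤ᵐ[volume] fun y => (MM V t y).det :=
    Filter.Eventually.of_forall fun y => (MM_det_pos hV hc ht y).le
  constructor
  · refine ⟨hcont.aestronglyMeasurable, ?_⟩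
    rw [hasFiniteIntegral_iff_ofReal hpos, h1]
    exact hfin.lt_top
  · rw [integral_eq_lintegral_of_nonneg_ae hpos hcont.aestronglyMeasurable, h1]

/-- polynomial version -/
noncomputable def pp (V : J → Finset (Fin n → ℝ)) (y : Fin n → ℝ) : MvPolynomial J ℝ :=
  (∑ j, (HH (V j) y).map fun a => MvPolynomial.C a * MvPolynomial.X j).det

lemma eval_pp (V : J → Finset (Fin n → ℝ)) (y) (t : J → ℝ) :
    MvPolynomial.eval t (pp V y) = (MM V t y).det := by
  rw [pp, RingHom.map_det]
  congr 1
  ext i k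
  simp [MM, Matrix.sum_apply, mul_comm]

lemma pp_homog (V : J → Finset (Fin n → ℝ)) (y) : (pp V y).IsHomogeneous n := by
  rw [pp, Matrix.det_apply]
  apply MvPolynomial.IsHomogeneous.sum
  intro σ _
  have : (∏ i, (∑ j, (HH (V j) y).map fun a => (MvPolynomial.C a * MvPolynomial.X j :
      MvPolynomial J ℝ)) (σ i) i).IsHomogeneous n := by
    have h := MvPolynomial.IsHomogeneous.prod (univ : Finset (Fin n))
      (fun i => (∑ j, (HH (V j) y).map fun a => (MvPolynomial.C a * MvPolynomial.X j :
      MvPolynomial J ℝ)) (σ i) i) (fun _ => 1) (fun i _ => by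
        rw [Matrix.sum_apply]
        apply MvPolynomial.IsHomogeneous.sum
        intro j _
        exact MvPolynomial.isHomogeneous_C_mul_X _ _)
    simpa using h
  rw [Units.smul_def]
  exact (MvPolynomial.homogeneousSubmodule J ℝ n).toAddSubgroup.zsmul_mem this _

theorem vol_poly [Nonempty J] {V : J → Finset (Fin n → ℝ)} (hV : ∀ j, (V j).Nonempty)
    (hc : ∀ j, ∀ z, z ≠ 0 → ¬ ∃ c, ∀ v ∈ V j, v ⬝ᵥ z = c) :
    ∃ f : MvPolynomial J ℝ, f.IsHomogeneous n ∧
      ∀ t : J → ℝ, (∀ j, 0 < t j) → MvPolynomial.eval t f = (volume (KK V t)).toReal := by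
  classical
  set E := MvPolynomial.homogeneousSubmodule J ℝ n
  haveI : FiniteDimensional ℝ E :=
    Module.Finite.iff_fg.2 (MvPolynomial.homogeneousSubmodule_fg J ℝ n)
  let T := {t : J → ℝ // ∀ j, 0 < t j}
  let Lt : T → E →ₗ[ℝ] ℝ := fun t => (MvPolynomial.aeval t.1).toLinearMap ∘ₗ E.subtype
  have hint : ∀ Λ : E →ₗ[ℝ] ℝ, Integrable (fun y => Λ ⟨pp V y, pp_homog V y⟩) := by
    intro Λ
    have hs : Λ ∈ Submodule.span ℝ (Set.range Lt) := by
      apply FiniteDimensional.mem_span_of_iInf_ker_le_ker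
      intro q hq
      have : q = 0 := by
        apply Subtype.ext
        apply MvPolynomial.funext_set (fun _ => Set.Ioi (0:ℝ)) (fun _ => Set.Ioi_infinite 0)
        intro x hx
        have h1 := (Submodule.mem_iInf _).1 hq ⟨x, fun j => hx j trivial⟩
        rw [LinearMap.mem_ker] at h1
        simpa [Lt, MvPolynomial.aeval_eq_eval] using h1
      rw [this]; exact zero_mem _
    induction hs using Submodule.span_induction with
    | mem Λ h =>
      obtain ⟨t, rfl⟩ := h
      refine (vol_KK hV hc t.2).1.congr (Filter.Eventually.of_forall fun y => ?_)
      simp [Lt, MvPolynomial.aeval_eq_eval, eval_pp]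
    | zero => simp
    | add a b _ _ ha hb => exact ha.add hb
    | smul c a _ ha => simpa using ha.const_mul c
  let b := Module.finBasis ℝ E
  let q : E := ∑ i, (∫ y, b.coord i ⟨pp V y, pp_homog V y⟩) • b i
  refine ⟨q.1, q.2, fun t ht => ?_⟩
  rw [← (vol_KK hV hc ht).2]
  have h1 : ∀ y, (MM V t y).det = ∑ i, b.coord i ⟨pp V y, pp_homog V y⟩ * Lt ⟨t, ht⟩ (b i) := by
    intro y
    rw [← eval_pp]
    have h2 := congrArg (Lt ⟨t, ht⟩) (b.sum_repr ⟨pp V y, pp_homog V y⟩)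
    rw [map_sum] at h2
    simp only [map_smul, smul_eq_mul] at h2
    simp only [Module.Basis.coord_apply]
    rw [h2]
    simp [Lt, MvPolynomial.aeval_eq_eval]
  simp only [h1]
  rw [integral_finsetSum _ fun i _ => (hint _).mul_const _]
  have h3 : MvPolynomial.eval t q.1 = Lt ⟨t, ht⟩ q := by simp [Lt, MvPolynomial.aeval_eq_eval]
  rw [h3]
  simp only [q, map_sum, map_smul, smul_eq_mul]
  exact Finset.sum_congr rfl fun i _ => (integral_mul_const _ _).symm

end AF

namespace AF

noncomputable def linP {ι J : Type*} [Fintype ι] [DecidableEq ι] (A : (ι → ℝ) →ₗ[ℝ] (J → ℝ))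
    (f : MvPolynomial J ℝ) : MvPolynomial ι ℝ :=
  MvPolynomial.aeval (fun j => ∑ i, MvPolynomial.C (A (Pi.single i 1) j) * MvPolynomial.X i) f

lemma eval_linP {ι J : Type*} [Fintype ι] [DecidableEq ι] (A : (ι → ℝ) →ₗ[ℝ] (J → ℝ))
    (f : MvPolynomial J ℝ) (h : ι → ℝ) :
    MvPolynomial.eval h (linP A f) = MvPolynomial.eval (A h) f := by
  have hA : ∀ j, A h j = ∑ i, A (Pi.single i 1) j * h i := by
    intro j
    have : h = ∑ i, h i • (Pi.single i (1:ℝ) : ι → ℝ) := by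
      ext k; simp [Finset.sum_apply, Pi.single_apply]
    conv_lhs => rw [this]
    simp [map_sum, Finset.sum_apply, mul_comm]
  rw [linP, ← MvPolynomial.coe_aeval_eq_eval, ← MvPolynomial.coe_aeval_eq_eval]
  simp only [RingHom.coe_coe]
  rw [← AlgHom.comp_apply, MvPolynomial.comp_aeval]
  congr 2
  ext j
  simp [hA]

lemma linP_homog {ι J : Type*} [Fintype ι] [DecidableEq ι] (A : (ι → ℝ) →ₗ[ℝ] (J → ℝ))
    {f : MvPolynomial J ℝ} {n} (hf : f.IsHomogeneous n) : (linP A f).IsHomogeneous n := by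
  have := hf.aeval (fun j => ∑ i, MvPolynomial.C (A (Pi.single i 1) j) * MvPolynomial.X i)
    (n := 1) (fun j => MvPolynomial.IsHomogeneous.sum _ _ _ fun i _ =>
      MvPolynomial.isHomogeneous_C_mul_X _ _)
  rw [one_mul] at this
  exact this

theorem poly_of_cone {ι : Type} [Fintype ι] [DecidableEq ι] [Nonempty ι] {n : ℕ}
    {C : Set (ι → ℝ)} (hC : IsOpen C) (hne : C.Nonempty)
    (Φ : (ι → ℝ) → ℝ)
    (hΦ : ∀ (J : Type) [Fintype J] [Nonempty J] (x : J → ι → ℝ), (∀ j, x j ∈ C) →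
      ∃ f : MvPolynomial J ℝ, f.IsHomogeneous n ∧
        ∀ t : J → ℝ, (∀ j, 0 < t j) → MvPolynomial.eval t f = Φ (∑ j, t j • x j)) :
    ∃ f : MvPolynomial ι ℝ, f.IsHomogeneous n ∧ ∀ h ∈ C, MvPolynomial.eval h f = Φ h := by
  obtain ⟨h0, hh0⟩ := hne
  obtain ⟨δ, hδ, hδC, hδn⟩ : ∃ δ : ℝ, 0 < δ ∧ (∀ j, h0 + δ • (Pi.single j 1 : ι → ℝ) ∈ C) ∧
      δ + ∑ i, h0 i ≠ 0 := by
    have h1 : ∀ᶠ δ in nhdsWithin (0:ℝ) (Set.Ioi 0),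
        ∀ j, h0 + δ • (Pi.single j 1 : ι → ℝ) ∈ C := by
      rw [Filter.eventually_all]
      intro j
      have hc : Continuous fun δ : ℝ => h0 + δ • (Pi.single j 1 : ι → ℝ) := by fun_prop
      exact (hc.continuousAt.eventually (hC.mem_nhds (by simpa using hh0))).filter_mono
        nhdsWithin_le_nhds
    have h2 : ∀ᶠ δ in nhdsWithin (0:ℝ) (Set.Ioi 0), δ + ∑ i, h0 i ≠ 0 := by
      by_cases hs : ∑ i, h0 i = 0
      · filter_upwards [self_mem_nhdsWithin] with δ hδ
        rw [hs, add_zero]; exact ne_of_gt hδ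
      · have hc : Continuous fun δ : ℝ => δ + ∑ i, h0 i := by fun_prop
        exact (hc.continuousAt.eventually_ne (by simpa using hs)).filter_mono
          nhdsWithin_le_nhds
    obtain ⟨δ, h⟩ := ((h1.and h2).and self_mem_nhdsWithin).exists
    exact ⟨δ, h.2, h.1.1, h.1.2⟩
  set x : ι → ι → ℝ := fun j => h0 + δ • (Pi.single j 1 : ι → ℝ) with hx
  obtain ⟨f0, hf0, hf0e⟩ := hΦ ι x hδC
  set c := δ + ∑ i, h0 i with hc
  -- section
  let S : (ι → ℝ) →ₗ[ℝ] (ι → ℝ) :=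
    { toFun := fun h j => (h j - (∑ i, h i) / c * h0 j) / δ
      map_add' := by intro a b; ext j; simp [Finset.sum_add_distrib]; field_simp; ring
      map_smul' := by intro a b; ext j; simp [← Finset.mul_sum]; field_simp }
  have hLS : ∀ h : ι → ℝ, ∑ j, S h j • x j = h := by
    intro h
    have hsum : ∑ j, S h j = (∑ i, h i) / c := by
      simp only [S, LinearMap.coe_mk, AddHom.coe_mk]
      rw [← Finset.sum_div, Finset.sum_sub_distrib, ← Finset.mul_sum]
      have : ∑ i, h0 i = c - δ := by rw [hc]; ring
      rw [this]; field_simp; ring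
    ext k
    have : (∑ j, S h j • x j) k = (∑ j, S h j) * h0 k + δ * S h k := by
      simp [hx, Finset.sum_apply, mul_add, Finset.sum_add_distrib, Finset.sum_mul, Pi.single_apply]
      ring
    rw [this, hsum]
    simp only [S, LinearMap.coe_mk, AddHom.coe_mk]
    field_simp; ring
  have hSL : ∀ t : ι → ℝ, S (∑ j, t j • x j) = t := by
    intro t
    ext k
    have e : ∀ k, (∑ j, t j • x j) k = (∑ j, t j) * h0 k + δ * t k := by
      intro k
      simp [hx, Finset.sum_apply, mul_add, Finset.sum_add_distrib, Finset.sum_mul, Pi.single_apply]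
      ring
    simp only [S, LinearMap.coe_mk, AddHom.coe_mk, e]
    rw [Finset.sum_add_distrib, ← Finset.mul_sum, ← Finset.mul_sum]
    have : ∑ i, h0 i = c - δ := by rw [hc]; ring
    rw [this]; field_simp; ring
  refine ⟨linP S f0, linP_homog S hf0, fun h' hh' => ?_⟩
  obtain ⟨ε, hε, hεC⟩ : ∃ ε : ℝ, 0 < ε ∧ h' - ε • ∑ j, x j ∈ C := by
    have hc : Continuous fun ε : ℝ => h' - ε • ∑ j, x j := by fun_prop
    have h1 := (hc.continuousAt.eventually (hC.mem_nhds (x := h' - (0:ℝ) • ∑ j, x j)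
      (by simpa using hh'))).filter_mono (nhdsWithin_le_nhds (s := Set.Ioi (0:ℝ)))
    obtain ⟨ε, h⟩ := (h1.and self_mem_nhdsWithin).exists
    exact ⟨ε, h.2, h.1⟩
  set h := h' - ε • ∑ j, x j with hh
  let x' : Option ι → ι → ℝ := fun o => o.elim h x
  obtain ⟨f1, hf1, hf1e⟩ := hΦ (Option ι) x' (by rintro (_ | j); exacts [hεC, hδC j])
  let L' : (Option ι → ℝ) →ₗ[ℝ] (ι → ℝ) := Fintype.linearCombination ℝ x'
  have hL' : ∀ t, L' t = t none • h + ∑ j, t (some j) • x j := by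
    intro t; simp [L', Fintype.linearCombination_apply, Fintype.sum_option, x']
  have key : f1 - linP L' (linP S f0) = 0 := by
    apply poly_zero_of_open (C := {t : Option ι → ℝ | (∀ o, 0 < t o) ∧ ∀ j, 0 < S (L' t) j})
    · have c1 : Continuous fun t : Option ι → ℝ => S (L' t) :=
        (S ∘ₗ L').continuous_of_finiteDimensional
      simp only [Set.ofPred_and, Set.ofPred_forall]
      exact (isOpen_iInter_of_finite fun o => isOpen_lt continuous_const (continuous_apply o)).inter
        (isOpen_iInter_of_finite fun j => isOpen_lt continuous_const
          ((continuous_apply j).comp c1))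
    · have h1 : ∀ᶠ s in nhdsWithin (0:ℝ) (Set.Ioi 0), ∀ j, 0 < 1 + s * S h j := by
        rw [Filter.eventually_all]
        intro j
        have hc : Continuous fun s : ℝ => 1 + s * S h j := by fun_prop
        exact (hc.continuousAt.eventually (lt_mem_nhds (a := 0) (by simp))).filter_mono
          nhdsWithin_le_nhds
      obtain ⟨s, h1, hs⟩ := (h1.and self_mem_nhdsWithin).exists
      refine ⟨fun o => o.elim s (fun _ => 1), ?_, fun j => ?_⟩
      · rintro (_ | j)
        · exact hs
        · simp
      · have := hSL (fun _ => 1)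
        rw [hL', map_add, map_smul]
        simp only [Option.elim_none, Option.elim_some]
        rw [this]
        simpa [add_comm] using h1 j
    · rintro t ⟨ht1, ht2⟩
      rw [map_sub, eval_linP, eval_linP, hf0e _ ht2, hf1e t ht1, hLS]
      simp [L', Fintype.linearCombination_apply]
  rw [sub_eq_zero] at key
  have e1 : L' (fun o => o.elim 1 (fun _ => ε)) = h' := by
    rw [hL']; simp [hh, ← Finset.smul_sum]
  have e2 := hf1e (fun o => o.elim 1 (fun _ => ε)) (by rintro (_ | j) <;> simp [hε])
  rw [key, eval_linP, e1] at e2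
  rw [e2]
  congr 1

end AF

namespace AF

section fan
variable {n : ℕ} {ι : Type} [Fintype ι] [DecidableEq ι]

def PP (u : ι → Fin n → ℝ) (h : ι → ℝ) : Set (Fin n → ℝ) := {x | ∀ k, u k ⬝ᵥ x ≤ h k}

structure Fan (n : ℕ) (ι : Type) [Fintype ι] [DecidableEq ι] where
  u : ι → Fin n → ℝ
  S : Finset (Finset ι)
  b : Finset ι → ι → Fin n → ℝ
  card : ∀ σ ∈ S, σ.card = n
  dual : ∀ σ ∈ S, ∀ i ∈ σ, ∀ j ∈ σ, u i ⬝ᵥ b σ j = if i = j then 1 else 0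
  expand : ∀ σ ∈ S, ∀ x, x = ∑ i ∈ σ, (u i ⬝ᵥ x) • b σ i
  max : ∀ c : Fin n → ℝ, ∃ σ ∈ S, ∀ i ∈ σ, 0 ≤ c ⬝ᵥ b σ i

omit [Fintype ι] [DecidableEq ι] in
lemma PP_convex (u : ι → Fin n → ℝ) (h : ι → ℝ) : Convex ℝ (PP u h) := by
  intro x hx y hy a b ha hb hab k
  have h1 := hx k
  have h2 := hy k
  simp only [dotProduct_add, dotProduct_smul, smul_eq_mul]
  calc a * u k ⬝ᵥ x + b * u k ⬝ᵥ y ≤ a * h k + b * h k := by gcongr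
    _ = h k := by rw [← add_mul, hab, one_mul]

omit [Fintype ι] [DecidableEq ι] in
lemma dot_cont (v : Fin n → ℝ) : Continuous fun x : Fin n → ℝ => v ⬝ᵥ x := by
  unfold dotProduct; fun_prop

omit [Fintype ι] [DecidableEq ι] in
lemma PP_closed (u : ι → Fin n → ℝ) (h : ι → ℝ) : IsClosed (PP u h) := by
  have : PP u h = ⋂ k, {x | u k ⬝ᵥ x ≤ h k} := by ext x; simp [PP]
  rw [this]
  exact isClosed_iInter fun k => isClosed_le (dot_cont _) continuous_const

namespace Fan
variable (X : Fan n ι)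

def xv (σ : Finset ι) (h : ι → ℝ) : Fin n → ℝ := ∑ i ∈ σ, h i • X.b σ i

lemma xv_add (σ) (h h' : ι → ℝ) : X.xv σ (h + h') = X.xv σ h + X.xv σ h' := by
  simp [xv, add_smul, Finset.sum_add_distrib]

lemma xv_smul (σ) (t : ℝ) (h : ι → ℝ) : X.xv σ (t • h) = t • X.xv σ h := by
  simp [xv, mul_smul, Finset.smul_sum]

variable {X}

lemma dot_sum {σ} (hσ : σ ∈ X.S) {i} (hi : i ∈ σ) (h : ι → ℝ) :
    X.u i ⬝ᵥ (∑ j ∈ σ, h j • X.b σ j) = h i := by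
  rw [dotProduct_sum]
  rw [Finset.sum_eq_single i]
  · simp [X.dual σ hσ i hi i hi]
  · intro j hj hne
    simp [X.dual σ hσ i hi j hj, hne.symm]
  · intro h; exact absurd hi h

lemma dot_xv {σ} (hσ : σ ∈ X.S) {i} (hi : i ∈ σ) (h : ι → ℝ) : X.u i ⬝ᵥ X.xv σ h = h i :=
  dot_sum hσ hi h

lemma dot_le {h : ι → ℝ} {x} (hx : x ∈ PP X.u h) {σ} (hσ : σ ∈ X.S) {c : Fin n → ℝ}
    (hc : ∀ i ∈ σ, 0 ≤ c ⬝ᵥ X.b σ i) : c ⬝ᵥ x ≤ c ⬝ᵥ X.xv σ h := by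
  conv_lhs => rw [X.expand σ hσ x]
  rw [xv, dotProduct_sum, dotProduct_sum]
  refine Finset.sum_le_sum fun i hi => ?_
  rw [dotProduct_smul, dotProduct_smul]
  exact mul_le_mul_of_nonneg_right (hx i) (hc i hi)

lemma PP_compact (h : ι → ℝ) : IsCompact (PP X.u h) := by
  apply Metric.isCompact_of_isClosed_isBounded (PP_closed _ _)
  have : ∀ c : Fin n → ℝ, ∃ B, ∀ x ∈ PP X.u h, c ⬝ᵥ x ≤ B := fun c => by
    obtain ⟨σ, hσ, hc⟩ := X.max c
    exact ⟨_, fun x hx => dot_le hx hσ hc⟩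
  choose B hB using this
  rw [isBounded_iff_forall_norm_le]
  refine ⟨∑ i, (|B (Pi.single i 1)| + |B (-Pi.single i 1)|), fun x hx => ?_⟩
  rw [pi_norm_le_iff_of_nonneg (Finset.sum_nonneg fun i _ => by positivity)]
  intro i
  have h1 := hB (Pi.single i 1) x hx
  have h2 := hB (-Pi.single i 1) x hx
  simp at h1 h2
  refine le_trans ?_ (Finset.single_le_sum (f := fun i => (|B (Pi.single i 1)| + |B (-Pi.single i 1)|))
    (fun i _ => by positivity) (mem_univ i))
  rw [Real.norm_eq_abs, abs_le]
  constructor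
  · linarith [le_abs_self (B (-Pi.single i 1)), abs_nonneg (B (Pi.single i 1))]
  · linarith [le_abs_self (B (Pi.single i 1)), abs_nonneg (B (-Pi.single i 1))]

variable (X) in
def Weak (h : ι → ℝ) : Prop := ∀ σ ∈ X.S, X.xv σ h ∈ PP X.u h

lemma Weak.add {h h' : ι → ℝ} (a : X.Weak h) (b : X.Weak h') : X.Weak (h + h') := by
  intro σ hσ k
  rw [xv_add, dotProduct_add]
  exact add_le_add (a σ hσ k) (b σ hσ k)

lemma Weak.smul {h : ι → ℝ} (a : X.Weak h) {t : ℝ} (ht : 0 ≤ t) : X.Weak (t • h) := by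
  intro σ hσ k
  rw [xv_smul, dotProduct_smul]
  exact mul_le_mul_of_nonneg_left (a σ hσ k) ht

variable (X) in
noncomputable def VV (h : ι → ℝ) : Finset (Fin n → ℝ) := by
  classical exact X.S.image fun σ => X.xv σ h

lemma mem_VV {h : ι → ℝ} {v} : v ∈ X.VV h ↔ ∃ σ ∈ X.S, X.xv σ h = v := by
  classical
  simp [VV]

lemma Weak.hull {h : ι → ℝ} (a : X.Weak h) : convexHull ℝ (X.VV h : Set (Fin n → ℝ)) = PP X.u h := by
  apply subset_antisymm
  · refine convexHull_min ?_ (PP_convex _ _)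
    intro v hv
    obtain ⟨σ, hσ, rfl⟩ := mem_VV.1 hv
    exact a σ hσ
  · intro x hx
    by_contra hn
    obtain ⟨φ, s, h1, h2⟩ := geometric_hahn_banach_closed_point (convex_convexHull ℝ _)
      ((X.VV h).finite_toSet.isCompact_convexHull ℝ).isClosed hn
    set c : Fin n → ℝ := fun i => φ (Pi.single i 1)
    have hφ : ∀ z, φ z = c ⬝ᵥ z := by
      intro z
      have : z = ∑ i, z i • (Pi.single i (1:ℝ) : Fin n → ℝ) := by
        ext k; simp [Finset.sum_apply, Pi.single_apply]
      conv_lhs => rw [this]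
      simp [map_sum, dotProduct, c, mul_comm]
    obtain ⟨σ, hσ, hc⟩ := X.max c
    have h3 := h1 (X.xv σ h) (subset_convexHull ℝ _ (mem_VV.2 ⟨σ, hσ, rfl⟩))
    rw [hφ] at h2 h3
    linarith [dot_le hx hσ hc]

lemma Weak.PP_add {h h' : ι → ℝ} (a : X.Weak h) (b : X.Weak h') :
    PP X.u (h + h') = PP X.u h + PP X.u h' := by
  apply subset_antisymm
  · rw [← (a.add b).hull]
    refine convexHull_min ?_ ((PP_convex _ _).add (PP_convex _ _))
    intro v hv
    obtain ⟨σ, hσ, rfl⟩ := mem_VV.1 hv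
    rw [xv_add]
    exact Set.add_mem_add (a σ hσ) (b σ hσ)
  · rintro _ ⟨x, hx, y, hy, rfl⟩ k
    rw [dotProduct_add]
    exact add_le_add (hx k) (hy k)

lemma PP_smul (h : ι → ℝ) {t : ℝ} (ht : 0 < t) : PP X.u (t • h) = t • PP X.u h := by
  ext x
  rw [Set.mem_smul_set_iff_inv_smul_mem₀ ht.ne']
  simp only [PP, Set.mem_ofPred_eq, dotProduct_smul, smul_eq_mul, Pi.smul_apply]
  refine forall_congr' fun k => ?_
  rw [inv_mul_le_iff₀ ht]

lemma weak_zero : X.Weak 0 := by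
  intro σ hσ k
  simp [xv]

lemma PP_zero : PP X.u 0 = {0} := by
  rw [← weak_zero.hull]
  have : (X.VV 0 : Set (Fin n → ℝ)) = {0} := by
    ext v
    rw [Finset.mem_coe, mem_VV]
    simp only [xv, Pi.zero_apply, zero_smul, Finset.sum_const_zero, Set.mem_singleton_iff]
    obtain ⟨σ, hσ, -⟩ := X.max 0
    exact ⟨fun ⟨_, _, h⟩ => h.symm, fun h => ⟨σ, hσ, h.symm⟩⟩
  rw [this, convexHull_singleton]

lemma weak_sum {κ : Type*} (s : Finset κ) (h : κ → ι → ℝ) (hw : ∀ i ∈ s, X.Weak (h i)) :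
    X.Weak (∑ i ∈ s, h i) ∧ PP X.u (∑ i ∈ s, h i) = ∑ i ∈ s, PP X.u (h i) := by
  classical
  induction s using Finset.induction_on with
  | empty => simp only [Finset.sum_empty]; exact ⟨weak_zero, by rw [PP_zero]; rfl⟩
  | insert a s ha ih =>
    obtain ⟨i1, i2⟩ := ih fun i hi => hw i (by simp [hi])
    have h1 := hw a (by simp)
    rw [Finset.sum_insert ha, Finset.sum_insert ha]
    exact ⟨h1.add i1, by rw [h1.PP_add i1, i2]⟩

variable (X) in
def CC : Set (ι → ℝ) := {h | ∀ σ ∈ X.S, ∀ k, k ∉ σ → X.u k ⬝ᵥ X.xv σ h < h k}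

lemma weak_of_mem {h : ι → ℝ} (hh : h ∈ X.CC) : X.Weak h := by
  intro σ hσ k
  by_cases hk : k ∈ σ
  · exact (dot_xv hσ hk h).le
  · exact (hh σ hσ k hk).le

lemma xv_cont (σ) : Continuous (X.xv σ) := by
  unfold xv; fun_prop

lemma CC_open : IsOpen X.CC := by
  have : X.CC = ⋂ σ ∈ X.S, ⋂ k, ⋂ (_ : k ∉ σ), {h | X.u k ⬝ᵥ X.xv σ h < h k} := by
    ext h; simp [CC]
  rw [this]
  refine isOpen_biInter_finset fun σ _ => isOpen_iInter_of_finite fun k =>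
    isOpen_iInter_of_finite fun _ => isOpen_lt ((dot_cont _).comp (xv_cont σ)) (continuous_apply k)

lemma CC_add_weak {h h' : ι → ℝ} (a : h ∈ X.CC) (b : X.Weak h') : h' + h ∈ X.CC := by
  intro σ hσ k hk
  rw [xv_add, dotProduct_add]
  exact add_lt_add_of_le_of_lt (b σ hσ k) (a σ hσ k hk)

lemma CC_smul {h : ι → ℝ} (a : h ∈ X.CC) {t : ℝ} (ht : 0 < t) : t • h ∈ X.CC := by
  intro σ hσ k hk
  rw [xv_smul, dotProduct_smul]
  exact mul_lt_mul_of_pos_left (a σ hσ k hk) ht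

/-- perturbation of a vertex -/
lemma pert {h : ι → ℝ} (hh : h ∈ X.CC) {σ} (hσ : σ ∈ X.S) (w : ι → ℝ) :
    ∀ᶠ ε in nhdsWithin (0:ℝ) (Set.Ioi 0), (0 < ε) ∧
      (∀ i ∈ σ, X.u i ⬝ᵥ (X.xv σ h + ε • X.xv σ w) = h i + ε * w i) ∧
      (∀ k, k ∉ σ → X.u k ⬝ᵥ (X.xv σ h + ε • X.xv σ w) < h k) := by
  have h1 : ∀ᶠ ε in nhdsWithin (0:ℝ) (Set.Ioi 0), ∀ k, k ∉ σ →
      X.u k ⬝ᵥ (X.xv σ h + ε • X.xv σ w) < h k := by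
    rw [Filter.eventually_all]
    intro k
    by_cases hk : k ∈ σ
    · simp [hk]
    have hc : Continuous fun ε : ℝ => X.u k ⬝ᵥ (X.xv σ h + ε • X.xv σ w) :=
      (dot_cont _).comp (by fun_prop)
    filter_upwards [(hc.continuousAt.eventually (Iio_mem_nhds
      (show X.u k ⬝ᵥ (X.xv σ h + (0:ℝ) • X.xv σ w) < h k by simpa using hh σ hσ k hk))).filter_mono
        nhdsWithin_le_nhds] with ε hε _ using hε
  filter_upwards [h1, self_mem_nhdsWithin] with ε h1 h2
  refine ⟨h2, fun i hi => ?_, h1⟩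
  rw [dotProduct_add, dotProduct_smul, dot_xv hσ hi, dot_xv hσ hi, smul_eq_mul]

lemma exists_rel {h : ι → ℝ} (hh : h ∈ X.CC) {σ} (hσ : σ ∈ X.S) {I : Finset ι} (hI : I ⊆ σ) :
    ∃ x, (∀ i ∈ I, X.u i ⬝ᵥ x = h i) ∧ ∀ k, k ∉ I → X.u k ⬝ᵥ x < h k := by
  obtain ⟨ε, h0, h1, h2⟩ := (pert hh hσ (fun i => if i ∈ I then 0 else -1)).exists
  refine ⟨X.xv σ h + ε • X.xv σ (fun i => if i ∈ I then 0 else -1), fun i hi => ?_, fun k hk => ?_⟩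
  · rw [h1 i (hI hi)]; simp [hi]
  · by_cases hk' : k ∈ σ
    · rw [h1 k hk']; simp [hk, h0]
    · exact h2 k hk'

lemma active {h : ι → ℝ} (hh : h ∈ X.CC) {x} (hx : x ∈ PP X.u h) :
    ∃ σ ∈ X.S, ∀ k, X.u k ⬝ᵥ x = h k → k ∈ σ := by
  set A := univ.filter fun k => X.u k ⬝ᵥ x = h k with hA
  obtain ⟨σ, hσ, hc⟩ := X.max (∑ k ∈ A, X.u k)
  refine ⟨σ, hσ, fun k hk => ?_⟩
  by_contra hn
  have h1 := dot_le hx hσ hc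
  rw [sum_dotProduct, sum_dotProduct] at h1
  have h2 : ∑ k ∈ A, X.u k ⬝ᵥ X.xv σ h < ∑ k ∈ A, X.u k ⬝ᵥ x := by
    apply Finset.sum_lt_sum
    · intro i hi
      rw [(mem_filter.1 hi).2]
      exact weak_of_mem hh σ hσ i
    · refine ⟨k, by simp [hA, hk], ?_⟩
      rw [hk]; exact hh σ hσ k hn
  linarith

lemma VV_nonempty (h : ι → ℝ) : (X.VV h).Nonempty := by
  obtain ⟨σ, hσ, -⟩ := X.max 0
  exact ⟨_, mem_VV.2 ⟨σ, hσ, rfl⟩⟩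

lemma VV_nonconst {h : ι → ℝ} (hh : h ∈ X.CC) (z : Fin n → ℝ) (hz : z ≠ 0) :
    ¬ ∃ c, ∀ v ∈ X.VV h, v ⬝ᵥ z = c := by
  rintro ⟨c, hc⟩
  have h1 : ∀ x ∈ PP X.u h, z ⬝ᵥ x = c := by
    intro x hx
    rw [← (weak_of_mem hh).hull] at hx
    have hconv : Convex ℝ {x : Fin n → ℝ | z ⬝ᵥ x = c} := by
      apply convex_hyperplane
      exact ⟨fun a b => dotProduct_add _ _ _, fun c a => by simp⟩
    refine convexHull_min ?_ hconv hx
    intro v hv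
    have := hc v hv
    rw [dotProduct_comm] at this
    exact this
  obtain ⟨σ, hσ, -⟩ := X.max 0
  have h2 : ∀ i ∈ σ, z ⬝ᵥ X.b σ i = 0 := by
    intro i hi
    obtain ⟨ε, h0, e1, e2⟩ := (pert hh hσ (fun j => if j = i then -1 else 0)).exists
    have h3 := h1 _ (weak_of_mem hh σ hσ)
    have h4 := h1 (X.xv σ h + ε • X.xv σ (fun j => if j = i then -1 else 0)) (by
      intro k
      by_cases hk : k ∈ σ
      · rw [e1 k hk]
        split_ifs
        · linarith
        · simp
      · exact (e2 k hk).le)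
    rw [dotProduct_add, h3, dotProduct_smul] at h4
    have h5 : X.xv σ (fun j => if j = i then -1 else 0) = - X.b σ i := by
      simp [xv, hi, ite_smul]
    rw [h5] at h4
    simp at h4
    rcases h4 with h4 | h4
    · exact absurd h4 h0.ne'
    · exact h4
  apply hz
  have : z ⬝ᵥ z = 0 := by
    conv_lhs => rhs; rw [X.expand σ hσ z]
    rw [dotProduct_sum]
    refine Finset.sum_eq_zero fun i hi => ?_
    rw [dotProduct_smul, h2 i hi, smul_zero]
  exact dotProduct_self_eq_zero.1 this

variable (X) in
theorem exists_poly [Nonempty ι] (hne : X.CC.Nonempty) : ∃ f : MvPolynomial ι ℝ, f.IsHomogeneous n ∧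
    ∀ h ∈ X.CC, MvPolynomial.eval h f = (volume (PP X.u h)).toReal := by
  apply poly_of_cone CC_open hne
  intro J _ _ x hx
  obtain ⟨f, hf, hfe⟩ := vol_poly (V := fun j => X.VV (x j)) (fun j => VV_nonempty _)
    (fun j => VV_nonconst (hx j))
  refine ⟨f, hf, fun t ht => ?_⟩
  rw [hfe t ht]
  congr 2
  rw [(weak_sum univ (fun j => t j • x j) fun j _ => (weak_of_mem (hx j)).smul (ht j).le).2, KK]
  refine Finset.sum_congr rfl fun j _ => ?_
  rw [(weak_of_mem (hx j)).hull, PP_smul _ (ht j)]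

end Fan
end fan
end AF

namespace AF

section fan
variable {n : ℕ} {ι : Type} [Fintype ι] [DecidableEq ι]

def slab (u : ι → Fin n → ℝ) (J : Finset ι) (t : ℝ) (h : ι → ℝ) : Set (Fin n → ℝ) :=
  {x | (∀ j ∈ J, h j < u j ⬝ᵥ x ∧ u j ⬝ᵥ x ≤ h j + t) ∧ ∀ k, k ∉ J → u k ⬝ᵥ x ≤ h k}

omit [DecidableEq ι] in
lemma slab_meas (u : ι → Fin n → ℝ) (J : Finset ι) (t : ℝ) (h : ι → ℝ) :
    MeasurableSet (slab u J t h) := by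
  have : slab u J t h = (⋂ j ∈ J, ({x | h j < u j ⬝ᵥ x} ∩ {x | u j ⬝ᵥ x ≤ h j + t})) ∩
      ⋂ k, ⋂ (_ : k ∉ J), {x | u k ⬝ᵥ x ≤ h k} := by
    ext x; simp [slab]
  rw [this]
  refine MeasurableSet.inter (Finset.measurableSet_biInter _ fun j _ => MeasurableSet.inter ?_ ?_)
    (MeasurableSet.iInter fun k => MeasurableSet.iInter fun _ => ?_)
  · exact (isOpen_lt continuous_const (dot_cont _)).measurableSet
  · exact (isClosed_le (dot_cont _) continuous_const).measurableSet
  · exact (isClosed_le (dot_cont _) continuous_const).measurableSet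

namespace Fan
variable {X : Fan n ι}

lemma slab_fin (J : Finset ι) {t : ℝ} (ht : 0 ≤ t) (h : ι → ℝ) :
    volume (slab X.u J t h) ≠ ⊤ := by
  refine ((measure_mono ?_).trans_lt (X.PP_compact (fun k => h k + t)).measure_lt_top).ne
  rintro x ⟨h1, h2⟩ k
  by_cases hk : k ∈ J
  · exact (h1 k hk).2
  · linarith [h2 k hk]

lemma dE_vol (J : Finset ι) {t : ℝ} (ht : 0 ≤ t) (h : ι → ℝ) :
    dE J t (fun h => (volume (PP X.u h)).toReal) h = (volume (slab X.u J t h)).toReal := by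
  induction J using Finset.induction_on generalizing h with
  | empty =>
    rw [dE, dF_empty]
    congr 2
    ext x; simp [slab, PP]
  | insert j J hj ih =>
    rw [dE, dF_insert hj]
    change dE J t _ _ - dE J t _ _ = _
    rw [ih, ih]
    set h' := h + t • (Pi.single j 1 : ι → ℝ) with hh'
    have e1 : h' j = h j + t := by simp [hh']
    have e2 : ∀ k, k ≠ j → h' k = h k := by intro k hk; simp [hh', hk]
    have hsub : slab X.u J t h ⊆ slab X.u J t h' := by
      rintro x ⟨h1, h2⟩
      refine ⟨fun i hi => ?_, fun k hk => ?_⟩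
      · rw [e2 i (fun h => hj (h ▸ hi))]; exact h1 i hi
      · by_cases hkj : k = j
        · subst hkj; rw [e1]; linarith [h2 k hk]
        · rw [e2 k hkj]; exact h2 k hk
    have hd : slab X.u (insert j J) t h = slab X.u J t h' \ slab X.u J t h := by
      ext x
      constructor
      · rintro ⟨h1, h2⟩
        refine ⟨⟨fun i hi => ?_, fun k hk => ?_⟩, fun h3 => ?_⟩
        · rw [e2 i (fun h => hj (h ▸ hi))]; exact h1 i (by simp [hi])
        · by_cases hkj : k = j
          · subst hkj; rw [e1]; exact (h1 k (by simp)).2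
          · rw [e2 k hkj]; exact h2 k (by simp [hk, hkj])
        · linarith [h3.2 j hj, (h1 j (by simp)).1]
      · rintro ⟨⟨h1, h2⟩, h3⟩
        have h1' : ∀ i ∈ J, h i < X.u i ⬝ᵥ x ∧ X.u i ⬝ᵥ x ≤ h i + t := fun i hi => by
          have := h1 i hi
          rwa [e2 i (fun h => hj (h ▸ hi))] at this
        have h2' : ∀ k, k ∉ insert j J → X.u k ⬝ᵥ x ≤ h k := fun k hk => by
          rw [mem_insert, not_or] at hk
          have := h2 k hk.2
          rwa [e2 k hk.1] at this
        refine ⟨fun i hi => ?_, h2'⟩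
        rcases mem_insert.1 hi with rfl | hi
        · refine ⟨?_, ?_⟩
          · by_contra hn
            apply h3
            refine ⟨h1', fun k hk => ?_⟩
            by_cases hki : k = i
            · subst hki; exact not_lt.1 hn
            · exact h2' k (by simp [hk, hki])
          · rw [← e1]; exact h2 i hj
        · exact h1' i hi
    rw [hd, measure_diff hsub (slab_meas _ _ _ _).nullMeasurableSet (slab_fin _ ht _),
      ENNReal.toReal_sub_of_le (measure_mono hsub) (slab_fin _ ht _)]

lemma box {h : ι → ℝ} (hh : h ∈ X.CC) : ∀ᶠ t in nhdsWithin (0:ℝ) (Set.Ioi 0),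
    ∀ w : ι → ℝ, (∀ i, 0 ≤ w i ∧ w i ≤ t) → h + w ∈ X.CC := by
  obtain ⟨r, hr, hb⟩ := Metric.isOpen_iff.1 X.CC_open h hh
  have : Set.Ioo 0 r ∈ nhdsWithin (0:ℝ) (Set.Ioi 0) := Ioo_mem_nhdsGT hr
  filter_upwards [this] with t ht w hw
  apply hb
  rw [Metric.mem_ball, dist_pi_lt_iff hr]
  intro i
  simp only [Pi.add_apply, Real.dist_eq, add_sub_cancel_left]
  rw [abs_of_nonneg (hw i).1]
  exact (hw i).2.trans_lt ht.2

variable {f : MvPolynomial ι ℝ}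

lemma dE_eq (hf : ∀ h ∈ X.CC, MvPolynomial.eval h f = (volume (PP X.u h)).toReal) (J : Finset ι)
    {h : ι → ℝ} (hh : h ∈ X.CC) : ∀ᶠ t in nhdsWithin (0:ℝ) (Set.Ioi 0),
    dE J t (fun x => MvPolynomial.eval x f) h = (volume (slab X.u J t h)).toReal := by
  filter_upwards [box hh, self_mem_nhdsWithin] with t ht ht0
  have ht0' : (0:ℝ) < t := ht0
  rw [← dE_vol J ht0'.le h]
  simp only [dE, dF]
  refine Finset.sum_congr rfl fun A _ => ?_
  congr 1
  apply hf
  apply ht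
  intro i
  simp only [Finset.sum_apply, Pi.smul_apply, Pi.single_apply, smul_eq_mul, mul_ite, mul_one,
    mul_zero, Finset.sum_ite_eq]
  split_ifs
  · exact ⟨ht0'.le, le_rfl⟩
  · exact ⟨le_rfl, ht0'.le⟩

theorem good (hne : X.CC.Nonempty) (hh : f.IsHomogeneous n)
    (hf : ∀ h ∈ X.CC, MvPolynomial.eval h f = (volume (PP X.u h)).toReal) :
    Good f n {J | ∃ σ ∈ X.S, J ⊆ σ} X.CC where
  hom := hh
  op := X.CC_open
  ne := hne
  a1 := by
    intro J hJ
    apply a1_of X.CC_open hne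
    intro h hhC
    filter_upwards [dE_eq hf J hhC, box hhC, self_mem_nhdsWithin] with t h1 h2 ht0
    have ht0' : (0:ℝ) < t := ht0
    rw [h1]
    have : slab X.u J t h = ∅ := by
      rw [Set.eq_empty_iff_forall_notMem]
      rintro x ⟨hx1, hx2⟩
      apply hJ
      set w : ι → ℝ := fun i => if i ∈ J then X.u i ⬝ᵥ x - h i else 0 with hw
      have hC := h2 w (by
        intro i
        simp only [hw]
        split_ifs with hi
        · constructor <;> linarith [(hx1 i hi).1, (hx1 i hi).2]
        · exact ⟨le_rfl, ht0'.le⟩)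
      obtain ⟨σ, hσ, hact⟩ := active hC (x := x) (by
        intro k
        by_cases hk : k ∈ J
        · simp [hw, hk]
        · simpa [hw, hk] using hx2 k hk)
      refine ⟨σ, hσ, fun j hj => hact j ?_⟩
      simp [hw, hj]
    rw [this]; simp
  a2 := by
    intro σ ⟨σ', hσ', hsub⟩ hcard
    have : σ = σ' := Finset.eq_of_subset_of_card_le hsub (by rw [hcard, X.card σ' hσ'])
    subst this
    obtain ⟨h, hhC⟩ := hne
    obtain ⟨t, h1, ht0⟩ := ((dE_eq hf σ hhC).and self_mem_nhdsWithin).exists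
    have ht0' : (0:ℝ) < t := ht0
    apply a2_of hh σ hcard h t ht0'
    rw [h1]
    apply ENNReal.toReal_pos _ (slab_fin _ ht0'.le _)
    set U : Set (Fin n → ℝ) := (⋂ j ∈ σ, ({x | h j < X.u j ⬝ᵥ x} ∩ {x | X.u j ⬝ᵥ x < h j + t})) ∩
      ⋂ k, ⋂ (_ : k ∉ σ), {x | X.u k ⬝ᵥ x < h k} with hU
    have hUo : IsOpen U := by
      refine IsOpen.inter (isOpen_biInter_finset fun j _ => IsOpen.inter ?_ ?_)
        (isOpen_iInter_of_finite fun k => isOpen_iInter_of_finite fun _ => ?_)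
      · exact (isOpen_lt continuous_const (dot_cont _))
      · exact (isOpen_lt (dot_cont _) continuous_const)
      · exact (isOpen_lt (dot_cont _) continuous_const)
    have hUn : U.Nonempty := by
      have hlt : Set.Ioo 0 t ∈ nhdsWithin (0:ℝ) (Set.Ioi 0) := Ioo_mem_nhdsGT ht0'
      obtain ⟨ε, ⟨h0, e1, e2⟩, h3⟩ := ((pert hhC hσ' (fun _ => 1)).and hlt).exists
      refine ⟨X.xv σ h + ε • X.xv σ (fun _ => 1), ?_⟩
      simp only [hU, Set.mem_inter_iff, Set.mem_iInter]
      refine ⟨fun i hi => ?_, fun k hk => e2 k hk⟩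
      simp only [Set.mem_ofPred_eq]
      rw [e1 i hi]
      constructor
      · linarith
      · linarith [h3.2]
    have hUs : U ⊆ slab X.u σ t h := by
      intro x hx
      simp only [hU, Set.mem_inter_iff, Set.mem_iInter] at hx
      exact ⟨fun j hj => ⟨(hx.1 j hj).1, le_of_lt (hx.1 j hj).2⟩, fun k hk => le_of_lt (hx.2 k hk)⟩
    exact ((hUo.measure_pos volume hUn).trans_le (measure_mono hUs)).ne'
  a3 := by
    rintro I ⟨σ, hσ, hI⟩ v hv
    obtain ⟨x, hx1, hx2⟩ := exists_rel hv hσ hI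
    refine ⟨fun k => X.u k ⬝ᵥ x, ?_, hx1, hx2⟩
    apply poly_zero_of_open X.CC_open hne
    intro h hhC
    have hder := hasDerivAt_eval f h (fun k => X.u k ⬝ᵥ x) 0
    have hconst : (fun t : ℝ => MvPolynomial.eval (h + t • fun k => X.u k ⬝ᵥ x) f) =ᶠ[nhds 0]
        fun _ => MvPolynomial.eval h f := by
      have hc : Continuous fun t : ℝ => h + t • fun k => X.u k ⬝ᵥ x := by fun_prop
      have := hc.continuousAt.eventually (X.CC_open.mem_nhds
        (show h + (0:ℝ) • (fun k => X.u k ⬝ᵥ x) ∈ X.CC by simpa using hhC))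
      filter_upwards [this] with t ht
      rw [hf _ ht, hf _ hhC]
      congr 1
      have : PP X.u (h + t • fun k => X.u k ⬝ᵥ x) = (fun y => -(t • x) + y) ⁻¹' PP X.u h := by
        ext y
        simp only [PP, Set.mem_ofPred_eq, Set.mem_preimage, dotProduct_add, dotProduct_neg,
          dotProduct_smul, Pi.add_apply, Pi.smul_apply]
        refine forall_congr' fun k => ?_
        constructor <;> intro h <;> linarith
      rw [this, measure_preimage_add]
    have h2 := (hasDerivAt_const (0:ℝ) (MvPolynomial.eval h f)).congr_of_eventuallyEq hconst
    have := hder.unique h2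
    simpa using this
  a4 := by
    rintro I ⟨σ, hσ, hI⟩ hcard
    rw [← X.card σ hσ] at hcard
    obtain ⟨k, hk1, hk2⟩ := Finset.exists_mem_notMem_of_card_lt_card hcard
    exact ⟨k, hk2, σ, hσ, Finset.insert_subset hk1 hI⟩
  a5 := by
    intro J _ h x h1 h2 h3
    apply a5_of
    filter_upwards [dE_eq hf J h1, dE_eq hf J h2, dE_eq hf J h3, self_mem_nhdsWithin]
      with t e1 e2 e3 ht0
    have ht0' : (0:ℝ) < t := ht0
    rw [e1, e2, e3, ← ENNReal.toReal_mul, ← ENNReal.toReal_pow]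
    apply ENNReal.toReal_mono (ENNReal.pow_ne_top (slab_fin _ ht0'.le _))
    apply bm_mul (slab_meas _ _ _ _) (slab_meas _ _ _ _) (slab_meas _ _ _ _)
    rintro y ⟨hy1, hy2⟩ z ⟨hz1, hz2⟩
    refine ⟨fun j hj => ?_, fun k hk => ?_⟩
    · have a := hy1 j hj
      have b := hz1 j hj
      simp only [Pi.add_apply, Pi.sub_apply] at a b
      rw [dotProduct_smul, dotProduct_add, smul_eq_mul]
      constructor <;> linarith [a.1, a.2, b.1, b.2]
    · have a := hy2 k hk
      have b := hz2 k hk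
      simp only [Pi.add_apply, Pi.sub_apply] at a b
      rw [dotProduct_smul, dotProduct_add, smul_eq_mul]
      linarith

end Fan
end fan
end AF

namespace AF

section fanof
variable {n : ℕ} {ι : Type} [Fintype ι] [DecidableEq ι]

omit [Fintype ι] [DecidableEq ι] in
lemma half_convex (c : Fin n → ℝ) (s : ℝ) : Convex ℝ {x : Fin n → ℝ | c ⬝ᵥ x ≤ s} := by
  intro x hx y hy a b ha hb hab
  have h1 : c ⬝ᵥ x ≤ s := hx
  have h2 : c ⬝ᵥ y ≤ s := hy
  show c ⬝ᵥ (a • x + b • y) ≤ s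
  simp only [dotProduct_add, dotProduct_smul, smul_eq_mul]
  calc a * c ⬝ᵥ x + b * c ⬝ᵥ y ≤ a * s + b * s := by gcongr
    _ = s := by rw [← add_mul, hab, one_mul]

omit [DecidableEq ι] in
lemma PP_step {u : ι → Fin n → ℝ} {h : ι → ℝ} {x : Fin n → ℝ} (hx : x ∈ PP u h) (z : Fin n → ℝ)
    (hz : ∀ k, u k ⬝ᵥ x = h k → u k ⬝ᵥ z ≤ 0) :
    ∀ᶠ t : ℝ in nhdsWithin (0:ℝ) (Set.Ioi 0), x + t • z ∈ PP u h := by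
  have : ∀ k, ∀ᶠ t : ℝ in nhdsWithin (0:ℝ) (Set.Ioi 0), u k ⬝ᵥ (x + t • z) ≤ h k := by
    intro k
    by_cases hk : u k ⬝ᵥ x = h k
    · filter_upwards [self_mem_nhdsWithin] with t ht
      have ht' : 0 < t := ht
      simp only [dotProduct_add, dotProduct_smul, smul_eq_mul]
      nlinarith [hz k hk]
    · have hlt : u k ⬝ᵥ x < h k := lt_of_le_of_ne (hx k) hk
      have hcont : Continuous fun t : ℝ => u k ⬝ᵥ (x + t • z) := by
        simp only [dotProduct_add, dotProduct_smul, smul_eq_mul]; fun_prop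
      have : ∀ᶠ t : ℝ in nhds (0:ℝ), u k ⬝ᵥ (x + t • z) < h k :=
        hcont.continuousAt.eventually_lt continuousAt_const (by simpa using hlt)
      exact (this.filter_mono nhdsWithin_le_nhds).mono fun t ht => ht.le
  exact Filter.eventually_all.2 this

omit [DecidableEq ι] in
lemma ext_sep {u : ι → Fin n → ℝ} {h : ι → ℝ} {x : Fin n → ℝ}
    (hx : x ∈ (PP u h).extremePoints ℝ) (z : Fin n → ℝ)
    (hz : ∀ k, u k ⬝ᵥ x = h k → u k ⬝ᵥ z = 0) : z = 0 := by
  obtain ⟨hx1, hx2⟩ := mem_extremePoints_iff_left.1 hx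
  have h1 := PP_step hx1 z (fun k hk => (hz k hk).le)
  have h2 := PP_step hx1 (-z) (fun k hk => by rw [dotProduct_neg, hz k hk]; simp)
  obtain ⟨t, ⟨h1, h2⟩, ht⟩ := ((h1.and h2).and self_mem_nhdsWithin).exists
  have ht' : 0 < t := ht
  have := hx2 _ h1 _ h2 ⟨1/2, 1/2, by norm_num, by norm_num, by norm_num, by
    ext i; simp; ring⟩
  have h3 : t • z = 0 := by simpa using this
  exact (smul_eq_zero.1 h3).resolve_left ht'.ne'

omit [DecidableEq ι] in
lemma ext_finite (u : ι → Fin n → ℝ) (h : ι → ℝ) : ((PP u h).extremePoints ℝ).Finite := by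
  classical
  refine Set.Finite.of_injOn (f := fun x => (univ.filter fun k => u k ⬝ᵥ x = h k)) (t := Set.univ)
    (fun _ _ => Set.mem_univ _) ?_ Set.finite_univ
  intro x hx y hy hxy
  have hxy' : ∀ k, u k ⬝ᵥ x = h k → u k ⬝ᵥ y = h k := by
    intro k hk
    have : k ∈ (univ.filter fun k => u k ⬝ᵥ x = h k) := by simp [hk]
    have h2 : k ∈ (univ.filter fun k => u k ⬝ᵥ y = h k) := by
      have e : (univ.filter fun k => u k ⬝ᵥ x = h k) = (univ.filter fun k => u k ⬝ᵥ y = h k) := hxy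
      rwa [← e]
    simpa using h2
  have := ext_sep hx (x - y) (fun k hk => by rw [dotProduct_sub, hk, hxy' k hk, sub_self])
  exact sub_eq_zero.1 this

def Dep (u : ι → Fin n → ℝ) (J : Finset ι) : Prop :=
  ∃ a : ι → ℝ, a ≠ 0 ∧ (∀ k, k ∉ J → a k = 0) ∧ ∑ k, a k • u k = 0

omit [DecidableEq ι] in
lemma dense_generic (u : ι → Fin n → ℝ) : Dense {h : ι → ℝ | ∀ J : Finset ι, Dep u J →
    ∃ a : ι → ℝ, (∀ k, k ∉ J → a k = 0) ∧ ∑ k, a k • u k = 0 ∧ ∑ k, a k * h k ≠ 0} := by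
  apply Measure.dense_of_ae (μ := (volume : Measure (ι → ℝ)))
  rw [ae_all_iff]
  intro J
  by_cases hJ : Dep u J
  · obtain ⟨a, ha0, ha1, ha2⟩ := hJ
    let T : (ι → ℝ) →ₗ[ℝ] ℝ :=
      { toFun := fun h => ∑ k, a k * h k
        map_add' := fun x y => by simp [mul_add, sum_add_distrib]
        map_smul' := fun c x => by simp [mul_sum, mul_left_comm] }
    have hT : LinearMap.ker T ≠ ⊤ := by
      intro h
      have : a ∈ LinearMap.ker T := by rw [h]; trivial
      have h2 : ∑ k, a k * a k = 0 := this
      rw [sum_eq_zero_iff_of_nonneg (fun i _ => mul_self_nonneg _)] at h2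
      exact ha0 (funext fun k => by simpa using h2 k (mem_univ _))
    have hnull := Measure.addHaar_submodule (volume : Measure (ι → ℝ)) _ hT
    have : ∀ᵐ h : ι → ℝ, h ∉ (LinearMap.ker T : Set (ι → ℝ)) := measure_eq_zero_iff_ae_notMem.1 hnull
    filter_upwards [this] with h hh _
    exact ⟨a, ha1, ha2, hh⟩
  · exact Filter.Eventually.of_forall fun h hd => absurd hd hJ

lemma dual_basis (u : ι → Fin n → ℝ) (σ : Finset ι) (hd : ¬ Dep u σ)
    (hs : ∀ z, (∀ k ∈ σ, u k ⬝ᵥ z = 0) → z = 0) :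
    σ.card = n ∧ ∃ b : ι → Fin n → ℝ,
      (∀ i ∈ σ, ∀ j ∈ σ, u i ⬝ᵥ b j = if i = j then 1 else 0) ∧
      (∀ x, x = ∑ i ∈ σ, (u i ⬝ᵥ x) • b i) := by
  let T : (Fin n → ℝ) →ₗ[ℝ] (σ → ℝ) :=
    { toFun := fun x i => u i ⬝ᵥ x
      map_add' := fun x y => by ext; simp [dotProduct_add]
      map_smul' := fun c x => by ext; simp [dotProduct_smul] }
  have hT : Function.Injective T := by
    rw [injective_iff_map_eq_zero]
    intro z hz
    exact hs z fun k hk => congrFun hz ⟨k, hk⟩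
  let R : (σ → ℝ) →ₗ[ℝ] (Fin n → ℝ) :=
    { toFun := fun a => ∑ i : σ, a i • u i
      map_add' := fun x y => by simp [add_smul, sum_add_distrib]
      map_smul' := fun c x => by simp [smul_sum, mul_smul] }
  have hR : Function.Injective R := by
    rw [injective_iff_map_eq_zero]
    intro a ha
    by_contra hne
    apply hd
    refine ⟨fun k => if h : k ∈ σ then a ⟨k, h⟩ else 0, ?_, fun k hk => by simp [hk], ?_⟩
    · intro h0
      apply hne
      ext ⟨i, hi⟩
      have := congrFun h0 i
      simpa [hi] using this
    · have ha' : ∑ i : σ, a i • u i = 0 := ha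
      rw [← ha', ← sum_subset (subset_univ σ), ← sum_coe_sort]
      · refine sum_congr rfl fun i _ => ?_
        simp
      · intro k _ hk
        simp [hk]
  have h1 := LinearMap.finrank_le_finrank_of_injective hT
  have h2 := LinearMap.finrank_le_finrank_of_injective hR
  simp only [Module.finrank_fintype_fun_eq_card, Fintype.card_fin, Fintype.card_coe] at h1 h2
  have hcard : σ.card = n := le_antisymm h2 h1
  refine ⟨hcard, ?_⟩
  let E := LinearMap.linearEquivOfInjective T hT (by simp [hcard])
  have hE : ∀ x (i : σ), E x i = u i ⬝ᵥ x := fun x i => rfl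
  refine ⟨fun i => if h : i ∈ σ then E.symm (Pi.single ⟨i, h⟩ 1) else 0, ?_, ?_⟩
  · intro i hi j hj
    simp only [hj, dif_pos]
    have := hE (E.symm (Pi.single ⟨j, hj⟩ 1)) ⟨i, hi⟩
    rw [← this]
    simp [Pi.single_apply]
  · intro x
    apply E.injective
    rw [map_sum, ← sum_coe_sort]
    ext i
    simp [Pi.single_apply, hE]

lemma fan_of (u : ι → Fin n → ℝ) (hc : IsCompact (PP u 1)) :
    ∃ X : Fan n ι, X.u = u ∧ (∃ h0 ∈ X.CC, ∀ k, 0 < h0 k ∧ h0 k < 2) ∧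
      ∀ σ ∈ X.S, X.xv σ 1 ∈ PP u 1 := by
  classical
  have hb : ∀ σ : Finset ι, ∃ b : ι → Fin n → ℝ, (¬ Dep u σ ∧ ∀ z, (∀ k ∈ σ, u k ⬝ᵥ z = 0) → z = 0) →
      σ.card = n ∧ 
      (∀ i ∈ σ, ∀ j ∈ σ, u i ⬝ᵥ b j = if i = j then 1 else 0) ∧
      (∀ x, x = ∑ i ∈ σ, (u i ⬝ᵥ x) • b i) := by
    intro σ
    by_cases h : ¬ Dep u σ ∧ ∀ z, (∀ k ∈ σ, u k ⬝ᵥ z = 0) → z = 0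
    · obtain ⟨h1, b, hb⟩ := dual_basis u σ h.1 h.2
      exact ⟨b, fun _ => ⟨h1, hb⟩⟩
    · exact ⟨0, fun h' => absurd h' h⟩
  choose b hb using hb
  let xx : Finset ι → (ι → ℝ) → Fin n → ℝ := fun σ h => ∑ i ∈ σ, h i • b σ i
  have hxx : ∀ σ, Continuous (xx σ) := fun σ => by
    show Continuous fun h : ι → ℝ => ∑ i ∈ σ, h i • b σ i
    fun_prop
  let O : Set (ι → ℝ) := {h | (∀ k, 0 < h k ∧ h k < 2) ∧
    ∀ σ, xx σ 1 ∈ PP u 1 ∨ ∃ k, h k < u k ⬝ᵥ xx σ h}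
  have hO : IsOpen O := by
    have : O = (⋂ k, {h | 0 < h k ∧ h k < 2}) ∩ ⋂ σ, ({h | xx σ 1 ∈ PP u 1} ∪
        ⋃ k, {h | h k < u k ⬝ᵥ xx σ h}) := by
      ext h; simp [O]
    rw [this]
    refine (isOpen_iInter_of_finite fun k => ?_).inter (isOpen_iInter_of_finite fun σ => ?_)
    · exact (isOpen_lt continuous_const (continuous_apply k)).inter
        (isOpen_lt (continuous_apply k) continuous_const)
    · refine isOpen_const.union (isOpen_iUnion fun k => ?_)
      exact isOpen_lt (continuous_apply k) ((dot_cont _).comp (hxx σ))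
  have h1O : (1 : ι → ℝ) ∈ O := by
    refine ⟨fun k => by norm_num, fun σ => ?_⟩
    by_cases h : xx σ 1 ∈ PP u 1
    · exact Or.inl h
    · right
      have : ¬ ∀ k, u k ⬝ᵥ xx σ 1 ≤ (1 : ι → ℝ) k := h
      push Not at this
      exact this
  obtain ⟨h0, h0O, hgen⟩ := (dense_generic u).inter_open_nonempty O hO ⟨1, h1O⟩
  obtain ⟨h0p, h0σ⟩ := h0O
  have hP : IsCompact (PP u h0) := by
    refine (hc.smul (2:ℝ)).of_isClosed_subset (PP_closed _ _) ?_
    intro x hx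
    rw [Set.mem_smul_set_iff_inv_smul_mem₀ (by norm_num)]
    intro k
    have := hx k
    have := (h0p k).2
    simp only [dotProduct_smul, smul_eq_mul, Pi.one_apply]
    linarith
  have h0P : (0 : Fin n → ℝ) ∈ PP u h0 := fun k => by simpa using (h0p k).1.le
  have hS : ∀ σ : Finset ι, ∀ e ∈ (PP u h0).extremePoints ℝ, (∀ k, k ∈ σ ↔ u k ⬝ᵥ e = h0 k) →
      (¬ Dep u σ ∧ ∀ z, (∀ k ∈ σ, u k ⬝ᵥ z = 0) → z = 0) ∧ e = xx σ h0 := by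
    intro σ e he hσ
    have hh : (¬ Dep u σ ∧ ∀ z, (∀ k ∈ σ, u k ⬝ᵥ z = 0) → z = 0) := by
      constructor
      · intro hd
        obtain ⟨a, ha1, ha2, ha3⟩ := hgen σ hd
        apply ha3
        calc ∑ k, a k * h0 k = ∑ k, a k * (u k ⬝ᵥ e) := by
              refine sum_congr rfl fun k _ => ?_
              by_cases hk : k ∈ σ
              · rw [(hσ k).1 hk]
              · rw [ha1 k hk]; simp
          _ = (∑ k, a k • u k) ⬝ᵥ e := by rw [sum_dotProduct]; simp
          _ = 0 := by rw [ha2, zero_dotProduct]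
      · intro z hz
        exact ext_sep he z fun k hk => hz k ((hσ k).2 hk)
    refine ⟨hh, ?_⟩
    rw [(hb σ hh).2.2 e]
    refine sum_congr rfl fun i hi => ?_
    rw [(hσ i).1 hi]
  let S : Finset (Finset ι) := univ.filter fun σ => ∃ e ∈ (PP u h0).extremePoints ℝ,
    ∀ k, k ∈ σ ↔ u k ⬝ᵥ e = h0 k
  have hSm : ∀ σ ∈ S, ∃ e ∈ (PP u h0).extremePoints ℝ, ∀ k, k ∈ σ ↔ u k ⬝ᵥ e = h0 k := by
    intro σ h; simpa [S] using h
  have hSb : ∀ σ ∈ S, (¬ Dep u σ ∧ ∀ z, (∀ k ∈ σ, u k ⬝ᵥ z = 0) → z = 0) := by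
    intro σ h
    obtain ⟨e, he, h⟩ := hSm σ h
    exact (hS σ e he h).1
  have hmax : ∀ c : Fin n → ℝ, ∃ σ ∈ S, ∀ i ∈ σ, 0 ≤ c ⬝ᵥ b σ i := by
    intro c
    have hne : ((PP u h0).extremePoints ℝ).Nonempty := hP.extremePoints_nonempty ⟨0, h0P⟩
    obtain ⟨e, he, hemax⟩ := (ext_finite u h0).exists_maximalFor (fun x => c ⬝ᵥ x) _ hne
    have hall : ∀ x ∈ PP u h0, c ⬝ᵥ x ≤ c ⬝ᵥ e := by
      have hsub : closure (convexHull ℝ ((PP u h0).extremePoints ℝ)) ⊆ {x | c ⬝ᵥ x ≤ c ⬝ᵥ e} := by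
        refine closure_minimal (convexHull_min ?_ ?_) (isClosed_le (dot_cont c) continuous_const)
        · intro x hx
          show c ⬝ᵥ x ≤ c ⬝ᵥ e
          by_contra hlt
          push Not at hlt
          have := hemax hx hlt.le
          simp only at this
          linarith
        · exact half_convex c _
      rw [closure_convexHull_extremePoints hP (PP_convex _ _)] at hsub
      exact hsub
    let σ : Finset ι := univ.filter fun k => u k ⬝ᵥ e = h0 k
    have hσ : ∀ k, k ∈ σ ↔ u k ⬝ᵥ e = h0 k := by simp [σ]
    refine ⟨σ, ?_, ?_⟩
    · simp only [S, mem_filter, mem_univ, true_and]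
      exact ⟨e, he, hσ⟩
    · intro i hi
      have hbb := hb σ (hS σ e he hσ).1
      have hst := PP_step he.1 (-b σ i) (fun k hk => by
        rw [dotProduct_neg, hbb.2.1 k ((hσ k).2 hk) i hi]
        split_ifs <;> simp)
      obtain ⟨t, h1, ht⟩ := (hst.and self_mem_nhdsWithin).exists
      have ht' : 0 < t := ht
      have := hall _ h1
      simp only [dotProduct_add, dotProduct_smul, dotProduct_neg, smul_eq_mul] at this
      by_contra hneg
      push Not at hneg
      nlinarith
  let X : Fan n ι := 
    { u := u, S := S, b := b
      card := fun σ h => (hb σ (hSb σ h)).1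
      dual := fun σ h => (hb σ (hSb σ h)).2.1
      expand := fun σ h => (hb σ (hSb σ h)).2.2
      max := hmax }
  have hX : ∀ σ h, X.xv σ h = xx σ h := fun σ h => rfl
  refine ⟨X, rfl, ⟨h0, ?_, h0p⟩, ?_⟩
  · intro σ hσ k hk
    obtain ⟨e, he, h⟩ := hSm σ hσ
    rw [hX, ← (hS σ e he h).2]
    exact lt_of_le_of_ne (he.1 k) (fun h' => hk ((h k).2 h'))
  · intro σ hσ
    obtain ⟨e, he, h⟩ := hSm σ hσ
    rw [hX]
    refine (h0σ σ).resolve_right ?_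
    rintro ⟨k, hk⟩
    rw [← (hS σ e he h).2] at hk
    exact absurd (he.1 k) (not_le.2 hk)
end fanof
end AF

namespace AF

section construct
variable {n : ℕ}

lemma dual_vec (f : StrongDual ℝ (Fin n → ℝ)) : ∃ w : Fin n → ℝ, ∀ x, f x = w ⬝ᵥ x := by
  refine ⟨fun i => f (Pi.single i 1), fun x => ?_⟩
  have := LinearMap.pi_apply_eq_sum_univ f.toLinearMap x
  have h2 : f x = ∑ i, x i • f (Pi.single i 1) := by
    refine this.trans (sum_congr rfl fun i _ => ?_)
    have e : (fun j => if i = j then (1:ℝ) else 0) = Pi.single i 1 := by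
      ext j; simp [Pi.single_apply, eq_comm]
    rw [e]; rfl
  rw [h2]
  simp [dotProduct, mul_comm]

lemma polar (hn : 1 ≤ n) (V : Finset (Fin n → ℝ))
    (h0 : (0 : Fin n → ℝ) ∈ interior (convexHull ℝ (V : Set (Fin n → ℝ)))) :
    ∃ U : Finset (Fin n → ℝ),
      convexHull ℝ (V : Set (Fin n → ℝ)) = PP (fun k : U => (k : Fin n → ℝ)) 1 ∧
      ∀ k : U, ∃ v ∈ V, (k : Fin n → ℝ) ⬝ᵥ v = 1 := by
  classical
  set T : Set (Fin n → ℝ) := PP (fun v : V => (v : Fin n → ℝ)) 1 with hT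
  have hTV : ∀ w ∈ T, ∀ x ∈ convexHull ℝ (V : Set (Fin n → ℝ)), w ⬝ᵥ x ≤ 1 := by
    intro w hw
    have : convexHull ℝ (V : Set (Fin n → ℝ)) ⊆ {x | w ⬝ᵥ x ≤ 1} := by
      refine convexHull_min ?_ (half_convex w 1)
      intro v hv
      have := hw ⟨v, hv⟩
      show w ⬝ᵥ v ≤ 1
      rw [dotProduct_comm]
      simpa using this
    exact this
  have hTc : IsCompact T := by
    rw [mem_interior_iff_mem_nhds, Metric.mem_nhds_iff] at h0
    obtain ⟨r, hr, hball⟩ := h0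
    refine (isCompact_closedBall (0 : Fin n → ℝ) (2/r)).of_isClosed_subset (PP_closed _ _) ?_
    intro w hw
    rw [mem_closedBall_zero_iff, pi_norm_le_iff_of_nonneg (by positivity)]
    intro i
    have key : ∀ s : ℝ, |s| < r → w i * s ≤ 1 := by
      intro s hs
      have := hTV w hw (Pi.single i s) (hball (by
        rw [mem_ball_zero_iff, pi_norm_lt_iff hr]
        intro j
        by_cases hj : j = i
        · subst hj; simpa using hs
        · simpa [hj] using hr))
      simpa using this
    have h1 := key (r/2) (by rw [abs_of_pos (by positivity)]; linarith)
    have h2 := key (-(r/2)) (by rw [abs_neg, abs_of_pos (by positivity)]; linarith)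
    rw [Real.norm_eq_abs, abs_le]
    constructor
    · rw [neg_le, le_div_iff₀ hr]; linarith
    · rw [le_div_iff₀ hr]; linarith
  have hfin : (T.extremePoints ℝ).Finite := ext_finite _ _
  refine ⟨hfin.toFinset, ?_, ?_⟩
  · apply Set.Subset.antisymm
    · intro x hx k
      have hk : (k : Fin n → ℝ) ∈ T.extremePoints ℝ := hfin.mem_toFinset.1 k.2
      exact hTV _ hk.1 x hx
    · intro x hx
      by_contra hxn
      obtain ⟨f, s, hfs, hsx⟩ := geometric_hahn_banach_closed_point
        (convex_convexHull ℝ _) ((V.finite_toSet).isClosed_convexHull ℝ) hxn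
      obtain ⟨w, hw⟩ := dual_vec f
      have hs : 0 < s := by
        have := hfs 0 (interior_subset h0)
        simpa using this
      have hwT : s⁻¹ • w ∈ T := by
        intro v
        have := hfs v (subset_convexHull ℝ _ v.2)
        rw [hw, dotProduct_comm] at this
        simp only [dotProduct_smul, smul_eq_mul, Pi.one_apply]
        rw [inv_mul_le_iff₀ hs]
        linarith
      have hsub : closure (convexHull ℝ (T.extremePoints ℝ)) ⊆ {y | x ⬝ᵥ y ≤ 1} := by
        refine closure_minimal (convexHull_min ?_ (half_convex x 1))
          (isClosed_le (dot_cont x) continuous_const)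
        intro y hy
        have := hx ⟨y, by simpa using hy⟩
        show x ⬝ᵥ y ≤ 1
        rw [dotProduct_comm]
        simpa using this
      rw [closure_convexHull_extremePoints hTc (PP_convex _ _)] at hsub
      have h3 : x ⬝ᵥ (s⁻¹ • w) ≤ 1 := hsub hwT
      rw [dotProduct_comm] at h3
      simp only [smul_dotProduct, smul_eq_mul] at h3
      rw [inv_mul_le_iff₀ hs] at h3
      rw [hw] at hsx
      linarith
  · intro k
    have hk : (k : Fin n → ℝ) ∈ T.extremePoints ℝ := hfin.mem_toFinset.1 k.2
    by_contra hno
    push Not at hno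
    have := ext_sep hk (Pi.single ⟨0, hn⟩ 1) (fun v hv => by
      exfalso
      apply hno v v.2
      rw [dotProduct_comm]
      simpa using hv)
    simpa using this

variable {ι : Type} [Fintype ι] [DecidableEq ι]

lemma weak_parts (X : Fan n ι) {κ : Type} [Fintype κ] (V : κ → Finset (Fin n → ℝ))
    (hne : ∀ i, (V i).Nonempty)
    (hQ : ∑ i, convexHull ℝ (V i : Set (Fin n → ℝ)) = PP X.u 1)
    (hact : ∀ k, ∃ x ∈ PP X.u 1, X.u k ⬝ᵥ x = 1)
    (hx : ∀ σ ∈ X.S, X.xv σ 1 ∈ PP X.u 1) :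
    ∃ q : κ → ι → ℝ, ∀ i, X.Weak (q i) ∧
      PP X.u (q i) = convexHull ℝ (V i : Set (Fin n → ℝ)) := by
  have hm : ∀ i k, ∃ v ∈ V i, ∀ v' ∈ V i, X.u k ⬝ᵥ v' ≤ X.u k ⬝ᵥ v :=
    fun i k => exists_max_image (V i) (fun v => X.u k ⬝ᵥ v) (hne i)
  choose m hmV hmax using hm
  let q : κ → ι → ℝ := fun i k => X.u k ⬝ᵥ m i k
  have hle : ∀ i, ∀ y ∈ convexHull ℝ (V i : Set (Fin n → ℝ)), ∀ k, X.u k ⬝ᵥ y ≤ q i k := by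
    intro i y hy k
    have : convexHull ℝ (V i : Set (Fin n → ℝ)) ⊆ {x | X.u k ⬝ᵥ x ≤ q i k} :=
      convexHull_min (fun v hv => hmax i k v hv) (half_convex _ _)
    exact this hy
  have hsum : ∀ k, ∑ i, q i k = 1 := by
    intro k
    apply le_antisymm
    · have : ∑ i, m i k ∈ ∑ i, convexHull ℝ (V i : Set (Fin n → ℝ)) :=
        Set.finsetSum_mem_finsetSum _ _ _ fun i _ => subset_convexHull ℝ _ (hmV i k)
      rw [hQ] at this
      have := this k
      rwa [dotProduct_sum] at this
    · obtain ⟨x, hx, hk⟩ := hact k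
      rw [← hQ, Set.mem_finsetSum] at hx
      obtain ⟨g, hg, rfl⟩ := hx
      rw [dotProduct_sum] at hk
      rw [← hk]
      exact sum_le_sum fun i _ => hle i _ (hg (mem_univ i)) k
  have hy : ∀ σ ∈ X.S, ∀ i, X.xv σ (q i) ∈ convexHull ℝ (V i : Set (Fin n → ℝ)) := by
    intro σ hσ i
    have := hx σ hσ
    rw [← hQ, Set.mem_finsetSum] at this
    obtain ⟨y, hy, hxy⟩ := this
    have heq : ∀ k ∈ σ, ∀ i, X.u k ⬝ᵥ y i = q i k := by
      intro k hk
      have h1 : ∑ i, X.u k ⬝ᵥ y i = ∑ i, q i k := by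
        rw [hsum, ← dotProduct_sum, hxy, Fan.dot_xv hσ hk]; rfl
      have := (sum_eq_sum_iff_of_le (s := univ) (fun i _ => hle i _ (hy (mem_univ i)) k)).1 h1
      exact fun i => this i (mem_univ i)
    have : X.xv σ (q i) = y i := by
      rw [X.expand σ hσ (y i)]
      exact sum_congr rfl fun k hk => by rw [heq k hk i]
    rw [this]
    exact hy (mem_univ i)
  refine ⟨q, fun i => ?_⟩
  have hw : X.Weak (q i) := fun σ hσ k => hle i _ (hy σ hσ i) k
  refine ⟨hw, Set.Subset.antisymm ?_ (fun y h k => hle i y h k)⟩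
  rw [← hw.hull]
  refine convexHull_min ?_ (convex_convexHull ℝ _)
  intro v hv
  obtain ⟨σ, hσ, rfl⟩ := Fan.mem_VV.1 hv
  exact hy σ hσ i

lemma approx0 (hn : 1 ≤ n) (A : Fin n → Set (Fin n → ℝ)) (hc : ∀ i, IsCompact (A i))
    (hv : ∀ i, Convex ℝ (A i)) (h0 : ∀ i, 0 ∈ A i) {ε : ℝ} (hε : 0 < ε) :
    ∃ (U : Finset (Fin n → ℝ)) (X : Fan n U) (h : Fin n → U → ℝ), ∀ i, h i ∈ X.CC ∧
      A i ⊆ PP X.u (h i) ∧ ∀ x ∈ PP X.u (h i), ∃ a ∈ A i, dist x a ≤ ε := by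
  classical
  have hV : ∀ i, ∃ V : Finset (Fin n → ℝ), A i ⊆ interior (convexHull ℝ (V : Set (Fin n → ℝ))) ∧
      convexHull ℝ (V : Set (Fin n → ℝ)) ⊆ Metric.thickening (ε/2) (A i) := fun i =>
    (hv i).exists_subset_interior_convexHull_finset_of_isCompact (hc i)
      (Metric.thickening_mem_nhdsSet _ (by positivity))
  choose V hV1 hV2 using hV
  have hne : ∀ i, (V i).Nonempty := by
    intro i
    have := interior_subset (hV1 i (h0 i))
    rw [← Finset.coe_nonempty, ← convexHull_nonempty_iff (𝕜 := ℝ)]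
    exact ⟨_, this⟩
  have hsumV : convexHull ℝ ((∑ i, V i : Finset (Fin n → ℝ)) : Set (Fin n → ℝ)) =
      ∑ i, convexHull ℝ (V i : Set (Fin n → ℝ)) := by
    rw [Finset.coe_sum, convexHull_sum]
  let i0 : Fin n := ⟨0, hn⟩
  have hint : (0 : Fin n → ℝ) ∈
      interior (convexHull ℝ ((∑ i, V i : Finset (Fin n → ℝ)) : Set (Fin n → ℝ))) := by
    refine interior_mono ?_ (hV1 i0 (h0 i0))
    rw [hsumV]
    intro x hx
    rw [Set.mem_finsetSum]
    refine ⟨Pi.single i0 x, fun {i} _ => ?_, by simp⟩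
    by_cases h : i = i0
    · subst h; simpa using hx
    · rw [Pi.single_eq_of_ne h]; exact interior_subset (hV1 i (h0 i))
  obtain ⟨U, hU1, hU2⟩ := polar hn _ hint
  have hcomp : IsCompact (PP (fun k : U => (k : Fin n → ℝ)) 1) := by
    rw [← hU1]; exact (Finset.finite_toSet _).isCompact_convexHull ℝ
  obtain ⟨X, hXu, ⟨g, hg, hgp⟩, hX⟩ := fan_of _ hcomp
  rw [← hXu] at hU1 hX
  obtain ⟨q, hq⟩ := weak_parts X V hne (by rw [← hU1, hsumV]) (fun k => by
    obtain ⟨v, hv, hk⟩ := hU2 k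
    refine ⟨v, ?_, ?_⟩
    · rw [← hU1]; exact subset_convexHull ℝ _ hv
    · rw [hXu]; exact hk) hX
  obtain ⟨R, hR⟩ := (X.PP_compact g).isBounded.subset_closedBall 0
  set R' := max R 1 with hR'
  have hR'0 : 0 < R' := lt_of_lt_of_le one_pos (le_max_right _ _)
  set t := ε / 2 / R' with ht
  have htp : 0 < t := by positivity
  have hg0 : (0 : Fin n → ℝ) ∈ PP X.u g := fun k => by simpa using (hgp k).1.le
  refine ⟨U, X, fun i => q i + t • g, fun i => ⟨Fan.CC_add_weak (Fan.CC_smul hg htp) (hq i).1, ?_⟩⟩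
  have hPP : PP X.u (q i + t • g) = convexHull ℝ (V i : Set (Fin n → ℝ)) + t • PP X.u g := by
    rw [(hq i).1.PP_add ((Fan.weak_of_mem hg).smul htp.le), (hq i).2, Fan.PP_smul _ htp]
  rw [hPP]
  constructor
  · intro x hx
    exact ⟨x, interior_subset (hV1 i hx), 0, ⟨0, hg0, by simp⟩, by simp⟩
  · rintro _ ⟨x, hx, _, ⟨y, hy, rfl⟩, rfl⟩
    obtain ⟨a, ha, hxa⟩ := Metric.mem_thickening_iff.1 (hV2 i hx)
    refine ⟨a, ha, ?_⟩
    have hyR : ‖y‖ ≤ R' := by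
      have := hR hy
      rw [mem_closedBall_zero_iff] at this
      exact this.trans (le_max_left _ _)
    have h1 : ‖t • y‖ ≤ ε/2 := by
      rw [norm_smul, Real.norm_eq_abs, abs_of_pos htp]
      calc t * ‖y‖ ≤ t * R' := by gcongr
        _ = ε / 2 := by rw [ht]; field_simp
    show dist (x + t • y) a ≤ ε
    calc dist (x + t • y) a ≤ dist (x + t • y) x + dist x a := dist_triangle _ _ _
      _ ≤ ε/2 + ε/2 := by
        gcongr
        simpa [dist_eq_norm] using h1
      _ = ε := by ring

lemma approx (hn : 1 ≤ n) (A : Fin n → Set (Fin n → ℝ)) (hc : ∀ i, IsCompact (A i))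
    (hv : ∀ i, Convex ℝ (A i)) (hne : ∀ i, (A i).Nonempty) {ε : ℝ} (hε : 0 < ε) :
    ∃ (U : Finset (Fin n → ℝ)) (X : Fan n U) (h : Fin n → U → ℝ), ∀ i, h i ∈ X.CC ∧
      A i ⊆ PP X.u (h i) ∧ ∀ x ∈ PP X.u (h i), ∃ a ∈ A i, dist x a ≤ ε := by
  choose a ha using hne
  obtain ⟨U, X, h, H⟩ := approx0 hn (fun i => (-a i) +ᵥ A i) (fun i => (hc i).vadd _)
    (fun i => (hv i).vadd _) (fun i => ⟨a i, ha i, by simp⟩) hε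
  have hw : ∀ i, X.Weak (fun k => X.u k ⬝ᵥ a i) := by
    intro i σ hσ k
    have : X.xv σ (fun k => X.u k ⬝ᵥ a i) = a i := (X.expand σ hσ (a i)).symm
    rw [this]
  have hP : ∀ i x, x ∈ PP X.u ((fun k => X.u k ⬝ᵥ a i) + h i) ↔ x - a i ∈ PP X.u (h i) := by
    intro i x
    refine forall_congr' fun k => ?_
    rw [dotProduct_sub, Pi.add_apply, sub_le_iff_le_add']
  refine ⟨U, X, fun i => (fun k => X.u k ⬝ᵥ a i) + h i, fun i =>
    ⟨Fan.CC_add_weak (H i).1 (hw i), ?_, ?_⟩⟩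
  · intro x hx
    rw [hP]
    exact (H i).2.1 ⟨x, hx, by simp; abel⟩
  · intro x hx
    rw [hP] at hx
    obtain ⟨_, ⟨y, hy, rfl⟩, hd⟩ := (H i).2.2 _ hx
    refine ⟨y, hy, ?_⟩
    simpa [dist_eq_norm, sub_eq_add_neg, add_assoc] using hd
end construct
end AF

namespace AF

section final
variable {n : ℕ}

lemma vol_tendsto {κ : Type} (S : Finset κ) (A : κ → Set (Fin n → ℝ)) (hc : ∀ i, IsCompact (A i))
    (B : ℕ → κ → Set (Fin n → ℝ)) (h1 : ∀ k i, A i ⊆ B k i)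
    (h2 : ∀ k i, ∀ x ∈ B k i, ∃ a ∈ A i, dist x a ≤ 1 / ((k:ℝ) + 1)) :
    Filter.Tendsto (fun k => vol (∑ i ∈ S, B k i)) Filter.atTop (nhds (vol (∑ i ∈ S, A i))) := by
  have hcomp : IsCompact (∑ i ∈ S, A i) := isCompact_sum' S A fun i _ => hc i
  have hr : Filter.Tendsto (fun k : ℕ => (S.card : ℝ) * (1 / ((k:ℝ) + 1))) Filter.atTop (nhds 0) := by
    simpa using (tendsto_one_div_add_atTop_nhds_zero_nat (𝕜 := ℝ)).const_mul (S.card : ℝ)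
  have ht := (tendsto_measure_cthickening_of_isCompact (μ := volume) hcomp).comp hr
  have hm : Filter.Tendsto (fun k => volume (∑ i ∈ S, B k i)) Filter.atTop
      (nhds (volume (∑ i ∈ S, A i))) := by
    refine tendsto_of_tendsto_of_tendsto_of_le_of_le tendsto_const_nhds ht ?_ ?_
    · intro k
      apply measure_mono
      intro x hx
      rw [Set.mem_finsetSum] at hx ⊢
      obtain ⟨g, hg, rfl⟩ := hx
      exact ⟨g, fun hi => h1 k _ (hg hi), rfl⟩
    · intro k
      apply measure_mono
      intro x hx
      rw [Set.mem_finsetSum] at hx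
      obtain ⟨g, hg, rfl⟩ := hx
      have : ∀ i : κ, ∃ a : Fin n → ℝ, i ∈ S → a ∈ A i ∧ dist (g i) a ≤ 1 / ((k:ℝ) + 1) := by
        intro i
        by_cases hi : i ∈ S
        · obtain ⟨a, ha, hd⟩ := h2 k i _ (hg hi)
          exact ⟨a, fun _ => ⟨ha, hd⟩⟩
        · exact ⟨0, fun h => absurd h hi⟩
      choose a ha using this
      refine Metric.mem_cthickening_of_dist_le _ (∑ i ∈ S, a i) _ _
        (Set.finsetSum_mem_finsetSum _ _ _ fun i hi => (ha i hi).1) ?_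
      calc dist (∑ i ∈ S, g i) (∑ i ∈ S, a i) ≤ ∑ i ∈ S, dist (g i) (a i) := dist_sum_sum_le _ _ _
        _ ≤ ∑ i ∈ S, 1 / ((k:ℝ) + 1) := sum_le_sum fun i hi => (ha i hi).2
        _ = _ := by simp
  exact (ENNReal.tendsto_toReal hcomp.measure_lt_top.ne).comp hm

lemma MV_tendsto (A : Fin n → Set (Fin n → ℝ)) (hc : ∀ i, IsCompact (A i))
    (B : ℕ → Fin n → Set (Fin n → ℝ)) (h1 : ∀ k i, A i ⊆ B k i)
    (h2 : ∀ k i, ∀ x ∈ B k i, ∃ a ∈ A i, dist x a ≤ 1 / ((k:ℝ) + 1)) :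
    Filter.Tendsto (fun k => MV n (B k)) Filter.atTop (nhds (MV n A)) := by
  unfold MV
  exact tendsto_finsetSum _ fun j _ => (tendsto_finsetSum _ fun S _ =>
    vol_tendsto S A hc B h1 h2).const_mul _

lemma MV_eq_dF {ι : Type} (hn : 1 ≤ n) (Φ : (ι → ℝ) → ℝ) (h0 : Φ 0 = 0) (B : Fin n → Set (Fin n → ℝ))
    (h : Fin n → ι → ℝ) (H : ∀ S : Finset (Fin n), S.Nonempty → vol (∑ i ∈ S, B i) = Φ (∑ i ∈ S, h i)) :
    MV n B = dF univ h Φ 0 := by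
  unfold MV dF
  rw [sum_powerset, card_univ, Fintype.card_fin]
  have hsub : Finset.Icc 1 n ⊆ range (n + 1) := by
    intro j hj
    rw [Finset.mem_Icc] at hj
    rw [Finset.mem_range]; omega
  rw [← sum_subset hsub]
  · refine sum_congr rfl fun j hj => ?_
    rw [mul_sum]
    refine sum_congr rfl fun S hS => ?_
    rw [Finset.mem_Icc] at hj
    have hS' := (mem_powersetCard.1 hS).2
    rw [H S (card_pos.1 (by omega)), hS', zero_add]
  · intro j hj hj'
    rw [Finset.mem_range] at hj
    rw [Finset.mem_Icc] at hj'
    have : j = 0 := by omega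
    subst this
    simp [h0]

lemma univ_split {α : Type} {p m : ℕ} (hm : p + m = n) (g : Fin n → α) :
    (univ : Finset (Fin n)).val.map g = (univ : Finset (Fin p)).val.map (fun i => g ⟨i.1, by have := i.2; omega⟩) +
      (univ : Finset (Fin m)).val.map (fun j => g ⟨p + j.1, by have := j.2; omega⟩) := by
  subst hm
  rw [← Multiset.map_univ_val_equiv (finSumFinEquiv (m := p) (n := m)), ← Finset.univ_disjSum_univ,
    Finset.val_disjSum, Multiset.disjSum]
  simp only [Multiset.map_add, Multiset.map_map]
  rfl

lemma hodge_fan {ι : Type} [Fintype ι] [DecidableEq ι] (X : Fan n ι) (h : Fin n → ι → ℝ)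
    (hh : ∀ i, h i ∈ X.CC) {p : ℕ} (hp1 : 1 ≤ p) (hpn : p ≤ n) :
    ∏ i : Fin p, MV n (fun j => PP X.u (h (if j.1 < p then Fin.castLE hpn i else j))) ≤
      MV n (fun j => PP X.u (h j)) ^ p := by
  have hn : 1 ≤ n := hp1.trans hpn
  obtain ⟨σ, hσ, -⟩ := X.max 0
  have hne : Nonempty ι := by
    have := X.card σ hσ
    obtain ⟨x, -⟩ := card_pos.1 (show 0 < σ.card by omega)
    exact ⟨x⟩
  have hCne : X.CC.Nonempty := ⟨_, hh ⟨0, hn⟩⟩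
  obtain ⟨f, hf, hfv⟩ := X.exists_poly hCne
  have G := X.good hCne hf hfv
  have hcc : ∀ φ : Fin n → Fin n, MV n (fun j => PP X.u (h (φ j))) =
      cc ((univ : Finset (Fin n)).val.map fun j => h (φ j)) f := by
    intro φ
    rw [← polarization univ (fun j => h (φ j)) (by simpa using hf)]
    refine MV_eq_dF hn _ ?_ _ _ ?_
    · show MvPolynomial.eval 0 f = 0
      have h1 : MvPolynomial.coeff 0 f = 0 := hf.coeff_eq_zero (by simp; omega)
      rw [← MvPolynomial.constantCoeff_eq] at h1
      rw [← h1, MvPolynomial.eval_zero]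
    · intro S hS
      have hw : ∀ T : Finset (Fin n), _ := fun T => Fan.weak_sum (X := X) T (fun j => h (φ j))
        (fun i _ => Fan.weak_of_mem (hh _))
      have hmem : ∑ i ∈ S, h (φ i) ∈ X.CC := by
        obtain ⟨i, hi⟩ := hS
        rw [← sum_erase_add _ _ hi]
        exact Fan.CC_add_weak (hh _) (hw _).1
      show (volume _).toReal = MvPolynomial.eval _ f
      rw [hfv _ hmem, (hw S).2]
  have hm : p + (n - p) = n := by omega
  have := G.hodge ⟨σ, hσ, by simp⟩ ((univ : Finset (Fin (n - p))).val.map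
    fun j => h ⟨p + j.1, by have := j.2; omega⟩) (by
      intro v hv
      obtain ⟨j, -, rfl⟩ := Multiset.mem_map.1 hv
      exact hh _) (by simpa using hm) (fun i : Fin p => h (Fin.castLE hpn i)) (fun i => hh _)
  have e0 := hcc id
  simp only [id] at e0
  rw [e0, univ_split hm]
  refine le_trans (le_of_eq (prod_congr rfl fun i _ => ?_)) this
  rw [hcc, univ_split hm]
  congr 2
  · refine Multiset.map_congr rfl fun j _ => ?_
    simp
  · refine Multiset.map_congr rfl fun j _ => ?_
    simp

theorem hodge_main (A : Fin n → Set (Fin n → ℝ)) (hc : ∀ i, IsCompact (A i))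
    (hv : ∀ i, Convex ℝ (A i)) (hne : ∀ i, (A i).Nonempty) {p : ℕ} (hp1 : 1 ≤ p) (hpn : p ≤ n) :
    ∏ i : Fin p, MV n (fun j => A (if j.1 < p then Fin.castLE hpn i else j)) ≤ MV n A ^ p := by
  have H := fun k : ℕ => approx (hp1.trans hpn) A hc hv hne (ε := 1 / ((k:ℝ) + 1)) (by positivity)
  choose U X h H using H
  have key : ∀ φ : Fin n → Fin n, Filter.Tendsto (fun k => MV n (fun j => PP (X k).u (h k (φ j))))
      Filter.atTop (nhds (MV n (fun j => A (φ j)))) := fun φ =>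
    MV_tendsto (fun j => A (φ j)) (fun j => hc _) (fun k j => PP (X k).u (h k (φ j)))
      (fun k j => (H k _).2.1) (fun k j => (H k _).2.2)
  refine le_of_tendsto_of_tendsto' (tendsto_finsetProd _ fun i _ => key _) ((key id).pow p) fun k => ?_
  exact hodge_fan (X k) (h k) (fun i => (H k i).1) hp1 hpn
end final
end AF

/-- Generalized Hodge type inequality (Theorem 7.3):
`MV(K₁, …, K_p, L₁, …, L_{n−p})^p ≥ Π_{i=1}^{p} MV(K_i^{(p)}, L₁, …, L_{n−p})`. -/
theorem generalized_hodge {n p : ℕ} (hp1 : 1 ≤ p) (hpn : p ≤ n)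
    (K : Fin p → Set (Fin n → ℝ)) (L : Fin (n - p) → Set (Fin n → ℝ))
    (hKne : ∀ i, (K i).Nonempty) (hKc : ∀ i, IsCompact (K i)) (hKcv : ∀ i, Convex ℝ (K i))
    (hLne : ∀ i, (L i).Nonempty) (hLc : ∀ i, IsCompact (L i)) (hLcv : ∀ i, Convex ℝ (L i)) :
    MV n (combine hpn K L) ^ p ≥ ∏ i : Fin p, MV n (combine hpn (fun _ => K i) L) := by
  have hA : ∀ (P : Set (Fin n → ℝ) → Prop), (∀ i, P (K i)) → (∀ i, P (L i)) →
      ∀ i, P (combine hpn K L i) := by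
    intro P h1 h2 i
    unfold combine
    split_ifs
    · exact h1 _
    · exact h2 _
  have := AF.hodge_main (combine hpn K L) (hA _ hKc hLc) (hA _ hKcv hLcv) (hA _ hKne hLne) hp1 hpn
  refine ge_iff_le.2 (le_trans (le_of_eq (prod_congr rfl fun i _ => ?_)) this)
  congr 1
  funext j
  by_cases hj : (j : ℕ) < p
  · simp [combine, hj]
  · simp [combine, hj]
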